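/- For all integers k ≥ 2 and 1 ≤ d ≤ k−1 and every real μ > 0, there exists n_0 such that every k-graph H on n ≥ n_0 vertices whose minimum relative d-degree is at least 2^(−1/(k−d)) + μ contains a tight Hamilton cycle. (Equivalently, the minimum d-degree threshold for tight Hamilton cycles satisfies hc_d(k) ≤ 2^(−1/(k−d)).) -/

import Mathlib

open Finset

variable {A : Type*} [DecidableEq A]

/-- The set of vertices occupying positions `i, …, i+k-1` of the walk `w`. -/
def walkEdgeAt (k : ℕ) (w : List A) (i : ℕ) : Finset A :=
  ((w.drop i).take k).toFinset

/-- `w` is a tight walk in the `k`-graph with edge set `E`: it has at least `k`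
vertices and every `k` consecutive vertices form an edge of `E`. -/
def IsTightWalk (k : ℕ) (E : Finset (Finset A)) (w : List A) : Prop :=
  k ≤ w.length ∧ ∀ i, i + k ≤ w.length → walkEdgeAt k w i ∈ E

/-- The edge `e` appears on the walk `w` (as `k` consecutive vertices). -/
def EdgeOnWalk (k : ℕ) (w : List A) (e : Finset A) : Prop :=
  ∃ i, i + k ≤ w.length ∧ walkEdgeAt k w i = e

/-- A `k`-uniform edge set is tightly connected if any two of its edges lie on a
common tight walk all of whose edges belong to it. -/
def TightlyConnected (k : ℕ) (E : Finset (Finset A)) : Prop :=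
  ∀ e₁ ∈ E, ∀ e₂ ∈ E, ∃ w : List A, IsTightWalk k E w ∧ EdgeOnWalk k w e₁ ∧ EdgeOnWalk k w e₂

/-- `w` is a closed tight walk: every cyclic interval of `k` consecutive vertices
forms an edge of `E`.  Its length is `w.length`. -/
def IsClosedTightWalk (k : ℕ) (E : Finset (Finset A)) (w : List A) : Prop :=
  k ≤ w.length ∧ ∀ i < w.length, ((w.rotate i).take k).toFinset ∈ E

/-- A tight Hamilton cycle: a cyclic ordering of all the vertices in which every `k`
cyclically consecutive vertices form an edge. -/
def HasTightHamCycle (k : ℕ) (V : Finset A) (E : Finset (Finset A)) : Prop :=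
  ∃ w : List A, w.Nodup ∧ w.toFinset = V ∧ IsClosedTightWalk k E w

/-- The `j`-th shadow: all `j`-element sets contained in some edge. -/
def shadow (j : ℕ) (E : Finset (Finset A)) : Finset (Finset A) :=
  E.biUnion fun e => e.powersetCard j

/-- The link graph of `S`: the `(k-d)`-graph whose edges are `e \ S` for edges `e ⊇ S`. -/
def link (S : Finset A) (E : Finset (Finset A)) : Finset (Finset A) :=
  (E.filter fun e => S ⊆ e).image fun e => e \ S

/-- `E` has a fractional matching of size at least `m`. -/
def HasFracMatching (E : Finset (Finset A)) (m : ℝ) : Prop :=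
  ∃ w : Finset A → ℝ,
    (∀ e ∈ E, 0 ≤ w e ∧ w e ≤ 1) ∧
    (∀ v : A, ∑ e ∈ E.filter (fun e' => v ∈ e'), w e ≤ 1) ∧
    m ≤ ∑ e ∈ E, w e

/-- `E` has a `b`-fractional matching of size at least `m` (vertex constraints on `V`). -/
def HasBFracMatching (V : Finset A) (E : Finset (Finset A)) (b : A → ℝ) (m : ℝ) : Prop :=
  ∃ w : Finset A → ℝ,
    (∀ e ∈ E, 0 ≤ w e ∧ w e ≤ 1) ∧
    (∀ v ∈ V, ∑ e ∈ E.filter (fun e' => v ∈ e'), w e ≤ b v) ∧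
    m ≤ ∑ e ∈ E, w e

/-- `γ`-robustly matchable: every vertex weighting with values in `[1-γ,1]` is realised
exactly by an edge weighting with values in `[0,1]`. -/
def RobustlyMatchable (γ : ℝ) (V : Finset A) (E : Finset (Finset A)) : Prop :=
  ∀ b : A → ℝ, (∀ v ∈ V, 1 - γ ≤ b v ∧ b v ≤ 1) →
    ∃ w : Finset A → ℝ, (∀ e ∈ E, 0 ≤ w e ∧ w e ≤ 1) ∧
      ∀ v ∈ V, ∑ e ∈ E.filter (fun e' => v ∈ e'), w e = b v

/-- A switcher: an edge `e` with a central vertex `a` such that for every `b ∈ e`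
there is `c ∉ e` with `(e ∪ {c}) \ {a}` and `(e ∪ {c}) \ {b}` both edges. -/
def HasSwitcher (C : Finset (Finset A)) : Prop :=
  ∃ e ∈ C, ∃ a ∈ e, ∀ b ∈ e, ∃ c, c ∉ e ∧
    insert c (e.erase a) ∈ C ∧ insert c (e.erase b) ∈ C

/-- An arc for the `d`-vicinity `C` of the `k`-graph with edge set `E`: a tuple of
`k+1` distinct vertices `v₁, …, v_{k+1}` with `{v₁,…,v_d} ∈ ∂_d`,
`{v_{d+1},…,v_k} ∈ C {v₁,…,v_d}`, `{v₂,…,v_{d+1}} ∈ ∂_d` and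
`{v_{d+2},…,v_{k+1}} ∈ C {v₂,…,v_{d+1}}`. -/
def HasArc (k d : ℕ) (E : Finset (Finset A)) (C : Finset A → Finset (Finset A)) : Prop :=
  ∃ l : List A, l.length = k + 1 ∧ l.Nodup ∧
    (l.take d).toFinset ∈ shadow d E ∧
    ((l.drop d).take (k - d)).toFinset ∈ C ((l.take d).toFinset) ∧
    ((l.drop 1).take d).toFinset ∈ shadow d E ∧
    (l.drop (d + 1)).toFinset ∈ C (((l.drop 1).take d).toFinset)

/-- The `k`-graph generated by a `d`-vicinity: all sets `B ∪ S` with `S ∈ ∂_d(E)`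
and `B ∈ C S`. -/
def generatedEdges (d : ℕ) (E : Finset (Finset A)) (C : Finset A → Finset (Finset A)) :
    Finset (Finset A) :=
  (shadow d E).biUnion fun S => (C S).image fun B => B ∪ S

/-- `α`-perturbed minimum relative `d`-degree at least `δ` for a `k`-graph on vertex
set `V` with edge set `E`. -/
def PerturbedDegLB (k d : ℕ) (a δ : ℝ) (V : Finset A) (E : Finset (Finset A)) : Prop :=
  ∀ j : ℕ, 1 ≤ j → j ≤ d →
    (∀ S ∈ shadow j E,
      δ * (((V.card - j).choose (k - j) : ℕ) : ℝ) ≤ ((E.filter fun e => S ⊆ e).card : ℝ)) ∧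
    ((((V.powersetCard j).filter fun S => S ∉ shadow j E).card : ℝ)
        ≤ a * ((V.card.choose j : ℕ) : ℝ)) ∧
    (∀ T : Finset A, (T ∈ shadow (j - 1) E ∨ (j = 1 ∧ T = ∅)) →
      ((((V.powersetCard j).filter fun S => T ⊆ S ∧ S ∉ shadow j E).card : ℝ)
        < a * ((V.card : ℝ) - (j : ℝ) + 1)))

/-- A `(γ, δ)`-Hamilton `d`-vicinity of a `k`-graph on `t = V.card` vertices. -/
def IsHamVicinity (k d : ℕ) (γ δ : ℝ) (V : Finset A) (E : Finset (Finset A))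
    (C : Finset A → Finset (Finset A)) : Prop :=
  (∀ S ∈ shadow d E, C S ⊆ link S E) ∧
  (∀ S ∈ shadow d E, TightlyConnected (k - d) (C S)) ∧
  (∀ S ∈ shadow d E, ∀ S' ∈ shadow d E, (C S ∩ C S').Nonempty) ∧
  (∀ S ∈ shadow d E, HasSwitcher (C S)) ∧
  HasArc k d E C ∧
  (∀ S ∈ shadow d E, HasFracMatching (C S) ((1 / (k : ℝ) + γ) * (V.card : ℝ))) ∧
  (∀ S ∈ shadow d E, (1 - δ + γ) * ((V.card.choose (k - d) : ℕ) : ℝ) ≤ ((C S).card : ℝ))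

/-- An `(a, γ, δ)`-Hamilton framework: a subgraph on vertex set `VH` with edge set `EH`
of a `k`-graph on vertex set `VR`, satisfying (F1)–(F5). -/
def IsHamFramework (k : ℕ) (a γ δ : ℝ) (VR VH : Finset A) (EH : Finset (Finset A)) : Prop :=
  (1 - a) * (VR.card : ℝ) ≤ (VH.card : ℝ) ∧
  TightlyConnected k EH ∧
  (∃ w : List A, IsClosedTightWalk k EH w ∧ w.length % k = 1 % k) ∧
  RobustlyMatchable γ VH EH ∧
  (∀ v ∈ VH, (1 - δ + γ) * (((VH.card - 1).choose (k - 1) : ℕ) : ℝ)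
      ≤ ((EH.filter fun e => v ∈ e).card : ℝ))

/-- A tight component: an edge-maximal tightly connected subgraph. -/
def IsTightComponent (k : ℕ) (E C : Finset (Finset A)) : Prop :=
  C ⊆ E ∧ TightlyConnected k C ∧
    ∀ C' : Finset (Finset A), C ⊆ C' → C' ⊆ E → TightlyConnected k C' → C' = C

/-- `δ` has the `(k,d)`-Hamilton-cycle property. -/
def HamCycleProp (k d : ℕ) (δ : ℝ) : Prop :=
  ∀ μ : ℝ, 0 < μ → ∃ n₀ : ℕ, ∀ (B : Type) [DecidableEq B],
    ∀ (V : Finset B) (E : Finset (Finset B)),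
      n₀ ≤ V.card → (∀ e ∈ E, e ⊆ V ∧ e.card = k) →
      (∀ S ⊆ V, S.card = d →
        (δ + μ) * (((V.card - d).choose (k - d) : ℕ) : ℝ)
          ≤ ((E.filter fun e => S ⊆ e).card : ℝ)) →
      HasTightHamCycle k V E

/-- `δ` has the `(k,d)`-Hamilton-framework property. -/
def HamFrameworkProp (k d : ℕ) (δ : ℝ) : Prop :=
  ∀ μ : ℝ, 0 < μ → ∃ γ₀ : ℝ, 0 < γ₀ ∧ ∀ γ : ℝ, 0 < γ → γ ≤ γ₀ →
    ∃ α₀ : ℝ, 0 < α₀ ∧ ∀ a : ℝ, 0 < a → a ≤ α₀ →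
      ∃ ε₀ : ℝ, 0 < ε₀ ∧ ∀ ε : ℝ, 0 < ε → ε ≤ ε₀ →
        ∃ t₀ : ℕ, ∀ t : ℕ, t₀ ≤ t →
          ∀ (B : Type) [DecidableEq B], ∀ (VR : Finset B) (ER : Finset (Finset B)),
            VR.card = t → (∀ e ∈ ER, e ⊆ VR ∧ e.card = k) →
            (∀ S ⊆ VR, S.card = d →
              (δ + μ) * (((t - d).choose (k - d) : ℕ) : ℝ)
                ≤ ((ER.filter fun e => S ⊆ e).card : ℝ)) →
            ∀ I : Finset (Finset B), I ⊆ ER → (I.card : ℝ) ≤ ε * ((t.choose k : ℕ) : ℝ) →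
              ∃ (VH : Finset B) (EH : Finset (Finset B)),
                VH ⊆ VR ∧ EH ⊆ ER ∧ (∀ e ∈ EH, e ⊆ VH) ∧ (∀ e ∈ EH, e ∉ I) ∧
                IsHamFramework k a γ δ VR VH EH

/-- `δ` has the `(k,d)`-Hamilton-vicinity property. -/
def HamVicinityProp (k d : ℕ) (δ : ℝ) : Prop :=
  ∀ μ : ℝ, 0 < μ → ∃ γ₀ : ℝ, 0 < γ₀ ∧ ∀ γ : ℝ, 0 < γ → γ ≤ γ₀ →
    ∃ α₀ : ℝ, 0 < α₀ ∧ ∀ a : ℝ, 0 < a → a ≤ α₀ →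
      ∃ t₀ : ℕ, ∀ t : ℕ, t₀ ≤ t →
        ∀ (B : Type) [DecidableEq B], ∀ (V : Finset B) (E : Finset (Finset B)),
          V.card = t → (∀ e ∈ E, e ⊆ V ∧ e.card = k) →
          PerturbedDegLB k d a (δ + μ) V E →
          (∀ v ∈ V, ∃ e ∈ E, v ∈ e) →
          ∃ C : Finset B → Finset (Finset B), IsHamVicinity k d γ δ V E C


open Finset
set_option linter.all false
namespace TH
open scoped Classical

noncomputable section

def ind (p : Prop) : ℝ := if p then 1 else 0
def ex {α : Type} (f : α → ℝ) : ℝ := (∑ᶠ x, f x) / Nat.card α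
def pr {α : Type} (p : α → Prop) : ℝ := ex (fun x => ind (p x))
lemma ex_eq {α : Type} [Fintype α] (f : α → ℝ) : ex f = (∑ x, f x) / Fintype.card α := by
  unfold ex; rw [finsum_eq_sum_of_fintype, Nat.card_eq_fintype_card]

section basics
variable {α β : Type} [Finite α] [Finite β]

lemma ind_nonneg (p : Prop) : 0 ≤ ind p := by unfold ind; split_ifs <;> norm_num
lemma ind_le_one (p : Prop) : ind p ≤ 1 := by unfold ind; split_ifs <;> norm_num
lemma ind_true {p : Prop} (h : p) : ind p = 1 := by simp [ind, h]
lemma ind_false {p : Prop} (h : ¬ p) : ind p = 0 := by simp [ind, h]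
lemma ind_mono {p q : Prop} (h : p → q) : ind p ≤ ind q := by
  by_cases hp : p
  · rw [ind_true hp, ind_true (h hp)]
  · rw [ind_false hp]; exact ind_nonneg q

lemma ex_mono {f g : α → ℝ} (h : ∀ x, f x ≤ g x) : ex f ≤ ex g := by
  cases nonempty_fintype α; rw [ex_eq, ex_eq]; exact div_le_div_of_nonneg_right (Finset.sum_le_sum fun x _ => h x) (Nat.cast_nonneg _)
lemma ex_nonneg {f : α → ℝ} (h : ∀ x, 0 ≤ f x) : 0 ≤ ex f := by
  cases nonempty_fintype α; rw [ex_eq]; exact div_nonneg (Finset.sum_nonneg fun x _ => h x) (Nat.cast_nonneg _)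
lemma ex_add (f g : α → ℝ) : ex (fun x => f x + g x) = ex f + ex g := by
  cases nonempty_fintype α; simp [ex_eq, Finset.sum_add_distrib, add_div]
lemma ex_sub (f g : α → ℝ) : ex (fun x => f x - g x) = ex f - ex g := by
  cases nonempty_fintype α; simp [ex_eq, Finset.sum_sub_distrib, sub_div]
lemma ex_mul (c : ℝ) (f : α → ℝ) : ex (fun x => c * f x) = c * ex f := by
  cases nonempty_fintype α; simp [ex_eq, ← Finset.mul_sum, mul_div_assoc]
lemma ex_const [Nonempty α] (c : ℝ) : ex (fun _ : α => c) = c := by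
  cases nonempty_fintype α
  have : (Fintype.card α : ℝ) ≠ 0 := by exact_mod_cast Fintype.card_ne_zero
  simp [ex_eq]
lemma ex_sum {ι : Type} (s : Finset ι) (f : ι → α → ℝ) :
    ex (fun x => ∑ i ∈ s, f i x) = ∑ i ∈ s, ex (f i) := by
  cases nonempty_fintype α; simp only [ex_eq]; rw [Finset.sum_comm, Finset.sum_div]
lemma ex_equiv (e : α ≃ β) (f : β → ℝ) : ex (fun x => f (e x)) = ex f := by
  cases nonempty_fintype α; cases nonempty_fintype β; simp only [ex_eq]; rw [Equiv.sum_comp e f, Fintype.card_congr e]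
lemma ex_prod (f : α × β → ℝ) : ex f = ex fun a => ex fun b => f (a, b) := by
  cases nonempty_fintype α; cases nonempty_fintype β; simp only [ex_eq, Fintype.sum_prod_type, Fintype.card_prod, Nat.cast_mul]
  rw [← Finset.sum_div, div_div, mul_comm]
lemma ex_comm (f : α → β → ℝ) : (ex fun a => ex fun b => f a b) = ex fun b => ex fun a => f a b := by
  cases nonempty_fintype α; cases nonempty_fintype β; simp only [ex_eq]; rw [← Finset.sum_div, ← Finset.sum_div, Finset.sum_comm, div_div, div_div, mul_comm]
lemma ex_le_const [Nonempty α] {f : α → ℝ} {c : ℝ} (h : ∀ x, f x ≤ c) : ex f ≤ c :=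
  (ex_mono h).trans_eq (ex_const c)
lemma const_le_ex [Nonempty α] {f : α → ℝ} {c : ℝ} (h : ∀ x, c ≤ f x) : c ≤ ex f :=
  (ex_const c).symm.trans_le (ex_mono h)
lemma exists_ge_of_ex {f : α → ℝ} [Nonempty α] {c : ℝ} (h : c ≤ ex f) : ∃ x, c ≤ f x := by
  by_contra! hc
  obtain ⟨x, hx⟩ := Finite.exists_max f
  exact absurd (h.trans (ex_le_const hx)) (not_le.2 (hc x))
lemma exists_le_of_ex {f : α → ℝ} [Nonempty α] {c : ℝ} (h : ex f ≤ c) : ∃ x, f x ≤ c := by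
  by_contra! hc
  obtain ⟨x, hx⟩ := Finite.exists_min f
  exact absurd ((const_le_ex hx).trans h) (not_le.2 (hc x))

lemma pr_mono {p q : α → Prop} (h : ∀ x, p x → q x) : pr p ≤ pr q := ex_mono fun x => ind_mono (h x)
lemma pr_nonneg (p : α → Prop) : 0 ≤ pr p := ex_nonneg fun _ => ind_nonneg _
lemma pr_le_one (p : α → Prop) : pr p ≤ 1 := by
  rcases isEmpty_or_nonempty α with h | h
  · simp [pr, ex]
  · exact ex_le_const fun x => ind_le_one _
lemma pr_or (p q : α → Prop) : pr (fun x => p x ∨ q x) ≤ pr p + pr q := by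
  unfold pr; rw [← ex_add]; apply ex_mono; intro x
  by_cases h1 : p x <;> by_cases h2 : q x <;> simp [ind, h1, h2]
lemma pr_not [Nonempty α] (p : α → Prop) : pr (fun x => ¬ p x) = 1 - pr p := by
  have := ex_const (α := α) 1
  unfold pr; rw [← this, ← ex_sub]; congr 1; ext x
  by_cases h1 : p x <;> simp [ind, h1]
lemma pr_exists {ι : Type} [Fintype ι] (p : ι → α → Prop) :
    pr (fun x => ∃ i, p i x) ≤ ∑ i, pr (p i) := by
  unfold pr; rw [← ex_sum]; apply ex_mono; intro x
  by_cases h : ∃ i, p i x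
  · obtain ⟨i, hi⟩ := h
    rw [ind_true ⟨i, hi⟩, ← ind_true hi]
    exact Finset.single_le_sum (f := fun i => ind (p i x)) (fun i _ => ind_nonneg _) (mem_univ i)
  · rw [ind_false h]; exact Finset.sum_nonneg fun i _ => ind_nonneg _
lemma pr_exists_le {ι : Type} [Finite ι] (p : ι → α → Prop) (c : ℝ) (h : ∀ i, pr (p i) ≤ c) :
    pr (fun x => ∃ i, p i x) ≤ Nat.card ι * c := by
  cases nonempty_fintype ι
  refine (pr_exists p).trans ((Finset.sum_le_sum fun i _ => h i).trans ?_)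
  simp
lemma pr_sub (p q : α → Prop) : pr p - pr q ≤ pr (fun x => p x ∧ ¬ q x) := by
  have := pr_or (fun x => p x ∧ ¬ q x) q
  have h2 : pr p ≤ pr (fun x => (p x ∧ ¬ q x) ∨ q x) := pr_mono fun x hx => by tauto
  linarith
lemma pr_and (p q : α → Prop) [Nonempty α] : pr p + pr q - 1 ≤ pr (fun x => p x ∧ q x) := by
  have := pr_sub p (fun x => ¬ q x)
  rw [pr_not] at this
  simp only [not_not] at this; linarith
lemma exists_of_pr {p : α → Prop} (h : 0 < pr p) : ∃ x, p x := by
  by_contra! hc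
  have : pr p ≤ 0 := by
    cases nonempty_fintype α
    unfold pr; rw [ex_eq]
    rw [Finset.sum_eq_zero (fun x _ => ind_false (hc x))]; simp
  linarith
lemma exists_and_of_pr [Nonempty α] {p q : α → Prop} (h : 1 < pr p + pr q) : ∃ x, p x ∧ q x :=
  exists_of_pr (by have := pr_and p q; linarith)
lemma pr_true [Nonempty α] {p : α → Prop} (h : ∀ x, p x) : pr p = 1 := by
  unfold pr; simp [ind_true (h _), ex_const]
lemma pr_equiv (e : α ≃ β) (p : β → Prop) : pr (fun x => p (e x)) = pr p :=
  ex_equiv e fun x => ind (p x)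
lemma pr_prod (p : α × β → Prop) : pr p = ex fun a => pr fun b => p (a, b) := ex_prod _
lemma pr_pigeon {κ : Type} [Finite κ] {ρ : ℝ} (Q : κ → α → Prop) (hρ : 0 < ρ)
    (h : ρ ≤ pr (fun x => ∃ c, Q c x)) : ∃ c, ρ / Nat.card κ ≤ pr (Q c) := by
  cases nonempty_fintype κ; rw [Nat.card_eq_fintype_card]
  have hne : Nonempty κ := by
    obtain ⟨x, c, _⟩ := exists_of_pr (hρ.trans_le h); exact ⟨c⟩
  by_contra! hc
  have h1 := pr_exists Q
  have h2 : ∑ i, pr (Q i) < ∑ _i : κ, ρ / Fintype.card κ :=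
    Finset.sum_lt_sum_of_nonempty univ_nonempty fun i _ => hc i
  have : (Fintype.card κ : ℝ) ≠ 0 := by exact_mod_cast Fintype.card_ne_zero
  rw [Finset.sum_const, card_univ, nsmul_eq_mul, mul_div_cancel₀ _ this] at h2
  linarith
/-- Markov type bound -/
lemma markov {f : α → ℝ} (h0 : ∀ x, 0 ≤ f x) {c : ℝ} (hc : 0 < c) :
    pr (fun x => c ≤ f x) ≤ ex f / c := by
  rw [le_div_iff₀ hc, mul_comm]; unfold pr; rw [← ex_mul]
  apply ex_mono; intro x
  by_cases h : c ≤ f x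
  · rw [ind_true h]; linarith
  · rw [ind_false h]; simpa using h0 x
lemma pr_card {α : Type} [Fintype α] (p : α → Prop) [DecidablePred p] : pr p = ((univ.filter p).card : ℝ) / Fintype.card α := by
  unfold pr; rw [ex_eq]; congr 1
  rw [Finset.card_filter]; push_cast; refine Finset.sum_congr rfl fun x _ => ?_
  by_cases h : p x <;> simp [ind, h]
end basics

section arrows
variable {V : Type} [Finite V]
variable {ι κ : Type} [Finite ι] [Finite κ]

lemma ex_sumArrow (f : (ι ⊕ κ → V) → ℝ) :
    ex f = ex fun y : ι → V => ex fun z : κ → V => f (Sum.elim y z) := by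
  rw [← ex_equiv (Equiv.sumArrowEquivProdArrow ι κ V).symm f, ex_prod]; rfl
lemma ex_arrowCongr (e : ι ≃ κ) (f : (ι → V) → ℝ) :
    ex f = ex fun x : κ → V => f (x ∘ e) := by
  rw [← ex_equiv (Equiv.arrowCongr e.symm (Equiv.refl V)) f]; rfl
def splitE (Ψ : κ → ι) (h : Function.Injective Ψ) : κ ⊕ {i // i ∉ Set.range Ψ} ≃ ι :=
  (Equiv.sumCongr (Equiv.ofInjective Ψ h) (Equiv.refl _)).trans (Equiv.Set.sumCompl (Set.range Ψ))
@[simp] lemma splitE_inl (Ψ : κ → ι) (h : Function.Injective Ψ) (a : κ) : splitE Ψ h (.inl a) = Ψ a := by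
  simp [splitE, Equiv.Set.sumCompl]
@[simp] lemma splitE_inr (Ψ : κ → ι) (h : Function.Injective Ψ) (a) : splitE Ψ h (.inr a) = a.1 := by
  simp [splitE, Equiv.Set.sumCompl]
lemma ex_split (Ψ : κ → ι) (h : Function.Injective Ψ) (f : (ι → V) → ℝ) :
    ex f = ex fun y : κ → V => ex fun z : {i // i ∉ Set.range Ψ} → V =>
      f (Sum.elim y z ∘ (splitE Ψ h).symm) := by
  rw [ex_arrowCongr (splitE Ψ h).symm, ex_sumArrow]
lemma ex_marg [Nonempty V] (Ψ : κ → ι) (h : Function.Injective Ψ) (f : (κ → V) → ℝ) :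
    (ex fun x : ι → V => f (x ∘ Ψ)) = ex f := by
  rw [ex_split Ψ h]; congr 1; ext y
  have : ∀ z : {i // i ∉ Set.range Ψ} → V, (Sum.elim y z ∘ (splitE Ψ h).symm) ∘ Ψ = y := by
    intro z; ext i
    have : (splitE Ψ h).symm (Ψ i) = .inl i := by rw [Equiv.symm_apply_eq]; simp
    simp [this]
  simp only [this]; exact ex_const _
lemma pr_marg [Nonempty V] (Ψ : κ → ι) (h : Function.Injective Ψ) (p : (κ → V) → Prop) :
    (pr fun x : ι → V => p (x ∘ Ψ)) = pr p := ex_marg Ψ h fun x => ind (p x)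

/-- one coordinate -/
lemma pr_coord [Nonempty V] (i : ι) (p : V → Prop) : (pr fun x : ι → V => p (x i)) = pr p := by
  have h := pr_marg (V := V) (fun _ : Unit => i) (fun _ _ _ => rfl) (fun y => p (y ()))
  rw [← pr_equiv (Equiv.funUnique Unit V) p]
  exact h

lemma pr_eq_le (a : V) : pr (fun x : V => x = a) ≤ 1 / Nat.card V := by
  cases nonempty_fintype V
  rw [pr_card, Nat.card_eq_fintype_card]; gcongr
  exact_mod_cast Finset.card_le_one.2 (by simp +contextual)

lemma pr_collide [Nonempty V] (i j : ι) (h : i ≠ j) :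
    pr (fun x : ι → V => x i = x j) ≤ 1 / Nat.card V := by
  have hinj : Function.Injective (fun b : Bool => if b then i else j) := by
    intro a b; cases a <;> cases b <;> simp [h, h.symm]
  have h1 := pr_marg (V := V) _ hinj (fun y => y true = y false)
  simp only [Function.comp, if_true, Bool.false_eq_true, if_false] at h1
  rw [h1, ← pr_equiv (Equiv.boolArrowEquivProd V).symm, pr_prod]
  apply ex_le_const; intro a
  have : ∀ b, (Equiv.boolArrowEquivProd V).symm (a, b) true = (Equiv.boolArrowEquivProd V).symm (a, b) false
     ↔ b = a := by intro b; simp [Equiv.boolArrowEquivProd]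
  simp only [this]
  exact pr_eq_le a

lemma pr_not_inj [Nonempty V] :
    pr (fun x : ι → V => ¬ Function.Injective x) ≤ (Nat.card ι : ℝ) ^ 2 / Nat.card V := by
  have h1 : pr (fun x : ι → V => ¬ Function.Injective x) ≤
      pr (fun x : ι → V => ∃ q : ι × ι, q.1 ≠ q.2 ∧ x q.1 = x q.2) := by
    apply pr_mono; intro x hx
    simp only [Function.Injective, not_forall] at hx
    obtain ⟨a, b, hab, hne⟩ := hx
    exact ⟨(a, b), hne, hab⟩
  refine h1.trans ((pr_exists_le _ (1 / (Nat.card V : ℝ)) ?_).trans ?_)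
  · rintro ⟨i, j⟩
    by_cases h : i = j
    · refine (pr_mono (q := fun _ => False) (by intro x hx; exact hx.1 h)).trans ?_
      simp [pr, ind, ex]
    · exact (pr_mono fun x hx => hx.2).trans (pr_collide i j h)
  · rw [Nat.card_prod]; push_cast; apply le_of_eq; ring

/-- sampling coordinates inside a subset; `j : κ → ι` injective, `q` coordinates. -/
lemma pr_mem_range [Nonempty ι] (j : κ → ι) (hj : Function.Injective j) (q : ℕ) :
    pr (fun x : Fin q → ι => ∃ t, x t ∉ Set.range j) ≤
      q * (((Nat.card ι : ℝ) - Nat.card κ) / Nat.card ι) := by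
  have := pr_exists_le (fun (t : Fin q) (x : Fin q → ι) => x t ∉ Set.range j)
    (((Nat.card ι : ℝ) - Nat.card κ) / Nat.card ι) ?_
  · simpa using this
  · intro t
    rw [pr_coord t (fun a => a ∉ Set.range j)]
    cases nonempty_fintype ι; cases nonempty_fintype κ
    rw [pr_card, Nat.card_eq_fintype_card, Nat.card_eq_fintype_card]
    gcongr
    have h1 : (univ.filter fun a => a ∉ Set.range j).card + Fintype.card κ = Fintype.card ι := by
      rw [← Finset.card_univ (α := κ), ← Finset.card_image_of_injective univ hj]
      have : (univ.filter fun a => a ∉ Set.range j) = (univ.image j)ᶜ := by ext; simp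
      rw [this, Finset.card_compl]
      have := Finset.card_le_univ (univ.image j); omega
    rw [← h1]; push_cast; linarith

lemma sum_le_of_inj {α β : Type} [Fintype α] [Fintype β] (g : α → β) (hg : Function.Injective g)
    (f : β → ℝ) (h : ∀ b, 0 ≤ f b) : ∑ a, f (g a) ≤ ∑ b, f b := by
  rw [← Finset.sum_image (f := f) (s := univ) (g := g) (fun a _ b _ hab => hg hab)]
  exact Finset.sum_le_sum_of_subset_of_nonneg (subset_univ _) fun b _ _ => h b

/-- restricting increases probability by at most the exceptional part -/
lemma pr_restrict [Nonempty ι] (j : κ → ι) (hj : Function.Injective j) (q : ℕ)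
    (p : (Fin q → ι) → Prop) :
    pr p ≤ pr (fun x : Fin q → κ => p (j ∘ x)) +
      q * (((Nat.card ι : ℝ) - Nat.card κ) / Nat.card ι) := by
  have h0 : pr p ≤ pr (fun x => (p x ∧ ∀ t, x t ∈ Set.range j) ∨ ∃ t, x t ∉ Set.range j) :=
    pr_mono fun x hx => by by_cases h : ∀ t, x t ∈ Set.range j <;> [exact .inl ⟨hx, h⟩; exact .inr (by simpa using h)]
  refine (h0.trans (pr_or _ _)).trans (add_le_add ?_ (pr_mem_range j hj q))
  cases nonempty_fintype ι; cases nonempty_fintype κ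
  have hle : Fintype.card κ ≤ Fintype.card ι := Fintype.card_le_of_injective j hj
  rcases isEmpty_or_nonempty κ with hk | hk
  · rcases Nat.eq_zero_or_pos q with rfl | hq
    · rw [pr_card, pr_card]
      apply le_of_eq
      congr 1
      · congr 1
        refine Finset.card_bij (fun _ _ => Fin.elim0) ?_ ?_ ?_
        · intro a ha; simp only [mem_filter, mem_univ, true_and] at ha ⊢
          convert ha.1
        · intro a _ b _ _; ext t; exact t.elim0
        · intro b hb; refine ⟨Fin.elim0, ?_, Subsingleton.elim _ _⟩
          simp only [mem_filter, mem_univ, true_and] at hb ⊢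
          exact ⟨by convert hb, fun t => t.elim0⟩
    · refine le_trans (le_of_eq ?_) (pr_nonneg _)
      rw [pr_card]
      have : (univ.filter fun x : Fin q → ι => p x ∧ ∀ t, x t ∈ Set.range j) = ∅ := by
        ext x; simp only [mem_filter, mem_univ, true_and, notMem_empty, iff_false]
        rintro ⟨_, h⟩; obtain ⟨a, _⟩ := h ⟨0, hq⟩; exact hk.elim a
      rw [this]; simp
  · rw [pr_card, pr_card]
    have h2 : (univ.filter fun x : Fin q → ι => p x ∧ ∀ t, x t ∈ Set.range j).card ≤
        (univ.filter fun x : Fin q → κ => p (j ∘ x)).card := by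
      refine Finset.card_le_card_of_surjOn (fun x => j ∘ x) ?_
      intro x hx
      simp only [coe_filter, mem_univ, true_and, Set.mem_ofPred_eq, Set.mem_image] at hx ⊢
      choose y hy using hx.2
      have : j ∘ y = x := funext hy
      exact ⟨y, by rw [this]; exact hx.1, this⟩
    have hkp : (0 : ℝ) < Fintype.card κ := by exact_mod_cast Fintype.card_pos
    have hc : (Fintype.card (Fin q → κ) : ℝ) ≤ Fintype.card (Fin q → ι) := by
      simp only [Fintype.card_fun, Fintype.card_fin, Nat.cast_pow]; gcongr
    have hp : (0 : ℝ) < Fintype.card (Fin q → κ) := by exact_mod_cast Fintype.card_pos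
    gcongr

/-- conversely -/
lemma pr_restrict' [Nonempty ι] [Nonempty κ] (j : κ → ι) (hj : Function.Injective j) (q : ℕ)
    (p : (Fin q → ι) → Prop) :
    pr (fun x : Fin q → κ => p (j ∘ x)) ≤ pr p +
      q * (((Nat.card ι : ℝ) - Nat.card κ) / Nat.card ι) := by
  have := pr_restrict j hj q (fun x => ¬ p x)
  rw [pr_not, pr_not] at this; linarith

/-- averaging over permutations -/
lemma ex_perm {ι κ : Type} [Fintype ι] [Fintype κ] (ψ : κ → ι) (hψ : Function.Injective ψ) (f : (κ → ι) → ℝ) :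
    (ex fun σ : Equiv.Perm ι => f (σ ∘ ψ)) * (univ.filter fun φ : κ → ι => Function.Injective φ).card
      = ∑ φ ∈ univ.filter (fun φ : κ → ι => Function.Injective φ), f φ := by
  have key : ∀ φ : κ → ι, Function.Injective φ →
      (ex fun σ : Equiv.Perm ι => f (σ ∘ φ)) = ex fun σ : Equiv.Perm ι => f (σ ∘ ψ) := by
    intro φ hφ
    obtain ⟨τ, hτ⟩ : ∃ τ : Equiv.Perm ι, τ ∘ ψ = φ := by
      let e : {i // i ∈ Set.range ψ} ≃ {i // i ∈ Set.range φ} :=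
        (Equiv.ofInjective ψ hψ).symm.trans (Equiv.ofInjective φ hφ)
      refine ⟨e.extendSubtype, funext fun a => ?_⟩
      simp only [Function.comp]
      rw [Equiv.extendSubtype_apply_of_mem e (ψ a) ⟨a, rfl⟩]
      have : (⟨ψ a, a, rfl⟩ : {i // i ∈ Set.range ψ}) = Equiv.ofInjective ψ hψ a := rfl
      rw [this]; show _ = (Equiv.ofInjective φ hφ a).1; congr 1; simp only [e, Equiv.trans_apply]
      rw [Equiv.symm_apply_apply]
    rw [← ex_equiv (Equiv.mulRight τ) (fun σ : Equiv.Perm ι => f (σ ∘ ψ))]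
    congr 1; ext σ; rw [← hτ]; rfl
  rw [mul_comm, ← nsmul_eq_mul, ← Finset.sum_const]
  rw [Finset.sum_congr rfl (fun φ hφ => (key φ (by simpa using hφ)).symm), ← ex_sum]
  have : ∀ σ : Equiv.Perm ι, ∑ φ ∈ univ.filter (fun φ : κ → ι => Function.Injective φ), f (σ ∘ φ) =
      ∑ φ ∈ univ.filter (fun φ : κ → ι => Function.Injective φ), f φ := by
    intro σ
    refine Finset.sum_bij (fun φ _ => σ ∘ φ) ?_ ?_ ?_ ?_
    · intro φ hφ; simp only [mem_filter, mem_univ, true_and] at hφ ⊢; exact σ.injective.comp hφ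
    · intro a _ b _ h; ext i; exact σ.injective (congrFun h i)
    · intro b hb; refine ⟨σ.symm ∘ b, ?_, by ext; simp⟩
      simp only [mem_filter, mem_univ, true_and] at hb ⊢; exact σ.symm.injective.comp hb
    · intros; rfl
  simp only [this]; exact ex_const _
end arrows

section hoeff
variable {Y : Type} [Finite Y] [Nonempty Y]

lemma exp_le_quad (y : ℝ) (h0 : 0 ≤ y) : Real.exp (-y) ≤ 1 - y + y ^ 2 / 2 := by
  have h : 1 / (1 - y + y ^ 2 / 2) ≥ 0 ∧ 0 < 1 - y + y ^ 2 / 2 := by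
    have : 0 < 1 - y + y ^ 2 / 2 := by nlinarith [sq_nonneg (y - 1)]
    exact ⟨by positivity, this⟩
  have h2 : 1 + y + y ^ 2 / 2 ≤ Real.exp y := Real.quadratic_le_exp_of_nonneg h0
  rw [Real.exp_neg, inv_le_comm₀ (Real.exp_pos _) h.2]
  refine le_trans ?_ h2
  rw [inv_le_iff_one_le_mul₀ h.2]
  nlinarith [sq_nonneg (y ^ 2), sq_nonneg y]

lemma ex_prod_pi {t : ℕ} (g : Y → ℝ) : (ex fun x : Fin t → Y => ∏ j, g (x j)) = (ex g) ^ t := by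
  cases nonempty_fintype Y
  have h := Finset.prod_univ_sum (fun _ : Fin t => (univ : Finset Y)) (fun _ y => g y)
  rw [Fintype.piFinset_univ] at h
  simp only [ex_eq, Fintype.card_fun, Fintype.card_fin]
  rw [div_pow, ← h]; simp

/-- exponential moment -/
lemma exp_moment {f : Y → ℝ} (h0 : ∀ y, 0 ≤ f y) (h1 : ∀ y, f y ≤ 1) {ξ ρ : ℝ} (hξ : 0 ≤ ξ)
    (hρ : ρ ≤ ex f) (t : ℕ) :
    (ex fun x : Fin t → Y => Real.exp (-ξ * ∑ j, f (x j))) ≤ Real.exp (-ξ * ρ * t + ξ ^ 2 / 2 * t) := by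
  have : ∀ x : Fin t → Y, Real.exp (-ξ * ∑ j, f (x j)) = ∏ j, Real.exp (-(ξ * f (x j))) := by
    intro x; rw [← Real.exp_sum, Finset.mul_sum]; simp
  simp only [this]
  rw [ex_prod_pi (fun y => Real.exp (-(ξ * f y)))]
  have e1 : ex (fun y => Real.exp (-(ξ * f y))) ≤ Real.exp (-ξ * ρ + ξ ^ 2 / 2) := by
    calc ex (fun y => Real.exp (-(ξ * f y))) ≤ ex (fun y => (1 + ξ ^ 2 / 2) - ξ * f y) := by
          apply ex_mono; intro y
          have := exp_le_quad (ξ * f y) (mul_nonneg hξ (h0 y))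
          have h3 : (ξ * f y) ^ 2 ≤ ξ ^ 2 := by
            rw [mul_pow]; have := pow_le_one₀ (n := 2) (h0 y) (h1 y); nlinarith [sq_nonneg ξ]
          linarith
      _ = (1 + ξ ^ 2 / 2) - ξ * ex f := by rw [ex_sub, ex_const, ex_mul]
      _ ≤ (-ξ * ρ + ξ ^ 2 / 2) + 1 := by nlinarith
      _ ≤ _ := Real.add_one_le_exp _
  calc _ ≤ (Real.exp (-ξ * ρ + ξ ^ 2 / 2)) ^ t :=
        pow_le_pow_left₀ (ex_nonneg fun _ => (Real.exp_pos _).le) e1 t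
    _ = _ := by rw [← Real.exp_nat_mul]; congr 1; ring

lemma hoeffding {f : Y → ℝ} (h0 : ∀ y, 0 ≤ f y) (h1 : ∀ y, f y ≤ 1) {ξ ρ : ℝ} (hξ : 0 ≤ ξ)
    (hρ : ρ ≤ ex f) (t : ℕ) :
    pr (fun x : Fin t → Y => ∑ j, f (x j) ≤ (ρ - ξ) * t) ≤ Real.exp (-(ξ ^ 2 / 2) * t) := by
  have h2 := exp_moment h0 h1 hξ hρ t
  have h3 := markov (α := Fin t → Y) (f := fun x => Real.exp (-ξ * ∑ j, f (x j)))
    (fun _ => (Real.exp_pos _).le) (Real.exp_pos (-ξ * ((ρ - ξ) * t)))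
  refine le_trans (pr_mono ?_) (h3.trans ?_)
  · intro x hx; rw [Real.exp_le_exp]; nlinarith
  · rw [div_le_iff₀ (Real.exp_pos _), ← Real.exp_add]
    refine h2.trans_eq ?_; congr 1; ring
end hoeff

end
end TH

open Finset
set_option linter.all false
namespace TH
open scoped Classical

noncomputable section

lemma amgm_prod {n : ℕ} (hn : 0 < n) (x : Fin n → ℝ) (h : ∀ i, 0 ≤ x i) :
    ∏ i, x i ≤ ((∑ i, x i) / n) ^ n := by
  have := Real.geom_mean_le_arith_mean_weighted univ (fun _ : Fin n => (1:ℝ) / n) x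
    (fun _ _ => by positivity) (by simp; field_simp) (fun i _ => h i)
  have hn' : (n:ℝ) ≠ 0 := by positivity
  have h2 : ∏ i, x i = (∏ i, x i ^ ((1:ℝ) / n)) ^ n := by
    rw [← Finset.prod_pow]; refine Finset.prod_congr rfl fun i _ => ?_
    rw [← Real.rpow_natCast, ← Real.rpow_mul (h i)]; field_simp; simp
  rw [h2]
  refine pow_le_pow_left₀ (Finset.prod_nonneg fun i _ => Real.rpow_nonneg (h i) _) ?_ n
  refine this.trans_eq ?_
  rw [← Finset.mul_sum]; ring

section LW
variable {ι : Type} [Fintype ι]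

def MM {m : ℕ} (C : Finset (Fin (m+1) → ι)) (j : Fin (m+1)) : ℕ := (C.image (fun x => j.removeNth x)).card

lemma LW : ∀ (m : ℕ) (C : Finset (Fin (m+1) → ι)), C.Nonempty →
    (C.card : ℝ) ^ m ≤ ∏ j, (MM C j : ℝ) := by
  intro m
  induction m with
  | zero =>
    intro C hC
    have : 0 < MM C 0 := by unfold MM; exact Finset.card_pos.2 (hC.image _)
    simp; exact this
  | succ m ih =>
    intro C hC
    let sl : ι → Finset (Fin (m+1) → ι) := fun a => univ.filter fun y => (Fin.cons a y : Fin (m+2) → ι) ∈ C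
    have hM : ∀ j, 0 < MM C j := fun j => Finset.card_pos.2 (hC.image _)
    have hcard : (C.card : ℝ) = ∑ a, ((sl a).card : ℝ) := by
      rw [← Nat.cast_sum]; congr 1
      rw [Finset.card_eq_sum_card_fiberwise (f := fun x => x 0) (t := univ) (by simp)]
      refine Finset.sum_congr rfl fun a _ => ?_
      refine Finset.card_bij (fun x _ => Fin.tail x) ?_ ?_ ?_
      · intro x hx; simp only [mem_filter, mem_univ, true_and, sl] at hx ⊢
        rw [← hx.2, Fin.cons_self_tail]; exact hx.1
      · intro x hx y hy h
        simp only [mem_filter] at hx hy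
        rw [← Fin.cons_self_tail x, ← Fin.cons_self_tail y, hx.2, hy.2, h]
      · intro y hy; simp only [mem_filter, mem_univ, true_and, sl] at hy
        exact ⟨Fin.cons a y, by simp [hy], by simp⟩
    have h0 : ∀ a, (sl a).card ≤ MM C 0 := by
      intro a
      refine Finset.card_le_card ?_
      intro y hy; simp only [mem_filter, mem_univ, true_and, sl] at hy
      exact Finset.mem_image.2 ⟨_, hy, by ext i; simp [Fin.removeNth]⟩
    have hs : ∀ j : Fin (m+1), ∑ a, MM (sl a) j ≤ MM C j.succ := by
      intro j
      have : ∑ a, MM (sl a) j = ∑ a, (((sl a).image fun x => j.removeNth x).image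
          (fun y => (Fin.cons a y : Fin (m+1) → ι))).card := by
        refine Finset.sum_congr rfl fun a _ => ?_
        rw [Finset.card_image_of_injective]; · rfl
        intro x y h; exact (Fin.cons_injective2 h).2
      rw [this, ← Finset.card_biUnion]
      · refine Finset.card_le_card ?_
        intro z hz
        simp only [mem_biUnion, mem_image, mem_univ, true_and, mem_filter, sl] at hz
        obtain ⟨a, y, ⟨x, hx, rfl⟩, rfl⟩ := hz
        refine Finset.mem_image.2 ⟨_, hx, ?_⟩
        ext i; refine Fin.cases ?_ (fun i => ?_) i <;> simp [Fin.removeNth]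
      · intro a _ b _ hab
        rw [Function.onFun, Finset.disjoint_left]
        intro z hz hz'
        simp only [mem_image] at hz hz'
        obtain ⟨y, _, rfl⟩ := hz
        obtain ⟨y', _, h⟩ := hz'
        exact hab ((Fin.cons_injective2 h).1).symm
    set D : ℝ := ∏ j, (MM C j : ℝ) with hD
    have hDpos : 0 < D := Finset.prod_pos fun j _ => by exact_mod_cast hM j
    set R : ℝ := D ^ ((1:ℝ) / (m+1)) with hR
    have hRpos : 0 < R := Real.rpow_pos_of_pos hDpos _
    have hRD : R ^ (m+1) = D := by
      rw [hR, ← Real.rpow_natCast, ← Real.rpow_mul hDpos.le]; push_cast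
      rw [one_div, inv_mul_cancel₀ (by positivity), Real.rpow_one]
    have key : ∀ a, ((sl a).card : ℝ) ≤ R * ((∑ j : Fin (m+1), (MM (sl a) j : ℝ) / MM C j.succ) / (m+1 : ℕ)) := by
      intro a
      rcases (sl a).eq_empty_or_nonempty with he | he
      · rw [he]; simp; positivity
      refine le_of_pow_le_pow_left₀ (n := m+1) (by omega) (by positivity) ?_
      rw [mul_pow, hRD]
      calc ((sl a).card : ℝ) ^ (m+1) = (sl a).card ^ m * (sl a).card := by rw [pow_succ]
        _ ≤ (∏ j, (MM (sl a) j : ℝ)) * MM C 0 :=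
            mul_le_mul (ih _ he) (by exact_mod_cast h0 a) (by positivity) (by positivity)
        _ = D * ∏ j : Fin (m+1), ((MM (sl a) j : ℝ) / MM C j.succ) := by
            rw [hD, Fin.prod_univ_succ (fun j => (MM C j : ℝ)), Finset.prod_div_distrib]
            have : ∏ j : Fin (m+1), (MM C j.succ : ℝ) ≠ 0 :=
              Finset.prod_ne_zero_iff.2 fun j _ => by have := hM j.succ; positivity
            generalize ∏ j : Fin (m+1), (MM C j.succ : ℝ) = u at *
            field_simp
        _ ≤ _ := mul_le_mul_of_nonneg_left (amgm_prod (by omega) _ fun i => by positivity) hDpos.le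
    have : (C.card : ℝ) ≤ R := by
      rw [hcard]
      refine (Finset.sum_le_sum fun a _ => key a).trans ?_
      rw [← Finset.mul_sum, ← Finset.sum_div, Finset.sum_comm]
      have : ∑ j : Fin (m+1), ∑ a, (MM (sl a) j : ℝ) / MM C j.succ ≤ ∑ j : Fin (m+1), 1 := by
        refine Finset.sum_le_sum fun j _ => ?_
        rw [← Finset.sum_div, div_le_one (by exact_mod_cast hM _)]
        exact_mod_cast hs j
      have h3 : (∑ j : Fin (m+1), ∑ a, (MM (sl a) j : ℝ) / MM C j.succ) / (m+1 : ℕ) ≤ 1 := by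
        rw [div_le_one (by positivity)]; refine this.trans (by simp)
      nlinarith
    rw [← hRD]; exact pow_le_pow_left₀ (by positivity) this _
end LW

section pattern
variable {ι : Type}
def Adj {q : ℕ} (P : (Fin q → ι) → Prop) (x y : Fin q → ι) : Prop :=
  P x ∧ P y ∧ ∃ j, ∀ i, i ≠ j → x i = y i
def Con {q : ℕ} (P : (Fin q → ι) → Prop) : (Fin q → ι) → (Fin q → ι) → Prop := Relation.ReflTransGen (Adj P)
def T {q : ℕ} (P : (Fin q → ι) → Prop) (x : Fin q → ι) : Prop := P x ∧ 1/2 < pr (Con P x)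

lemma Adj.symm {q : ℕ} {P : (Fin q → ι) → Prop} {x y} (h : Adj P x y) : Adj P y x :=
  ⟨h.2.1, h.1, h.2.2.imp fun j hj i hi => (hj i hi).symm⟩
lemma Con.symm {q : ℕ} {P : (Fin q → ι) → Prop} {x y} (h : Con P x y) : Con P y x :=
  haveI : Std.Symm (Adj P) := ⟨fun _ _ h => h.symm⟩
  (inferInstance : Std.Symm (Relation.ReflTransGen (Adj P))).symm _ _ h
lemma Con.trans {q : ℕ} {P : (Fin q → ι) → Prop} {x y z} (h : Con P x y) (h2 : Con P y z) : Con P x z :=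
  Relation.ReflTransGen.trans h h2
lemma Con.P {q : ℕ} {P : (Fin q → ι) → Prop} {x y} (h : Con P x y) (hx : P x) : P y := by
  induction h with
  | refl => exact hx
  | tail _ h _ => exact h.2.1
lemma Con.map {q q' : ℕ} {κ : Type} {P : (Fin q → ι) → Prop} {Q : (Fin q' → κ) → Prop}
    (f : (Fin q → ι) → (Fin q' → κ)) (hf : ∀ x y, Adj P x y → Adj Q (f x) (f y)) {x y}
    (h : Con P x y) : Con Q (f x) (f y) := Relation.ReflTransGen.lift f (fun x y => hf x y) x y h
lemma T.con [Finite ι] [Nonempty ι] {q : ℕ} {P : (Fin q → ι) → Prop} {x y} (hx : T P x) (hy : T P y) : Con P x y := by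
  obtain ⟨z, h1, h2⟩ := exists_and_of_pr (p := Con P x) (q := Con P y) (by linarith [hx.2, hy.2])
  exact h1.trans h2.symm
lemma T.of_con [Finite ι] {q : ℕ} {P : (Fin q → ι) → Prop} {x y} (hx : T P x) (h : Con P x y) : T P y := by
  refine ⟨h.P hx.1, hx.2.trans_le (pr_mono fun z hz => h.symm.trans hz)⟩

variable [Fintype ι]

/-- a large component with small projections -/
lemma comp_exists [Nonempty ι] {m : ℕ} {L : (Fin (m+1) → ι) → Prop} {δ : ℝ} (hδ : 0 < δ) (h : δ ≤ pr L) :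
    ∃ x0, L x0 ∧ ∃ C : Finset (Fin (m+1) → ι), (∀ y, y ∈ C ↔ Con L x0 y) ∧
      δ * Fintype.card ι * ∑ j, (MM C j : ℝ) ≤ (m+1) * C.card := by
  let cl : (Fin (m+1) → ι) → Finset (Fin (m+1) → ι) := fun x => univ.filter (Con L x)
  have hne : (univ.filter L).Nonempty := by
    obtain ⟨x, hx⟩ := exists_of_pr (hδ.trans_le h); exact ⟨x, by simpa using hx⟩
  set cs := (univ.filter L).image cl
  by_contra! hc
  have hlt : ∀ C ∈ cs, ((m:ℝ)+1) * C.card < δ * Fintype.card ι * ∑ j, (MM C j : ℝ) := by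
    intro C hC
    obtain ⟨x, hx, rfl⟩ := Finset.mem_image.1 hC
    exact hc x (by simpa using hx) _ (by simp [cl])
  have hsum := Finset.sum_lt_sum_of_nonempty (hne.image cl) hlt
  have hdis : ∀ x y, L x → L y → ∀ u ∈ cl x, ∀ v ∈ cl y, Con L u v → cl x = cl y := by
    intro x y hx hy u hu v hv huv
    simp only [mem_filter, mem_univ, true_and, cl] at hu hv
    have : Con L x y := (hu.trans huv).trans hv.symm
    ext z; simp only [mem_filter, mem_univ, true_and, cl]
    exact ⟨fun h => this.symm.trans h, fun h => this.trans h⟩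
  have h1 : (∑ C ∈ cs, C.card) = (univ.filter L).card := by
    rw [← Finset.card_biUnion (t := fun C => C)]
    · congr 1; ext x; simp only [mem_biUnion, mem_filter, mem_univ, true_and]
      constructor
      · rintro ⟨C, hC, hx⟩
        obtain ⟨y, hy, rfl⟩ := Finset.mem_image.1 hC
        simp only [mem_filter, mem_univ, true_and, cl] at hx hy
        exact hx.P hy
      · intro hx; exact ⟨cl x, Finset.mem_image_of_mem _ (by simpa using hx), by simp only [cl, mem_filter, mem_univ, true_and]; exact Relation.ReflTransGen.refl⟩
    · intro C hC D hD hne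
      obtain ⟨x, hx, rfl⟩ := Finset.mem_image.1 hC
      obtain ⟨y, hy, rfl⟩ := Finset.mem_image.1 hD
      rw [Function.onFun, Finset.disjoint_left]
      intro z hz hz'
      exact hne (hdis x y (by simpa using hx) (by simpa using hy) z hz z hz' Relation.ReflTransGen.refl)
  have h2 : ∀ j, (∑ C ∈ cs, MM C j) ≤ Fintype.card ι ^ m := by
    intro j
    unfold MM
    rw [← Finset.card_biUnion]
    · refine (Finset.card_le_univ _).trans (by simp)
    · intro C hC D hD hne
      obtain ⟨x, hx, rfl⟩ := Finset.mem_image.1 hC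
      obtain ⟨y, hy, rfl⟩ := Finset.mem_image.1 hD
      rw [Function.onFun, Finset.disjoint_left]
      intro z hz hz'
      obtain ⟨u, hu, rfl⟩ := Finset.mem_image.1 hz
      obtain ⟨v, hv, huv⟩ := Finset.mem_image.1 hz'
      simp only [mem_filter, mem_univ, true_and] at hx hy
      refine hne (hdis x y hx hy u hu v hv (Relation.ReflTransGen.single ?_))
      simp only [mem_filter, mem_univ, true_and, cl] at hu hv
      refine ⟨hu.P hx, hv.P hy, j, fun i hi => ?_⟩
      obtain ⟨i', rfl⟩ := Fin.exists_succAbove_eq hi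
      exact (congrFun huv i').symm
  rw [← Finset.mul_sum, ← Finset.mul_sum, Finset.sum_comm] at hsum
  have h3 : (∑ j : Fin (m+1), ∑ C ∈ cs, (MM C j : ℝ)) ≤ ∑ j : Fin (m+1), (Fintype.card ι : ℝ) ^ m :=
    Finset.sum_le_sum fun j _ => by exact_mod_cast h2 j
  rw [← Nat.cast_sum, h1] at hsum
  rw [pr_card, le_div_iff₀ (by exact_mod_cast Fintype.card_pos)] at h
  simp only [Fintype.card_fun, Fintype.card_fin, Nat.cast_pow] at h
  simp only [sum_const, card_univ, Fintype.card_fin, nsmul_eq_mul] at h3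
  push_cast at h3
  have h4 : δ * Fintype.card ι * (∑ j : Fin (m+1), ∑ C ∈ cs, (MM C j : ℝ)) ≤
      δ * Fintype.card ι * ((m+1) * Fintype.card ι ^ m) := by gcongr
  have h5 : δ * Fintype.card ι * ((m+1) * (Fintype.card ι:ℝ) ^ m) = (m+1) * (δ * (Fintype.card ι:ℝ) ^ (m+1)) := by ring
  have h6 := mul_le_mul_of_nonneg_left h (by positivity : (0:ℝ) ≤ m+1)
  linarith

lemma fib_le_MM {m : ℕ} (C : Finset (Fin (m+1) → ι)) (j : Fin (m+1)) (a : ι) :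
    (C.filter fun B => B j = a).card ≤ MM C j := by
  refine Finset.card_le_card_of_injOn (fun x => j.removeNth x) ?_ ?_
  · intro x hx; simp only [coe_filter, Set.mem_ofPred_eq, mem_coe] at hx ⊢
    exact Finset.mem_image_of_mem _ hx.1
  · intro x hx y hy h
    simp only [coe_filter, Set.mem_ofPred_eq] at hx hy
    rw [← Fin.insertNth_self_removeNth j x, ← Fin.insertNth_self_removeNth j y, hx.2, hy.2]
    exact congrArg _ h

lemma comp_main [Nonempty ι] {r : ℕ} (hr : 0 < r) {L : (Fin r → ι) → Prop} {δ : ℝ} (hδ : 0 < δ) (h : δ ≤ pr L) :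
    ∃ x0, L x0 ∧ δ ^ r ≤ pr (Con L x0) ∧ ∃ C : Finset (Fin r → ι), ∃ M : Fin r → ℕ, C.Nonempty ∧
      (∀ y, y ∈ C ↔ Con L x0 y) ∧ (∀ j a, (C.filter fun B => B j = a).card ≤ M j) ∧
      δ * Fintype.card ι * ∑ j, (M j : ℝ) ≤ r * C.card := by
  obtain ⟨m, rfl⟩ : ∃ m, r = m+1 := ⟨r-1, by omega⟩
  obtain ⟨x0, hx0, C, hC, hM⟩ := comp_exists hδ h
  have hne : C.Nonempty := ⟨x0, (hC _).2 Relation.ReflTransGen.refl⟩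
  have hcp : (0:ℝ) < C.card := by exact_mod_cast hne.card_pos
  refine ⟨x0, hx0, ?_, C, MM C, hne, hC, fun j a => fib_le_MM C j a, by push_cast; exact hM⟩
  have hCf : univ.filter (Con L x0) = C := by ext; simp [hC]
  have hn : (0:ℝ) < Fintype.card ι := by exact_mod_cast Fintype.card_pos
  rw [pr_card, hCf, le_div_iff₀ (by exact_mod_cast Fintype.card_pos)]
  simp only [Fintype.card_fun, Fintype.card_fin, Nat.cast_pow]
  rw [← mul_pow]
  have h1 := LW m C hne
  have h2 := amgm_prod (n := m+1) (by omega) (fun j => (MM C j : ℝ)) (fun _ => by positivity)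
  have h3 : (∑ j, (MM C j : ℝ)) / (m+1 : ℕ) ≤ C.card / (δ * Fintype.card ι) := by
    rw [div_le_div_iff₀ (by positivity) (by positivity)]; push_cast; linarith
  have h4 := h1.trans (h2.trans (pow_le_pow_left₀ (by positivity) h3 _))
  rw [div_pow, le_div_iff₀ (by positivity), pow_succ (C.card:ℝ), mul_comm, mul_comm ((C.card:ℝ)^m)] at h4
  exact le_of_mul_le_mul_right h4 (by positivity)
end pattern
end
end TH

open Finset
set_option linter.all false
namespace TH
open scoped Classical
noncomputable section

def Typ {ι : Type} (d r : ℕ) (δ : ℝ) (P : (Fin (d+r) → ι) → Prop) : Prop :=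
  ∀ S : Fin d → ι, Function.Injective S → δ ≤ pr fun B : Fin r → ι => P (Fin.append S B)

section struct
variable {ι : Type} [Fintype ι] {d r : ℕ} {δ ν : ℝ}

lemma ex_append {V : Type} [Finite V] (f : (Fin (d+r) → V) → ℝ) :
    ex f = ex fun S : Fin d → V => ex fun B : Fin r → V => f (Fin.append S B) := by
  rw [← ex_equiv (Fin.appendEquiv d r) f, ex_prod]; rfl

lemma con_append {P : (Fin (d+r) → ι) → Prop} {S : Fin d → ι} {B B' : Fin r → ι}
    (h : Con (fun B => P (Fin.append S B)) B B') : Con P (Fin.append S B) (Fin.append S B') := by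
  refine h.map (fun B => Fin.append S B) ?_
  rintro x y ⟨h1, h2, j, hj⟩
  refine ⟨h1, h2, Fin.natAdd d j, fun i hi => ?_⟩
  refine Fin.addCases (fun i hi => by simp) (fun i hi => ?_) i hi
  simp only [Fin.append_right]; exact hj i fun h => hi (by rw [h])

lemma adj_append {P : (Fin (d+r) → ι) → Prop} {S S' : Fin d → ι} {B : Fin r → ι} {j : Fin d}
    (hj : ∀ i, i ≠ j → S i = S' i) (h : P (Fin.append S B)) (h' : P (Fin.append S' B)) :
    Adj P (Fin.append S B) (Fin.append S' B) := by
  refine ⟨h, h', Fin.castAdd r j, fun i hi => ?_⟩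
  refine Fin.addCases (fun i hi => ?_) (fun i hi => by simp) i hi
  simp only [Fin.append_left]; exact hj i fun h => hi (by rw [h])

/-- The structural theorem. -/
lemma struct (hr : 0 < r) (hδ : 0 < δ) (hν : 0 < ν) (hpow : 1/2 + ν ≤ δ ^ r)
    {P : (Fin (d+r) → ι) → Prop} (hP : Typ d r δ P)
    (hs : 3 * d < Fintype.card ι) (hs2 : (d:ℝ)^2 ≤ ν / 2 * Fintype.card ι) :
    (∀ S : Fin d → ι, Function.Injective S → ∃ C : Finset (Fin r → ι), ∃ M : Fin r → ℕ, C.Nonempty ∧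
      (∀ B ∈ C, T P (Fin.append S B)) ∧ 1/2 + ν ≤ pr (fun B => B ∈ C) ∧
      (∀ j a, (C.filter fun B => B j = a).card ≤ M j) ∧
      δ * Fintype.card ι * ∑ j, (M j : ℝ) ≤ r * C.card) ∧ 1/2 + ν/2 ≤ pr (T P) := by
  have hne : Nonempty ι := Fintype.card_pos_iff.1 (by omega)
  have hC := fun S (hS : Function.Injective S) => comp_main hr hδ (hP S hS)
  choose! B0 hB0 hpr C M hCne hmem hfib hM using hC
  -- one step
  have step : ∀ S S' : Fin d → ι, Function.Injective S → Function.Injective S' →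
      (∃ j, ∀ i, i ≠ j → S i = S' i) → Con P (Fin.append S (B0 S)) (Fin.append S' (B0 S')) := by
    rintro S S' hS hS' ⟨j, hj⟩
    obtain ⟨B, h1, h2⟩ := exists_and_of_pr (p := Con (fun B => P (Fin.append S B)) (B0 S))
      (q := Con (fun B => P (Fin.append S' B)) (B0 S')) (by linarith [hpr S hS, hpr S' hS'])
    exact ((con_append h1).trans (Relation.ReflTransGen.single
      (adj_append hj (h1.P (hB0 S hS)) (h2.P (hB0 S' hS'))))).trans (con_append h2).symm
  have disj : ∀ S S' : Fin d → ι, Function.Injective S → Function.Injective S' →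
      (∀ i j, S i ≠ S' j) → Con P (Fin.append S (B0 S)) (Fin.append S' (B0 S')) := by
    intro S S' hS hS' hd
    let h : ℕ → Fin d → ι := fun t i => if i.1 < t then S' i else S i
    have hinj : ∀ t, Function.Injective (h t) := by
      intro t a b hab; simp only [h] at hab
      split_ifs at hab
      · exact hS' hab
      · exact absurd hab.symm (hd _ _)
      · exact absurd hab (hd _ _)
      · exact hS hab
    have hall : ∀ t, t ≤ d → Con P (Fin.append S (B0 S)) (Fin.append (h t) (B0 (h t))) := by
      intro t
      induction t with
      | zero => intro _; have : h 0 = S := by ext i; simp [h]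
                rw [this]; exact Relation.ReflTransGen.refl
      | succ t ih =>
        intro ht
        refine (ih (by omega)).trans (step _ _ (hinj _) (hinj _) ⟨⟨t, by omega⟩, fun i hi => ?_⟩)
        have : i.1 ≠ t := fun h => hi (Fin.ext h)
        simp only [h]; congr 1; simp only [eq_iff_iff]; omega
    have : h d = S' := by ext i; simp [h]
    rw [← this]; exact hall d le_rfl
  have all : ∀ S S' : Fin d → ι, Function.Injective S → Function.Injective S' →
      Con P (Fin.append S (B0 S)) (Fin.append S' (B0 S')) := by
    intro S S' hS hS'
    have hcard : Fintype.card (Fin d) ≤ Fintype.card {x // x ∉ univ.image S ∪ univ.image S'} := by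
      rw [Fintype.card_fin, Fintype.card_subtype]
      have : (univ.filter fun x => x ∉ univ.image S ∪ univ.image S') = (univ.image S ∪ univ.image S')ᶜ := by
        ext; simp
      rw [this, Finset.card_compl]
      have h1 := Finset.card_union_le (univ.image S) (univ.image S')
      have h2 : (univ.image S).card ≤ d := Finset.card_image_le.trans (by simp)
      have h3 : (univ.image S').card ≤ d := Finset.card_image_le.trans (by simp)
      omega
    obtain ⟨f⟩ := Function.Embedding.nonempty_of_card_le hcard
    let S2 : Fin d → ι := fun i => (f i).1
    have hS2 : Function.Injective S2 := fun a b h => f.injective (Subtype.ext h)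
    have e1 : ∀ i j, S i ≠ S2 j := fun i j h => (f j).2 (by rw [show ((f j).1) = S i from h.symm]; simp)
    have e2 : ∀ i j, S' i ≠ S2 j := fun i j h => (f j).2 (by rw [show ((f j).1) = S' i from h.symm]; simp)
    exact (disj S S2 hS hS2 e1).trans (disj S' S2 hS' hS2 e2).symm
  have hbig : ∀ S, Function.Injective S → 1/2 + ν/2 ≤ pr (Con P (Fin.append S (B0 S))) := by
    intro S hS
    unfold pr; rw [ex_append]
    have : ∀ S' : Fin d → ι, (1/2 + ν) - ind (¬ Function.Injective S') ≤
        ex fun B : Fin r → ι => ind (Con P (Fin.append S (B0 S)) (Fin.append S' B)) := by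
      intro S'
      by_cases hS' : Function.Injective S'
      · rw [ind_false (by simpa using hS'), sub_zero]
        refine (hpow.trans (hpr S' hS')).trans (pr_mono fun B hB => ?_)
        exact (all S S' hS hS').trans (con_append hB)
      · rw [ind_true hS']
        refine le_trans ?_ (ex_nonneg fun _ => ind_nonneg _)
        have : 1/2 + ν ≤ 1 := (hpow.trans (hpr S hS)).trans (pr_le_one _)
        linarith
    refine le_trans ?_ (ex_mono this)
    rw [ex_sub, ex_const]
    have h1 := pr_not_inj (V := ι) (ι := Fin d)
    unfold pr at h1
    have h2 : ((Nat.card (Fin d) : ℝ))^2 / Nat.card ι ≤ ν / 2 := by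
      rw [div_le_iff₀ (by rw [Nat.card_eq_fintype_card]; exact_mod_cast (by omega : 0 < Fintype.card ι))]
      simpa using hs2
    linarith
  have hT : ∀ S, Function.Injective S → T P (Fin.append S (B0 S)) := fun S hS =>
    ⟨hB0 S hS, by linarith [hbig S hS]⟩
  refine ⟨fun S hS => ⟨C S, M S, hCne S hS, fun B hB => ?_, ?_, hfib S hS, hM S hS⟩, ?_⟩
  · exact (hT S hS).of_con (con_append ((hmem S hS B).1 hB))
  · refine (hpow.trans (hpr S hS)).trans (pr_mono fun B hB => (hmem S hS B).2 hB)
  · obtain ⟨f⟩ := Function.Embedding.nonempty_of_card_le (α := Fin d) (β := ι) (by simp; omega)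
    exact (hbig f f.injective).trans (pr_mono fun x hx => (hT f f.injective).of_con hx)
end struct
end
end TH

open Finset
set_option linter.all false
namespace TH
open scoped Classical
noncomputable section

def pull {V ι : Type} {q : ℕ} (H : (Fin q → V) → Prop) (g : ι → V) : (Fin q → ι) → Prop := fun x => H (g ∘ x)

structure Host {V : Type} (d r : ℕ) (δ : ℝ) (H : (Fin (d+r) → V) → Prop) : Prop where
  sym : ∀ (x : Fin (d+r) → V) (σ : Equiv.Perm (Fin (d+r))), H x → H (x ∘ σ)
  inj : ∀ x, H x → Function.Injective x
  deg : ∀ S : Fin d → V, Function.Injective S → δ ≤ pr fun B : Fin r → V => H (Fin.append S B)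

lemma exp_ex_le {α : Type} [Finite α] [Nonempty α] (f : α → ℝ) : Real.exp (ex f) ≤ ex fun x => Real.exp (f x) := by
  have : ∀ x, Real.exp (ex f) * (1 - ex f) + Real.exp (ex f) * f x ≤ Real.exp (f x) := by
    intro x
    have h := Real.add_one_le_exp (f x - ex f)
    have h2 : Real.exp (f x) = Real.exp (ex f) * Real.exp (f x - ex f) := by rw [← Real.exp_add]; congr 1; ring
    rw [h2]; nlinarith [Real.exp_pos (ex f)]
  refine le_trans (le_of_eq ?_) (ex_mono this)
  rw [ex_add, ex_const, ex_mul]; ring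

lemma append_comp {α β : Type} {d r : ℕ} (g : α → β) (S : Fin d → α) (B : Fin r → α) :
    g ∘ Fin.append S B = Fin.append (g ∘ S) (g ∘ B) := by
  ext i; refine Fin.addCases (fun i => ?_) (fun i => ?_) i <;> simp

lemma ustat {V : Type} [Finite V] [Nonempty V] {ι : Type} [Fintype ι] [Nonempty ι] {r t : ℕ} (hr : 0 < r)
    (F : (Fin r → V) → Prop) {ρ ξ : ℝ} (hξ : 0 < ξ) (hρ : ρ ≤ pr F) (ht : t * r ≤ Fintype.card ι) (ht0 : 0 < t)
    (hri : (r:ℝ)^2 ≤ ξ * Fintype.card ι) :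
    pr (fun z : ι → V => pr (fun B : Fin r → ι => F (z ∘ B)) < ρ - 2 * ξ) ≤ Real.exp (-(ξ^2/2) * t) := by
  obtain ⟨b⟩ := Function.Embedding.nonempty_of_card_le (α := Fin t × Fin r) (β := ι) (by simpa using ht)
  have htp : (0:ℝ) < t := by exact_mod_cast ht0
  let W : Equiv.Perm ι → (ι → V) → ℝ := fun σ z => ∑ j : Fin t, ind (F (z ∘ (σ ∘ fun i => b (j, i))))
  have hn : (0:ℝ) < Fintype.card ι := by exact_mod_cast Fintype.card_pos
  -- comparison
  have hU : ∀ z, (ex fun σ => W σ z) ≤ t * (pr (fun B : Fin r → ι => F (z ∘ B)) + ξ) := by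
    intro z
    simp only [W]; rw [ex_sum]
    have : ∀ j : Fin t, (ex fun σ : Equiv.Perm ι => ind (F (z ∘ (σ ∘ fun i => b (j, i))))) ≤
        pr (fun B : Fin r → ι => F (z ∘ B)) + ξ := by
      intro j
      have hinj : Function.Injective (fun i => b (j, i)) := fun x y h => by simpa using b.injective h
      have h1 := ex_perm (fun i => b (j, i)) hinj (fun φ => ind (F (z ∘ φ)))
      set A := (ex fun σ : Equiv.Perm ι => ind (F (z ∘ (σ ∘ fun i => b (j, i))))) with hA
      have hA1 : A ≤ 1 := ex_le_const fun _ => ind_le_one _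
      have hA0 : 0 ≤ A := ex_nonneg fun _ => ind_nonneg _
      have h2 : ∑ φ ∈ univ.filter (fun φ : Fin r → ι => Function.Injective φ), ind (F (z ∘ φ)) ≤
          ∑ φ : Fin r → ι, ind (F (z ∘ φ)) :=
        Finset.sum_le_sum_of_subset_of_nonneg (subset_univ _) fun _ _ _ => ind_nonneg _
      have h3 := pr_not_inj (V := ι) (ι := Fin r)
      rw [pr_not, pr_card] at h3
      have hcp : (0:ℝ) < Fintype.card (Fin r → ι) := by exact_mod_cast Fintype.card_pos
      have h4 : (Nat.card (Fin r) : ℝ)^2 / Nat.card ι ≤ ξ := by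
        rw [div_le_iff₀ (by simpa using hn)]; simpa using hri
      have h5 : pr (fun B : Fin r → ι => F (z ∘ B)) = (∑ φ : Fin r → ι, ind (F (z ∘ φ))) / Fintype.card (Fin r → ι) := ex_eq _
      have h2 : A * _ ≤ ∑ φ : Fin r → ι, ind (F (z ∘ φ)) := h1.trans_le (by convert h2)
      have h6 : A * ((univ.filter fun φ : Fin r → ι => Function.Injective φ).card / Fintype.card (Fin r → ι)) ≤
          pr (fun B : Fin r → ι => F (z ∘ B)) := by
        rw [h5, ← mul_div_assoc]; refine div_le_div_of_nonneg_right (le_trans (le_of_eq ?_) h2) hcp.le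
        congr!
      set q : ℝ := (univ.filter fun φ : Fin r → ι => Function.Injective φ).card / Fintype.card (Fin r → ι)
      have h3' : 1 - q ≤ (Nat.card (Fin r) : ℝ)^2 / Nat.card ι := by convert h3
      have h7 : 1 - ξ ≤ q := by linarith
      nlinarith
    refine (Finset.sum_le_sum fun j _ => this j).trans ?_
    simp only [sum_const, card_univ, Fintype.card_fin, nsmul_eq_mul]; exact le_rfl
  have hmom : (ex fun z : ι → V => Real.exp (-ξ * ex fun σ => W σ z)) ≤ Real.exp (-ξ * ρ * t + ξ ^ 2 / 2 * t) := by
    have h1 : ∀ z, Real.exp (-ξ * ex fun σ => W σ z) ≤ ex fun σ => Real.exp (-ξ * W σ z) := by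
      intro z; rw [← ex_mul]; exact exp_ex_le _
    refine (ex_mono h1).trans ?_
    rw [ex_comm]
    refine ex_le_const fun σ => ?_
    have h2 := exp_moment (Y := Fin r → V) (f := fun y => ind (F y)) (fun _ => ind_nonneg _) (fun _ => ind_le_one _) hξ.le hρ t
    refine le_trans (le_of_eq ?_) h2
    have hinj : Function.Injective (fun p : Fin t × Fin r => σ (b p)) := fun x y h => b.injective (σ.injective h)
    rw [← ex_equiv (Equiv.curry (Fin t) (Fin r) V)]
    rw [← ex_marg (V := V) _ hinj]
    rfl
  have h3 := markov (α := ι → V) (f := fun z => Real.exp (-ξ * ex fun σ => W σ z))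
    (fun _ => (Real.exp_pos _).le) (Real.exp_pos (-ξ * ((ρ - ξ) * t)))
  refine le_trans (pr_mono ?_) (h3.trans ?_)
  · intro z hz; rw [Real.exp_le_exp]
    have := hU z
    have h4 : (ex fun σ => W σ z) ≤ (ρ - ξ) * t := by nlinarith
    nlinarith
  · rw [div_le_iff₀ (Real.exp_pos _), ← Real.exp_add]
    refine hmom.trans_eq ?_; congr 1; ring

lemma typ_one {V : Type} [Finite V] [Nonempty V] {d r a s t : ℕ} {δ ξ : ℝ} (hr : 0 < r) (hξ : 0 < ξ)
    {H : (Fin (d+r) → V) → Prop} (hH : Host d r (δ + 4 * ξ) H) (y : Fin a → V)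
    (S : Fin d → Fin a ⊕ Fin s) (ht : t * r + d ≤ s) (ht0 : 0 < t)
    (hs : (r:ℝ)^2 * (a + d + 1) + ξ * d ≤ ξ * s) :
    pr (fun z : Fin s → V => Function.Injective (Sum.elim y z ∘ S) ∧
      pr (fun B : Fin r → Fin a ⊕ Fin s => pull H (Sum.elim y z) (Fin.append S B)) < δ) ≤
      Real.exp (-(ξ^2/2) * t) := by
  let K := {i : Fin s // Sum.inr i ∉ Set.range S}
  have hr1 : (1:ℝ) ≤ r := by exact_mod_cast hr
  have hcK : s ≤ Fintype.card K + d := by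
    rw [Fintype.card_subtype]
    have h1 : (univ.filter fun i : Fin s => ¬ (Sum.inr i ∉ Set.range S)).card ≤ d := by
      calc _ = ((univ.filter fun i : Fin s => ¬ (Sum.inr i ∉ Set.range S)).image (Sum.inr : Fin s → Fin a ⊕ Fin s)).card := by
            rw [Finset.card_image_of_injective _ Sum.inr_injective]
        _ ≤ (univ.image S).card := by
            refine Finset.card_le_card ?_
            intro x hx; simp only [mem_image, mem_filter, mem_univ, true_and, not_not] at hx
            obtain ⟨i, ⟨j, hj⟩, rfl⟩ := hx
            exact Finset.mem_image.2 ⟨j, mem_univ _, hj⟩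
        _ ≤ d := Finset.card_image_le.trans (by simp)
    have := Finset.card_filter_add_card_filter_not (s := (univ : Finset (Fin s))) (fun i => Sum.inr i ∉ Set.range S)
    simp only [card_univ, Fintype.card_fin] at this
    omega
  have hKne : Nonempty K := Fintype.card_pos_iff.1 (by have : 1 ≤ t * r := Nat.mul_pos ht0 hr
                                                       omega)
  have hsp : 0 < s := by have : 1 ≤ t * r := Nat.mul_pos ht0 hr
                         omega
  have hcK' : (s:ℝ) ≤ Fintype.card K + d := by exact_mod_cast hcK
  let Ψ : K → Fin s := Subtype.val
  have hΨ : Function.Injective Ψ := Subtype.val_injective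
  have hne : Nonempty (Fin a ⊕ Fin s) := ⟨.inr ⟨0, hsp⟩⟩
  unfold pr
  rw [ex_split Ψ hΨ, ex_comm]
  refine ex_le_const fun w => ?_
  let z0 : (K → V) → Fin s → V := fun u => Sum.elim u w ∘ (splitE Ψ hΨ).symm
  have hz0K : ∀ u (i : K), z0 u i.1 = u i := by
    intro u i
    have : (splitE Ψ hΨ).symm i.1 = .inl i := by rw [Equiv.symm_apply_eq]; simp [Ψ]
    simp [z0, this]
  have hz0n : ∀ u u' (i : Fin s), Sum.inr i ∈ Set.range S → z0 u i = z0 u' i := by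
    intro u u' i hi
    have hi' : i ∉ Set.range Ψ := by rintro ⟨j, rfl⟩; exact j.2 hi
    have : (splitE Ψ hΨ).symm i = .inr ⟨i, hi'⟩ := by rw [Equiv.symm_apply_eq]; simp
    simp [z0, this]
  let u0 : K → V := fun _ => Classical.arbitrary V
  have hS : ∀ u, Sum.elim y (z0 u) ∘ S = Sum.elim y (z0 u0) ∘ S := by
    intro u; ext i; simp only [Function.comp]
    rcases h : S i with x | x
    · rfl
    · exact hz0n _ _ _ ⟨i, h⟩
  change pr (fun u : K → V => Function.Injective (Sum.elim y (z0 u) ∘ S) ∧ 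
    pr (fun B : Fin r → Fin a ⊕ Fin s => pull H (Sum.elim y (z0 u)) (Fin.append S B)) < δ) ≤ _
  simp only [hS]
  by_cases hin : Function.Injective (Sum.elim y (z0 u0) ∘ S)
  swap
  · refine le_trans (pr_mono (q := fun _ => False) fun u hu => hin hu.1) ?_
    simp only [pr, ex, ind]; simp; positivity
  have h1 := ustat (ι := K) (t := t) hr (fun B => H (Fin.append (Sum.elim y (z0 u0) ∘ S) B)) hξ (hH.deg _ hin) (by omega) ht0 (by
    have : (0:ℝ) ≤ a + d := by positivity
    nlinarith [sq_nonneg (r:ℝ)])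
  refine (pr_mono fun u hu => ?_).trans h1
  have h2 := pr_restrict' (fun i : K => (Sum.inr i.1 : Fin a ⊕ Fin s)) (fun i j h => Subtype.ext (Sum.inr_injective h)) r
    (fun B => pull H (Sum.elim y (z0 u)) (Fin.append S B))
  have h3 : ∀ B : Fin r → K, pull H (Sum.elim y (z0 u)) (Fin.append S ((fun i : K => (Sum.inr i.1 : Fin a ⊕ Fin s)) ∘ B)) ↔
      H (Fin.append (Sum.elim y (z0 u0) ∘ S) (u ∘ B)) := by
    intro B; unfold pull; rw [append_comp, hS]
    have : Sum.elim y (z0 u) ∘ (fun i : K => (Sum.inr i.1 : Fin a ⊕ Fin s)) ∘ B = u ∘ B := by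
      ext i; simp [hz0K]
    rw [this]
  simp only [h3] at h2
  have h4 : r * (((Nat.card (Fin a ⊕ Fin s) : ℝ) - Nat.card K) / Nat.card (Fin a ⊕ Fin s)) ≤ ξ := by
    simp only [Nat.card_eq_fintype_card, Fintype.card_sum, Fintype.card_fin]
    push_cast
    rw [← mul_div_assoc, div_le_iff₀ (by positivity)]
    have : (r:ℝ) * (a + s - Fintype.card K) ≤ r * (a + d) := by gcongr; linarith
    have e2 : (r:ℝ) * (a+d) ≤ r^2 * (a+d+1) := by
      have h9 : (0:ℝ) ≤ a + d := by positivity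
      have h8 : (r:ℝ) ≤ r^2 := by nlinarith
      calc (r:ℝ) * (a+d) ≤ r^2 * (a+d) := by gcongr
        _ ≤ _ := mul_le_mul_of_nonneg_left (by linarith) (by positivity)
    have e3 : 0 ≤ ξ * a := by positivity
    have e4 : 0 ≤ ξ * d := by positivity
    linarith
  linarith [hu.2]

lemma typ_bound {V : Type} [Finite V] [Nonempty V] {d r a s t : ℕ} {δ ξ : ℝ} (hr : 0 < r) (hξ : 0 < ξ)
    {H : (Fin (d+r) → V) → Prop} (hH : Host d r (δ + 4 * ξ) H) (y : Fin a → V) (hy : Function.Injective y)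
    (ht : t * r + d ≤ s) (ht0 : 0 < t)
    (hs : (r:ℝ)^2 * (a + d + 1) + ξ * d ≤ ξ * s) :
    pr (fun z : Fin s → V => ¬ Typ d r δ (pull H (Sum.elim y z))) ≤
      ((a + s : ℕ):ℝ)^d * Real.exp (-(ξ^2/2) * t) + ((s:ℝ)^2 + s * a) / Nat.card V := by
  have h1 : ∀ z : Fin s → V, ¬ Typ d r δ (pull H (Sum.elim y z)) →
      (∃ S : Fin d → Fin a ⊕ Fin s, Function.Injective (Sum.elim y z ∘ S) ∧
      pr (fun B : Fin r → Fin a ⊕ Fin s => pull H (Sum.elim y z) (Fin.append S B)) < δ) ∨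
      (¬ Function.Injective z ∨ ∃ p : Fin s × Fin a, z p.1 = y p.2) := by
    intro z hz
    unfold Typ at hz; push Not at hz
    obtain ⟨S, hS, hlt⟩ := hz
    by_cases hg : ¬ Function.Injective z ∨ ∃ p : Fin s × Fin a, z p.1 = y p.2
    · exact .inr hg
    · push Not at hg
      refine .inl ⟨S, Function.Injective.comp ?_ hS, hlt⟩
      exact Function.Injective.sumElim hy hg.1 fun i j h => hg.2 (j, i) h.symm
  refine (pr_mono h1).trans ((pr_or _ _).trans (add_le_add ?_ ?_))
  · refine (pr_exists_le _ _ fun S => typ_one hr hξ hH y S ht ht0 hs).trans (le_of_eq ?_)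
    simp
  · refine (pr_or _ _).trans ?_
    rw [add_div]
    refine add_le_add (by simpa using pr_not_inj (V := V) (ι := Fin s)) ?_
    refine (pr_exists_le _ (1 / (Nat.card V:ℝ)) ?_).trans (le_of_eq ?_)
    · rintro ⟨i, j⟩
      exact (pr_coord (V := V) i (fun v => v = y j)).trans_le (pr_eq_le _)
    · simp; ring

lemma typ_sample (d r A M : ℕ) (δ ξ : ℝ) (hr : 0 < r) (hξ : 0 < ξ) :
    ∃ s0 : ℕ, ∀ s ≥ s0, ∃ n0 : ℕ, ∀ (V : Type) [Finite V], n0 ≤ Nat.card V →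
      ∀ H : (Fin (d+r) → V) → Prop, Host d r (δ + ξ) H → ∀ a ≤ A, ∀ y : Fin a → V, Function.Injective y →
      pr (fun z : Fin s → V => ¬ Typ d r δ (pull H (Sum.elim y z))) ≤ 1 / (s:ℝ)^M := by
  set ζ := ξ / 4 with hζ
  have hζp : 0 < ζ := by positivity
  set c := ζ^2/2 with hc
  have hcp : 0 < c := by positivity
  have hrp : (0:ℝ) < r := by exact_mod_cast hr
  set q := Real.exp (-(c / r)) with hq
  have hq1 : |q| < 1 := by
    rw [hq, abs_of_pos (Real.exp_pos _), Real.exp_lt_one_iff]; simp; positivity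
  have hlim := tendsto_pow_const_mul_const_pow_of_abs_lt_one (d + M) hq1
  have hlim2 := (hlim.const_mul ((2:ℝ)^d * Real.exp (c * (d+1))))
  rw [mul_zero] at hlim2
  have hev := (hlim2.eventually (gt_mem_nhds (show (0:ℝ) < 1/2 by norm_num)))
  obtain ⟨s1, hs1⟩ := Filter.eventually_atTop.1 hev
  obtain ⟨s2, hs2⟩ := exists_nat_gt (((r:ℝ)^2 * (A + d + 1) + ζ * d) / ζ)
  refine ⟨max (max s1 s2) (max (A+1) (r + d)), fun s hs => ?_⟩
  simp only [ge_iff_le, max_le_iff] at hs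
  obtain ⟨n0, hn0⟩ := exists_nat_gt (((s:ℝ)^2 + s * A) * (2 * s^M))
  refine ⟨n0 + 1, fun V _ hV H hH a ha y hy => ?_⟩
  have hVp : 0 < Nat.card V := by omega
  have hVne : Nonempty V := (Nat.card_pos_iff.1 hVp).1
  have hsp : (0:ℝ) < s := by exact_mod_cast (by omega : 0 < s)
  have ha' : (a:ℝ) ≤ A := by exact_mod_cast ha
  set t := (s - d) / r with ht
  have ht1 : t * r ≤ s - d := Nat.div_mul_le_self _ _
  have ht0 : 0 < t := Nat.div_pos (by omega) hr
  have hH' : Host d r (δ + 4 * ζ) H := by rw [hζ]; convert hH using 2; ring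
  refine (typ_bound (t := t) hr hζp hH' y hy (by omega) ht0 ?_).trans ?_
  · rw [div_lt_iff₀ hζp] at hs2
    have : (s2:ℝ) ≤ s := by exact_mod_cast hs.1.2
    nlinarith [sq_nonneg (r:ℝ)]
  · have e1 : ((s:ℝ)^2 + s * a) / Nat.card V ≤ 1 / (2 * s^M) := by
      rw [div_le_div_iff₀ (by exact_mod_cast hVp) (by positivity)]
      have : (n0:ℝ) ≤ Nat.card V := by exact_mod_cast (by omega : n0 ≤ Nat.card V)
      have h5 : ((s:ℝ)^2 + s * a) * (2 * s^M) ≤ ((s:ℝ)^2 + s * A) * (2 * s^M) := by gcongr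
      linarith
    have e2 : ((a + s : ℕ):ℝ)^d * Real.exp (-c * t) ≤ 1 / (2 * s^M) := by
      have h6 : ((a + s : ℕ):ℝ)^d ≤ 2^d * s^d := by
        rw [← mul_pow]; gcongr; push_cast
        have : (A:ℝ) ≤ s := by exact_mod_cast (by omega : A ≤ s)
        linarith
      have h7 : Real.exp (-c * t) ≤ Real.exp (c * (d+1)) * q ^ s := by
        rw [hq, ← Real.exp_nat_mul, ← Real.exp_add, Real.exp_le_exp]
        have : (s:ℝ) ≤ r * (t + d + 1) := by
          have h8 := Nat.lt_div_mul_add (a := s - d) hr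
          have h9 : s ≤ r * (t + d + 1) := by
            rw [← ht] at h8
            have : d ≤ r * d := Nat.le_mul_of_pos_left d hr
            have e : r * (t + d + 1) = t * r + r * d + r := by ring
            omega
          exact_mod_cast h9
        have h10 : (s:ℝ) / r ≤ t + d + 1 := by rw [div_le_iff₀ hrp]; linarith
        have h11 : (s:ℝ) * -(c / r) = -(c * (s / r)) := by ring
        rw [h11]; nlinarith
      have h8 := hs1 s hs.1.1
      rw [le_div_iff₀ (by positivity)]
      calc ((a + s : ℕ):ℝ)^d * Real.exp (-c * t) * (2 * s^M) ≤ (2^d * s^d) * (Real.exp (c * (d+1)) * q ^ s) * (2 * s^M) := by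
            gcongr
        _ = 2 * (2 ^ d * Real.exp (c * (d + 1)) * (s ^ (d + M) * q ^ s)) := by rw [pow_add]; ring
        _ ≤ 1 := by linarith
    have e3 : 1 / (2 * (s:ℝ)^M) + 1 / (2 * s^M) = 1 / s^M := by field_simp; norm_num
    linarith
end
end TH

open Finset
set_option linter.all false
namespace TH
open scoped Classical
noncomputable section

structure Par (d r : ℕ) (δ ν : ℝ) : Prop where
  hr : 0 < r
  hd : 0 < d
  hδ : 0 < δ
  hν : 0 < ν
  hpow : 1/2 + ν ≤ δ ^ r
  hδ1 : 1/2 + ν ≤ δ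
  hrk : (r:ℝ) ≤ δ * (d + r)

def Big (d : ℕ) (ν : ℝ) (n : ℕ) : Prop := 3 * d < n ∧ (d:ℝ)^2 ≤ ν / 2 * n

lemma con_pull {V ι : Type} {q : ℕ} {H : (Fin q → V) → Prop} {g : ι → V} {x y} (h : Con (pull H g) x y) :
    Con H (g ∘ x) (g ∘ y) :=
  h.map (fun x => g ∘ x) (by
    rintro x y ⟨h1, h2, j, hj⟩
    exact ⟨h1, h2, j, fun i hi => by simp [hj i hi]⟩)

lemma T_perm {ι : Type} [Finite ι] {q : ℕ} {P : (Fin q → ι) → Prop} (hP : ∀ x (σ : Equiv.Perm (Fin q)), P x → P (x ∘ σ))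
    {x} (σ : Equiv.Perm (Fin q)) (h : T P x) : T P (x ∘ σ) := by
  refine ⟨hP _ _ h.1, h.2.trans_le ?_⟩
  rw [← pr_equiv (Equiv.arrowCongr σ.symm (Equiv.refl ι)) (Con P (x ∘ σ))]
  refine pr_mono fun y hy => ?_
  refine hy.map (fun y => Equiv.arrowCongr σ.symm (Equiv.refl ι) y) ?_
  rintro x y ⟨h1, h2, j, hj⟩
  refine ⟨hP _ _ h1, hP _ _ h2, σ.symm j, fun i hi => ?_⟩
  simp [Equiv.arrowCongr]
  exact hj _ fun h => hi (by rw [← h]; simp)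

lemma T_equiv {ι κ : Type} [Finite ι] [Finite κ] {q : ℕ} {P : (Fin q → ι) → Prop} (e : κ ≃ ι) {x} (h : T (pull P e) x) :
    T P (e ∘ x) := by
  refine ⟨h.1, h.2.trans_le ?_⟩
  rw [← pr_equiv (Equiv.arrowCongr (Equiv.refl _) e) (Con P (e ∘ x))]
  exact pr_mono fun y hy => con_pull hy

lemma T_up {ι κ : Type} [Fintype ι] [Fintype κ] {d r : ℕ} {δ ν : ℝ} (hp : Par d r δ ν) {P : (Fin (d+r) → ι) → Prop}
    (j : κ → ι) (hj : Function.Injective j) (hP : Typ d r δ P) (hP' : Typ d r δ (pull P j))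
    (hb : Big d ν (Fintype.card κ)) (hc : ((d+r:ℕ):ℝ) * ((Fintype.card ι : ℝ) - Fintype.card κ) < ν * Fintype.card ι)
    {x} (hx : T (pull P j) x) : T P (j ∘ x) := by
  have hle : Fintype.card κ ≤ Fintype.card ι := Fintype.card_le_of_injective j hj
  have hle' : (Fintype.card κ:ℝ) ≤ Fintype.card ι := by exact_mod_cast hle
  have hpos : (0:ℝ) < Fintype.card ι := by exact_mod_cast (by have := hb.1; omega : 0 < Fintype.card ι)
  have hneι : Nonempty ι := Fintype.card_pos_iff.1 (by exact_mod_cast hpos)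
  have hneκ : Nonempty κ := Fintype.card_pos_iff.1 (by have := hb.1; omega)
  have h1 := (struct hp.hr hp.hδ hp.hν hp.hpow hP (by have := hb.1; omega) (hb.2.trans (by have := hp.hν; gcongr))).2
  have h2 := (struct hp.hr hp.hδ hp.hν hp.hpow hP' hb.1 hb.2).2
  have h3 := pr_restrict j hj (d+r) (T P)
  rw [Nat.card_eq_fintype_card, Nat.card_eq_fintype_card] at h3
  have h4 : ((d+r:ℕ):ℝ) * (((Fintype.card ι : ℝ) - Fintype.card κ) / Fintype.card ι) < ν := by
    rw [← mul_div_assoc, div_lt_iff₀ hpos]; exact hc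
  obtain ⟨y, hy1, hy2⟩ := exists_and_of_pr (p := T (pull P j)) (q := fun x => T P (j ∘ x)) (by linarith)
  exact hy2.of_con (con_pull (hx.con hy1)).symm

/-- perfect fractional matching -/
def PFM {ι : Type} [Fintype ι] {q : ℕ} (A : (Fin q → ι) → Prop) : Prop :=
  ∃ w : (Fin q → ι) → ℝ, (∀ x, 0 ≤ w x) ∧ (∀ x, w x ≠ 0 → A x) ∧ ∀ a, ∑ x, w x * ((univ.filter fun j => x j = a).card : ℝ) = 1

lemma PFM.mono {ι : Type} [Fintype ι] {q : ℕ} {A B : (Fin q → ι) → Prop} (h : PFM A) (hAB : ∀ x, A x → B x) : PFM B := by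
  obtain ⟨w, h1, h2, h3⟩ := h
  exact ⟨w, h1, fun x hx => hAB _ (h2 x hx), h3⟩

lemma farkas {ι : Type} [Fintype ι] [Nonempty ι] {q : ℕ} (A : (Fin q → ι) → Prop) (hne : ∃ x, A x) (hq : 0 < q)
    (h : ∀ y : ι → ℝ, ∃ x, A x ∧ Fintype.card ι * ∑ j, y (x j) ≤ q * ∑ a, y a) : PFM A := by
  let Sb := {x // A x}
  have : Nonempty Sb := ⟨⟨_, hne.choose_spec⟩⟩
  have hn : (0:ℝ) < Fintype.card ι := by exact_mod_cast Fintype.card_pos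
  have hq' : (0:ℝ) < q := by exact_mod_cast hq
  let cnt : (Fin q → ι) → ι → ℝ := fun x a => ((univ.filter fun j => x j = a).card : ℝ)
  let Lm : (Sb → ℝ) →ₗ[ℝ] (ι → ℝ) := 
    { toFun := fun w a => ∑ x, w x * cnt x.1 a
      map_add' := fun u v => by ext a; simp [add_mul, Finset.sum_add_distrib]
      map_smul' := fun c u => by ext a; simp [mul_assoc, Finset.mul_sum] }
  have hLc : Continuous Lm := Lm.continuous_of_finiteDimensional
  let K := Lm '' stdSimplex ℝ Sb
  have hK1 : Convex ℝ K := (convex_stdSimplex ℝ Sb).linear_image Lm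
  have hK2 : IsClosed K := ((isCompact_stdSimplex ℝ Sb).image hLc).isClosed
  let t : ι → ℝ := fun _ => (q:ℝ) / Fintype.card ι
  by_cases ht : t ∈ K
  · obtain ⟨w, hw, hwt⟩ := ht
    refine ⟨fun x => if hx : A x then (Fintype.card ι / q) * w ⟨x, hx⟩ else 0, fun x => ?_, fun x hx => ?_, fun a => ?_⟩
    · dsimp only; split_ifs
      · have := hw.1 ⟨x, ‹_›⟩; positivity
      · exact le_rfl
    · by_contra hc; simp [hc] at hx
    · have h1 := congrFun hwt a
      simp only [Lm, LinearMap.coe_mk, AddHom.coe_mk, t, cnt] at h1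
      have h2 : ∑ x : Fin q → ι, (if hx : A x then (Fintype.card ι / q : ℝ) * w ⟨x, hx⟩ else 0) * ((univ.filter fun j => x j = a).card : ℝ)
          = ∑ x : Sb, (Fintype.card ι / q : ℝ) * (w x * ((univ.filter fun j => x.1 j = a).card : ℝ)) := by
        rw [← Finset.sum_filter_of_ne (p := A)]
        · rw [Finset.sum_subtype (p := A) (univ.filter A) (by simp)]
          refine Finset.sum_congr rfl fun x _ => ?_
          rw [dif_pos x.2]; ring
        · intro x _ hx; by_contra hc; simp [hc] at hx
      rw [h2, ← Finset.mul_sum]; erw [h1]; field_simp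
  · obtain ⟨f, u, hf1, hf2⟩ := geometric_hahn_banach_closed_point hK1 hK2 ht
    obtain ⟨x, hx, hle⟩ := h (fun a => - f (Pi.single a 1))
    have hfe : ∀ v : ι → ℝ, f v = ∑ a, v a * f (Pi.single a 1) := by
      intro v
      conv_lhs => rw [← Finset.univ_sum_single v]
      rw [map_sum]; refine Finset.sum_congr rfl fun a _ => ?_
      rw [show (Pi.single a (v a) : ι → ℝ) = v a • Pi.single a 1 by rw [← Pi.single_smul]; simp, map_smul]; rfl
    have h3 : cnt x ∈ K := by
      refine ⟨Pi.single ⟨x, hx⟩ 1, single_mem_stdSimplex ℝ _, ?_⟩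
      ext a
      simp only [Lm, LinearMap.coe_mk, AddHom.coe_mk]
      rw [Finset.sum_eq_single (⟨x, hx⟩ : Sb)]
      · simp
      · intro b _ hb; rw [Pi.single_eq_of_ne hb, zero_mul]
      · simp
    have h4 := (hf1 _ h3).trans hf2
    rw [hfe, hfe t] at h4
    have h5 : ∑ a, cnt x a * f (Pi.single a 1) = ∑ j, f (Pi.single (x j) 1) := by
      simp only [cnt, Finset.card_filter, Nat.cast_sum, Finset.sum_mul]
      rw [Finset.sum_comm]; refine Finset.sum_congr rfl fun j _ => ?_
      simp
    rw [h5] at h4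
    simp only [t] at h4
    rw [← Finset.mul_sum] at h4
    simp only [Finset.sum_neg_distrib] at hle
    have h6 := mul_lt_mul_of_pos_left h4 hn
    rw [← mul_assoc, mul_div_cancel₀ _ hn.ne'] at h6
    linarith
end
end TH

open Finset
set_option linter.all false
namespace TH
open scoped Classical
noncomputable section

lemma pfm_of_typ {ι : Type} [Fintype ι] {d r : ℕ} {δ ν : ℝ} (hp : Par d r δ ν) {P : (Fin (d+r) → ι) → Prop}
    (hinj : ∀ x, P x → Function.Injective x) (hP : Typ d r δ P) (hb : Big d ν (Fintype.card ι)) : PFM (T P) := by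
  have hs := (struct hp.hr hp.hδ hp.hν hp.hpow hP hb.1 hb.2).1
  have hne : Nonempty ι := Fintype.card_pos_iff.1 (by have := hb.1; omega)
  have hn : (0:ℝ) < Fintype.card ι := by exact_mod_cast Fintype.card_pos
  obtain ⟨S0⟩ : Nonempty {S : Fin d → ι // Function.Injective S} := by
    obtain ⟨f⟩ := Function.Embedding.nonempty_of_card_le (α := Fin d) (β := ι) (by have := hb.1; simp; omega)
    exact ⟨⟨f, f.injective⟩⟩
  have hd0 : (0:ℝ) < d := by exact_mod_cast hp.hd
  refine farkas _ ?_ (by have := hp.hd; omega) ?_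
  · obtain ⟨C, M, ⟨B, hB⟩, hC, _⟩ := hs S0.1 S0.2
    exact ⟨_, hC B hB⟩
  intro y
  haveI : Nonempty {S : Fin d → ι // Function.Injective S} := ⟨S0⟩
  obtain ⟨⟨S, hS⟩, hmin⟩ := Finite.exists_min (fun S : {S : Fin d → ι // Function.Injective S} => ∑ j, y (S.1 j))
  set a := (∑ j, y (S j)) / d with ha
  have hda : ∑ j, y (S j) = d * a := by rw [ha]; field_simp
  -- values off S
  have hoff : ∀ v, v ∉ Set.range S → a ≤ y v := by
    intro v hv
    have h1 : ∀ j, y (S j) ≤ y v := by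
      intro j
      have hSi : Function.Injective (Function.update S j v) := by
        intro p q hpq
        by_cases hp : p = j <;> by_cases hq : q = j
        · rw [hp, hq]
        · subst hp; rw [Function.update_self, Function.update_of_ne hq] at hpq; exact absurd ⟨q, hpq.symm⟩ hv
        · subst hq; rw [Function.update_self, Function.update_of_ne hp] at hpq; exact absurd ⟨p, hpq⟩ hv
        · rw [Function.update_of_ne hq, Function.update_of_ne hp] at hpq; exact hS hpq
      have h2 := hmin ⟨_, hSi⟩
      simp only at h2
      rw [← Finset.add_sum_erase _ _ (mem_univ j), ← Finset.add_sum_erase univ (fun i => y (Function.update S j v i)) (mem_univ j)] at h2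
      rw [Finset.sum_congr rfl (g := fun i => y (S i)) (fun i hi => by rw [Function.update_of_ne (Finset.ne_of_mem_erase hi)]) (s₁ := univ.erase j) (f := fun i => y (Function.update S j v i))] at h2
      simp only [Function.update_self] at h2
      linarith
    have h3 : ∑ j, y (S j) ≤ ∑ _j : Fin d, y v := Finset.sum_le_sum fun j _ => h1 j
    rw [hda] at h3; simp at h3
    exact le_of_mul_le_mul_left h3 hd0
  let X : ι → ℝ := fun v => if v ∈ Set.range S then 0 else y v - a
  have hX0 : ∀ v, 0 ≤ X v := by
    intro v; simp only [X]; split_ifs with h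
    · exact le_rfl
    · linarith [hoff v h]
  have hsumS : ∑ v, (if v ∈ Set.range S then y v - a else 0) = 0 := by
    rw [← Finset.sum_filter]
    have : univ.filter (fun v => v ∈ Set.range S) = univ.image S := by ext v; simp
    rw [this, Finset.sum_image (fun p _ q _ h => hS h)]
    simp [hda]
  have hsumX : ∑ v, y v = ∑ v, X v + Fintype.card ι * a := by
    have : ∀ v, y v = X v + (if v ∈ Set.range S then y v - a else 0) + a := by
      intro v; simp only [X]; split_ifs <;> ring
    rw [Finset.sum_congr rfl fun v _ => this v, Finset.sum_add_distrib, Finset.sum_add_distrib, hsumS]; simp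
  obtain ⟨C, M, hCne, hC, -, hfib, hM⟩ := hs S hS
  by_contra! hcon
  have key : ∀ B ∈ C, (d+r) * ∑ v, X v < Fintype.card ι * ∑ j, X (B j) := by
    intro B hB
    have h1 := hcon _ (hC B hB)
    rw [Fin.sum_univ_add] at h1
    simp only [Fin.append_left, Fin.append_right] at h1
    have hi := hinj _ (hC B hB).1
    have h2 : ∀ j, X (B j) = y (B j) - a := by
      intro j; simp only [X]; rw [if_neg]
      rintro ⟨i, hi'⟩
      have := @hi (Fin.castAdd r i) (Fin.natAdd d j) (by simp [hi'])
      have := congrArg Fin.val this; simp at this; omega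
    simp only [h2, Finset.sum_sub_distrib]
    rw [hda, hsumX] at h1
    push_cast at h1
    simp
    nlinarith
  have h1 : ∑ B ∈ C, (d+r) * ∑ v, X v < ∑ B ∈ C, Fintype.card ι * ∑ j, X (B j) := Finset.sum_lt_sum_of_nonempty hCne key
  have h2 : ∑ B ∈ C, ∑ j, X (B j) ≤ (∑ j, (M j : ℝ)) * ∑ v, X v := by
    rw [Finset.sum_comm, Finset.sum_mul]
    refine Finset.sum_le_sum fun j _ => ?_
    have : ∑ B ∈ C, X (B j) = ∑ v, ((C.filter fun B => B j = v).card : ℝ) * X v := by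
      rw [← Finset.sum_fiberwise (s := C) (g := fun B => B j)]
      refine Finset.sum_congr rfl fun v _ => ?_
      rw [Finset.sum_congr rfl (g := fun _ => X v) (fun B hB => by rw [(Finset.mem_filter.1 hB).2])]
      simp
    rw [this, Finset.mul_sum]
    refine Finset.sum_le_sum fun v _ => mul_le_mul_of_nonneg_right ?_ (hX0 v)
    exact_mod_cast hfib j v
  rw [Finset.sum_const, nsmul_eq_mul, ← Finset.mul_sum] at h1
  have hXs : 0 ≤ ∑ v, X v := Finset.sum_nonneg fun v _ => hX0 v
  have hδ := hp.hδ
  have h3 : δ * (Fintype.card ι * ∑ B ∈ C, ∑ j, X (B j)) ≤ r * C.card * ∑ v, X v := by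
    calc δ * (Fintype.card ι * ∑ B ∈ C, ∑ j, X (B j)) ≤ δ * (Fintype.card ι * ((∑ j, (M j : ℝ)) * ∑ v, X v)) := by gcongr
      _ = (δ * Fintype.card ι * ∑ j, (M j : ℝ)) * ∑ v, X v := by ring
      _ ≤ _ := mul_le_mul_of_nonneg_right hM hXs
  have h4 := mul_lt_mul_of_pos_left h1 hδ
  have hXs' : 0 ≤ (C.card:ℝ) * ∑ v, X v := mul_nonneg (Nat.cast_nonneg _) hXs
  have h5 := mul_le_mul_of_nonneg_left hp.hrk hXs'
  nlinarith

/-- robust edges -/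
def G {V : Type} {q : ℕ} (H : (Fin q → V) → Prop) (s : ℕ) (e : Fin q → V) : Prop :=
  1 / (s:ℝ)^(q+1) ≤ pr fun R : Fin s → V => T (pull H (Sum.elim e R)) Sum.inl

lemma G.H {V : Type} [Finite V] {q : ℕ} {H : (Fin q → V) → Prop} {s : ℕ} (hs : 0 < s) {e : Fin q → V} (h : G H s e) : H e := by
  obtain ⟨R, hR⟩ := exists_of_pr (lt_of_lt_of_le (by positivity) h)
  exact hR.1

lemma G_fail {V : Type} [Finite V] [Nonempty V] {q s : ℕ} {H : (Fin q → V) → Prop} (hs : 0 < s) (x : Fin q → Fin (q+s))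
    (hx : Function.Injective x) :
    pr (fun R : Fin (q+s) → V => T (pull H R) x ∧ ¬ G H s (R ∘ x)) ≤ 1 / (s:ℝ)^(q+1) := by
  unfold pr
  rw [ex_split x hx]
  refine ex_le_const fun y => ?_
  have hc : ∀ z : {i // i ∉ Set.range x} → V, (Sum.elim y z ∘ (splitE x hx).symm) ∘ x = y := by
    intro z; ext i
    have : (splitE x hx).symm (x i) = .inl i := by rw [Equiv.symm_apply_eq]; simp
    simp [this]
  simp only [hc]
  by_cases hG : G H s y
  · refine le_trans (le_of_eq (b := (0:ℝ)) ?_) (by positivity)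
    simp only [hG, not_true, and_false]; simp [ind, ex]
  · have hcard : Nat.card {i // i ∉ Set.range x} = s := by
      have h1 := Nat.card_congr (splitE x hx)
      rw [Nat.card_sum] at h1; simpa using h1
    obtain ⟨ε⟩ : Nonempty ({i // i ∉ Set.range x} ≃ Fin s) := by
      refine ⟨Finite.equivFinOfCardEq hcard⟩
    unfold G at hG; push Not at hG
    refine le_trans ?_ hG.le
    rw [ex_arrowCongr ε]
    refine pr_mono fun R hR => ?_
    have h1 := hR.1
    let e' : Fin q ⊕ Fin s ≃ Fin (q+s) := (Equiv.sumCongr (Equiv.refl _) ε.symm).trans (splitE x hx)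
    have h2 := T_equiv (P := pull H (Sum.elim y R)) (e := e'.symm) (x := x) (by
      convert h1 using 1
      unfold pull; ext u; congr! 1
      ext i; simp only [e', Function.comp, Equiv.symm_trans_apply]
      rcases (splitE x hx).symm (u i) with a | a <;> simp)
    convert h2 using 1
    ext i : 1
    simp only [Function.comp, e']
    rw [eq_comm, Equiv.symm_apply_eq]; simp
end
end TH

open Finset
set_option linter.all false
namespace TH
open scoped Classical
noncomputable section

def Sz (d r : ℕ) (ν : ℝ) (s : ℕ) : Prop := 3 * d < s ∧ (d:ℝ)^2 ≤ ν / 2 * s ∧ ((d+r:ℕ):ℝ)^2 < ν * s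
lemma Sz.big {d r : ℕ} {ν : ℝ} {s : ℕ} (h : Sz d r ν s) (hν : 0 < ν) {n : ℕ} (hn : s ≤ n) : Big d ν n :=
  ⟨h.1.trans_le hn, h.2.1.trans (by gcongr)⟩
lemma Sz_ev (d r : ℕ) {ν : ℝ} (hν : 0 < ν) : ∃ s0, ∀ s ≥ s0, Sz d r ν s := by
  obtain ⟨a, ha⟩ := exists_nat_gt ((d:ℝ)^2 * 2 / ν)
  obtain ⟨b, hb⟩ := exists_nat_gt (((d+r:ℕ):ℝ)^2 / ν)
  refine ⟨3*d+1+a+b, fun s hs => ⟨by omega, ?_, ?_⟩⟩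
  · rw [div_lt_iff₀ hν] at ha
    have : (a:ℝ) ≤ s := by exact_mod_cast (by omega : a ≤ s)
    nlinarith
  · rw [div_lt_iff₀ hν] at hb
    have : (b:ℝ) ≤ s := by exact_mod_cast (by omega : b ≤ s)
    nlinarith

lemma Typ_equiv {ι κ : Type} [Finite ι] [Finite κ] {d r : ℕ} {δ : ℝ} {P : (Fin (d+r) → ι) → Prop} (e : κ ≃ ι)
    (h : Typ d r δ (pull P e)) : Typ d r δ P := by
  intro S hS
  refine (h (e.symm ∘ S) (e.symm.injective.comp hS)).trans (le_of_eq ?_)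
  rw [← pr_equiv (Equiv.arrowCongr (Equiv.refl _) e)]
  congr 1; ext B
  unfold pull; rw [append_comp]
  have : e ∘ e.symm ∘ S = S := by ext; simp
  rw [this]; rfl

lemma grow_prob (d r A M : ℕ) (δ ξ : ℝ) (hr : 0 < r) (hξ : 0 < ξ) :
    ∃ s0 : ℕ, ∀ s ≥ s0, ∀ m, ∃ n0 : ℕ, ∀ (V : Type) [Finite V], n0 ≤ Nat.card V →
      ∀ H : (Fin (d+r) → V) → Prop, Host d r (δ + ξ) H → ∀ a ≤ A, ∀ y : Fin a → V, Function.Injective y →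
      pr (fun z : Fin m → V => ∃ i, ∃ h : i ≤ m, s ≤ i ∧ ¬ Typ d r δ (pull H (Sum.elim y (z ∘ Fin.castLE h)))) ≤ 1 / (s:ℝ)^M := by
  obtain ⟨s0, hs0⟩ := typ_sample d r A (M+2) δ ξ hr hξ
  refine ⟨max s0 2, fun s hs m => ?_⟩
  have hs1 : s0 ≤ s := le_trans (le_max_left _ _) hs
  have hs2 : 2 ≤ s := le_trans (le_max_right _ _) hs
  have hsr : (2:ℝ) ≤ s := by exact_mod_cast hs2
  choose! N hN using hs0
  refine ⟨(∑ i ∈ range (m+1), N i) + 1, fun V _ hV H hH a ha y hy => ?_⟩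
  have hne : Nonempty V := (Nat.card_pos_iff.1 (by omega : 0 < Nat.card V)).1
  have h1 : ∀ i : Fin (m+1), pr (fun z : Fin m → V => ∃ h : i.1 ≤ m, s ≤ i.1 ∧ ¬ Typ d r δ (pull H (Sum.elim y (z ∘ Fin.castLE h))))
      ≤ if s ≤ i.1 then 1 / (i.1:ℝ)^(M+2) else 0 := by
    intro i
    have him : i.1 ≤ m := by omega
    split_ifs with hi
    · refine le_trans (pr_mono (q := fun z : Fin m → V => ¬ Typ d r δ (pull H (Sum.elim y (z ∘ Fin.castLE him)))) fun z hz => hz.2.2) ?_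
      have := pr_marg (V := V) (Fin.castLE him) (Fin.castLE_injective him) (fun z => ¬ Typ d r δ (pull H (Sum.elim y z)))
      rw [this]
      refine hN i.1 (by omega) V (le_trans ?_ hV) H hH a ha y hy
      exact (Finset.single_le_sum (f := N) (fun _ _ => Nat.zero_le _) (Finset.mem_range.2 i.2)).trans (Nat.le_succ _)
    · refine (pr_mono (q := fun _ => False) fun z hz => hi hz.2.1).trans ?_
      simp [pr, ex, ind]
  have h2 := (pr_exists (fun (i : Fin (m+1)) (z : Fin m → V) => ∃ h : i.1 ≤ m, s ≤ i.1 ∧ ¬ Typ d r δ (pull H (Sum.elim y (z ∘ Fin.castLE h))))).trans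
    (Finset.sum_le_sum fun i _ => h1 i)
  refine le_trans (pr_mono ?_) (h2.trans ?_)
  · rintro z ⟨i, h, h'⟩
    exact ⟨⟨i, by omega⟩, h, h'⟩
  · rw [Fin.sum_univ_eq_sum_range (fun i => if s ≤ i then 1 / (i:ℝ)^(M+2) else 0), ← Finset.sum_filter]
    have h3 : (range (m+1)).filter (fun i => s ≤ i) = Finset.Ioo (s-1) (m+1) := by ext i; simp; omega
    rw [h3]
    calc ∑ i ∈ Finset.Ioo (s-1) (m+1), 1 / (i:ℝ)^(M+2) ≤ ∑ i ∈ Finset.Ioo (s-1) (m+1), (1 / (s:ℝ)^M) * ((i:ℝ)^2)⁻¹ := by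
          refine Finset.sum_le_sum fun i hi => ?_
          have hsi : s ≤ i := by have := (Finset.mem_Ioo.1 hi).1; omega
          have : (s:ℝ) ≤ i := by exact_mod_cast hsi
          rw [pow_add, one_div, mul_inv, one_div]; gcongr
      _ ≤ (1 / (s:ℝ)^M) * 1 := by
          rw [← Finset.mul_sum]; gcongr
          refine (sum_Ioo_inv_sq_le (α := ℝ) (s-1) (m+1)).trans ?_
          rw [show (((s-1:ℕ):ℝ)+1) = s by rw [Nat.cast_sub (by omega)]; simp, div_le_one (by linarith)]
          exact hsr
      _ = _ := mul_one _

lemma grow {V : Type} {d r : ℕ} {δ ν : ℝ} (hp : Par d r δ ν) {H : (Fin (d+r) → V) → Prop} {s a : ℕ} (hs : Sz d r ν s)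
    (y : Fin a → V) (x : Fin (d+r) → Fin a ⊕ Fin s) :
    ∀ m (hm : s ≤ m) (z : Fin m → V), (∀ i, ∀ h : i ≤ m, s ≤ i → Typ d r δ (pull H (Sum.elim y (z ∘ Fin.castLE h)))) →
    T (pull H (Sum.elim y (z ∘ Fin.castLE hm))) x → T (pull H (Sum.elim y z)) (Sum.map id (Fin.castLE hm) ∘ x) := by
  have hk : (1:ℝ) ≤ ((d+r:ℕ):ℝ) := by exact_mod_cast (by have := hp.hd; omega : 1 ≤ d + r)
  have hν := hp.hν
  intro m hm
  induction m, hm using Nat.le_induction with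
  | base => intro z _ h; simpa using h
  | succ m hm ih =>
    intro z hz h
    have h1 := ih (z ∘ Fin.castSucc) (fun i h hi => hz i (by omega) hi) h
    have h2 := T_up hp (P := pull H (Sum.elim y z)) (Sum.map id Fin.castSucc) (Function.Injective.sumMap Function.injective_id (Fin.castSucc_injective m))
      (hz (m+1) le_rfl (by omega)) (κ := Fin a ⊕ Fin m) (x := Sum.map id (Fin.castLE hm) ∘ x) ?_ (hs.big hp.hν (by simp; omega)) ?_ ?_
    · convert h2 using 1
      ext i : 1; simp only [Function.comp]; rcases x i with a|a <;> rfl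
    · convert hz m (by omega) hm using 1
      unfold pull; ext u; congr! 1; ext i
      simp only [Function.comp]; rcases u i with a|a <;> rfl
    · simp only [Fintype.card_sum, Fintype.card_fin]; push_cast
      have : (s:ℝ) ≤ m := by exact_mod_cast hm
      have h3 := hs.2.2
      push_cast at hk h3 ⊢
      have : 0 ≤ ν * a := by positivity
      nlinarith
    · convert h1 using 1
      unfold pull; ext u; congr! 1; ext i
      simp only [Function.comp]; rcases u i with a|a <;> rfl

lemma pr_indep {V : Type} [Finite V] {a b : ℕ} (A : (Fin a → V) → Prop) (B : (Fin b → V) → Prop) :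
    pr (fun z : Fin (a+b) → V => A (z ∘ Fin.castAdd b) ∧ B (z ∘ Fin.natAdd a)) = pr A * pr B := by
  unfold pr; rw [ex_append]
  have h1 : ∀ (S : Fin a → V) (T : Fin b → V), Fin.append S T ∘ Fin.castAdd b = S := fun S T => by ext; simp
  have h2 : ∀ (S : Fin a → V) (T : Fin b → V), Fin.append S T ∘ Fin.natAdd a = T := fun S T => by ext; simp
  simp only [h1, h2]
  have : ∀ S T, ind (A S ∧ B T) = ind (A S) * ind (B T) := by
    intro S T; unfold ind; split_ifs <;> simp_all
  simp only [this, ex_mul]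
  rw [mul_comm, ← ex_mul]; congr 1; ext; ring

lemma G_mono (d r : ℕ) (δ ν ξ : ℝ) (hp : Par d r δ ν) (hξ : 0 < ξ) :
    ∃ s0 : ℕ, ∀ s ≥ s0, ∀ s' ≥ 4 * s, ∃ n0 : ℕ, ∀ (V : Type) [Finite V], n0 ≤ Nat.card V →
      ∀ H : (Fin (d+r) → V) → Prop, Host d r (δ + ξ) H → ∀ e : Fin (d+r) → V,
      1 / (2 * (s:ℝ)^(d+r+1)) ≤ pr (fun R : Fin s → V => T (pull H (Sum.elim e R)) Sum.inl) → G H s' e := by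
  obtain ⟨s0, hs0⟩ := grow_prob d r (d+r) (d+r+2) δ ξ hp.hr hξ
  obtain ⟨s1, hs1⟩ := Sz_ev d r hp.hν
  refine ⟨max (max s0 s1) 4, fun s hs s' hs' => ?_⟩
  simp only [ge_iff_le, max_le_iff] at hs
  have hsr : (4:ℝ) ≤ s := by exact_mod_cast hs.2
  obtain ⟨n0, hn0⟩ := hs0 s hs.1.1 s'
  refine ⟨n0+1, fun V _ hV H hH e he => ?_⟩
  have hne : Nonempty V := (Nat.card_pos_iff.1 (by omega : 0 < Nat.card V)).1
  have hss : s ≤ s' := by omega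
  obtain ⟨R, hR⟩ := exists_of_pr (lt_of_lt_of_le (by positivity) he)
  have hei : Function.Injective e := hH.inj _ hR.1
  have h1 := hn0 V (by omega) H hH (d+r) le_rfl e hei
  have h2 := pr_marg (V := V) (Fin.castLE hss) (Fin.castLE_injective hss) (fun R => T (pull H (Sum.elim e R)) Sum.inl)
  rw [← h2] at he
  have h3 := pr_sub (fun z : Fin s' → V => T (pull H (Sum.elim e (z ∘ Fin.castLE hss))) Sum.inl)
    (fun z : Fin s' → V => ∃ i, ∃ h : i ≤ s', s ≤ i ∧ ¬ Typ d r δ (pull H (Sum.elim e (z ∘ Fin.castLE h))))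
  have h4 : 1 / (s':ℝ)^(d+r+1) ≤ 1 / (2 * (s:ℝ)^(d+r+1)) - 1 / (s:ℝ)^(d+r+2) := by
    have e1 : 1 / (s:ℝ)^(d+r+2) ≤ 1 / (4 * (s:ℝ)^(d+r+1)) := by
      rw [pow_succ (s:ℝ) (d+r+1)]; apply one_div_le_one_div_of_le (by positivity); nlinarith [pow_pos (by linarith : (0:ℝ) < s) (d+r+1)]
    have e2 : 1 / (s':ℝ)^(d+r+1) ≤ 1 / (4 * (s:ℝ)^(d+r+1)) := by
      have : (4 * (s:ℝ)) ≤ s' := by exact_mod_cast hs'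
      have : (4 * (s:ℝ))^(d+r+1) ≤ (s':ℝ)^(d+r+1) := by gcongr
      gcongr
      refine le_trans ?_ this
      rw [mul_pow]; gcongr
      calc (4:ℝ) = 4^1 := by norm_num
        _ ≤ 4^(d+r+1) := by gcongr <;> [norm_num; omega]
    have e3 : 1 / (2 * (s:ℝ)^(d+r+1)) = 1 / (4 * (s:ℝ)^(d+r+1)) + 1 / (4 * (s:ℝ)^(d+r+1)) := by field_simp; norm_num
    linarith
  refine h4.trans (le_trans (by linarith) (h3.trans (pr_mono ?_)))
  rintro z ⟨hz1, hz2⟩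
  push Not at hz2
  exact grow hp (hs1 s hs.1.2) e Sum.inl s' hss z (fun i h hi => hz2 i h hi) hz1
end
end TH

open Finset
set_option linter.all false
namespace TH
open scoped Classical
noncomputable section

lemma G_connect (d r : ℕ) (δ ν ξ : ℝ) (hp : Par d r δ ν) (hξ : 0 < ξ) :
    ∃ s0 : ℕ, ∀ s ≥ s0, ∃ n0 : ℕ, ∀ (V : Type) [Finite V], n0 ≤ Nat.card V →
      ∀ H : (Fin (d+r) → V) → Prop, Host d r (δ + ξ) H → ∀ e e' : Fin (d+r) → V, G H s e → G H s e' →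
      Function.Injective (Fin.append e e') →
      1 / (2 * ((s:ℝ)^(d+r+1))^2) ≤ pr (fun z : Fin (s+s) → V => ∀ σ : Equiv.Perm (Fin (d+r)),
        Con (pull H (Sum.elim (Fin.append e e') z)) (Sum.inl ∘ Fin.castAdd (d+r) ∘ σ) (Sum.inl ∘ Fin.natAdd (d+r))) := by
  obtain ⟨s0, hs0⟩ := grow_prob d r (d+r) (2*(d+r+1)+3) δ ξ hp.hr hξ
  obtain ⟨s1, hs1⟩ := Sz_ev d r hp.hν
  obtain ⟨s2, hs2⟩ := typ_sample d r ((d+r)+(d+r)) (2*(d+r+1)+3) δ ξ hp.hr hξ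
  refine ⟨max (max (max s0 s1) s2) 2, fun s hs => ?_⟩
  simp only [ge_iff_le, max_le_iff] at hs
  obtain ⟨⟨⟨h0, h1⟩, h2⟩, h2'⟩ := hs
  have hsr : (2:ℝ) ≤ s := by exact_mod_cast h2'
  have hsz := hs1 s h1
  have hν := hp.hν
  have hk : (1:ℝ) ≤ ((d+r:ℕ):ℝ) := by exact_mod_cast (by have := hp.hd; omega : 1 ≤ d + r)
  obtain ⟨n0, hn0⟩ := hs0 s h0 (s+s)
  obtain ⟨n2, hn2⟩ := hs2 (s+s) (by omega)
  refine ⟨n0+n2+1, fun V _ hV H hH e e' he he' hinj => ?_⟩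
  have hne : Nonempty V := (Nat.card_pos_iff.1 (by omega : 0 < Nat.card V)).1
  have hei : Function.Injective e := hH.inj _ (he.H (by omega))
  have hei' : Function.Injective e' := hH.inj _ (he'.H (by omega))
  have b1 := hn0 V (by omega) H hH (d+r) le_rfl e hei
  have b2 := hn0 V (by omega) H hH (d+r) le_rfl e' hei'
  rw [← pr_marg (V := V) (finAddFlip (m := s) (n := s)) (Equiv.injective _)] at b2
  have b3 := hn2 V (by omega) H hH _ le_rfl (Fin.append e e') hinj
  have b3' : (1:ℝ) / ((s+s:ℕ):ℝ)^(2*(d+r+1)+3) ≤ 1 / (s:ℝ)^(2*(d+r+1)+3) := by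
    gcongr; push_cast; linarith
  have a1 := pr_indep (V := V) (fun R : Fin s → V => T (pull H (Sum.elim e R)) Sum.inl)
    (fun R : Fin s → V => T (pull H (Sum.elim e' R)) Sum.inl)
  have a2 : (1 / (s:ℝ)^(d+r+1)) * (1 / (s:ℝ)^(d+r+1)) ≤ _ := mul_le_mul he he' (by positivity) (pr_nonneg _)
  rw [← a1] at a2
  have c3 := pr_sub (fun z : Fin (s+s) → V => T (pull H (Sum.elim e (z ∘ Fin.castAdd s))) Sum.inl ∧
      T (pull H (Sum.elim e' (z ∘ Fin.natAdd s))) Sum.inl)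
    (fun z : Fin (s+s) → V => (∃ i, ∃ h : i ≤ s+s, s ≤ i ∧ ¬ Typ d r δ (pull H (Sum.elim e (z ∘ Fin.castLE h)))) ∨
      (∃ i, ∃ h : i ≤ s+s, s ≤ i ∧ ¬ Typ d r δ (pull H (Sum.elim e' ((z ∘ finAddFlip) ∘ Fin.castLE h)))) ∨
      ¬ Typ d r δ (pull H (Sum.elim (Fin.append e e') z)))
  have c4 := pr_or (fun z : Fin (s+s) → V => (∃ i, ∃ h : i ≤ s+s, s ≤ i ∧ ¬ Typ d r δ (pull H (Sum.elim e (z ∘ Fin.castLE h)))))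
      (fun z => (∃ i, ∃ h : i ≤ s+s, s ≤ i ∧ ¬ Typ d r δ (pull H (Sum.elim e' ((z ∘ finAddFlip) ∘ Fin.castLE h)))) ∨
      ¬ Typ d r δ (pull H (Sum.elim (Fin.append e e') z)))
  have c5 := pr_or (fun z : Fin (s+s) → V => (∃ i, ∃ h : i ≤ s+s, s ≤ i ∧ ¬ Typ d r δ (pull H (Sum.elim e' ((z ∘ finAddFlip) ∘ Fin.castLE h)))))
      (fun z => ¬ Typ d r δ (pull H (Sum.elim (Fin.append e e') z)))
  have num : 1 / (2 * ((s:ℝ)^(d+r+1))^2) ≤ (1 / (s:ℝ)^(d+r+1)) * (1 / (s:ℝ)^(d+r+1)) - 3 * (1 / (s:ℝ)^(2*(d+r+1)+3)) := by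
    have e1 : (1:ℝ) / (s:ℝ)^(2*(d+r+1)+3) ≤ 1 / (8 * ((s:ℝ)^(d+r+1))^2) := by
      apply one_div_le_one_div_of_le (by positivity)
      rw [pow_add _ (2*(d+r+1)) 3, mul_comm 2 (d+r+1), pow_mul, mul_comm]
      gcongr
      calc (8:ℝ) = 2^3 := by norm_num
        _ ≤ _ := by gcongr
    have e2 : (1 / (s:ℝ)^(d+r+1)) * (1 / (s:ℝ)^(d+r+1)) = 8 * (1 / (8 * ((s:ℝ)^(d+r+1))^2)) := by field_simp
    have e3 : 1 / (2 * ((s:ℝ)^(d+r+1))^2) = 4 * (1 / (8 * ((s:ℝ)^(d+r+1))^2)) := by field_simp; norm_num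
    have : 0 ≤ 1 / (8 * ((s:ℝ)^(d+r+1))^2) := by positivity
    linarith
  refine num.trans (le_trans (by linarith) (c3.trans (pr_mono ?_)))
  rintro z ⟨⟨hz1, hz2⟩, hz3⟩
  push Not at hz3
  obtain ⟨hz3, hz4, hz5⟩ := hz3
  have t1 := grow hp hsz e Sum.inl (s+s) (by omega) z (fun i h hi => hz3 i h hi) hz1
  have t2 := grow hp hsz e' Sum.inl (s+s) (by omega) (z ∘ finAddFlip) (fun i h hi => hz4 i h hi) (by
    have : (z ∘ finAddFlip) ∘ Fin.castLE (by omega : s ≤ s+s) = z ∘ Fin.natAdd s := by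
      ext i; simp only [Function.comp]; congr 1; rw [← finAddFlip_apply_castAdd]; rfl
    rw [this]; exact hz2)
  have u : ∀ (y : Fin (d+r) → V) (z' : Fin (s+s) → V) (j : Fin (d+r) → Fin (d+r+(d+r))) (j' : Fin (s+s) → Fin (s+s)),
      Function.Injective j → Function.Injective j' → Fin.append e e' ∘ j = y → z ∘ j' = z' →
      Typ d r δ (pull H (Sum.elim y z')) → T (pull H (Sum.elim y z')) (Sum.inl : Fin (d+r) → _) → T (pull H (Sum.elim (Fin.append e e') z)) (Sum.inl ∘ j) := by
    intro y z' j j' hj hj' hy hz' ht hT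
    have hpl : pull (pull H (Sum.elim (Fin.append e e') z)) (Sum.map j j') = pull H (Sum.elim y z') := by
      unfold pull; ext x; congr! 1; ext i; simp only [Function.comp]
      rw [← hy, ← hz']; rcases x i with a|a <;> rfl
    refine T_up hp (P := pull H (Sum.elim (Fin.append e e') z)) (Sum.map j j') (hj.sumMap hj') hz5 (by rw [hpl]; exact ht) 
      (hsz.big hν (by simp; omega)) ?_ (x := Sum.inl) (by rw [hpl]; exact hT)
    simp only [Fintype.card_sum, Fintype.card_fin]; push_cast
    have h3 := hsz.2.2
    push_cast at h3 hk
    have : 0 ≤ ν * d := by positivity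
    have : 0 ≤ ν * r := by positivity
    have : 0 ≤ ν * s := by positivity
    nlinarith
  intro σ
  have v1 := u e z (Fin.castAdd (d+r)) id (Fin.castAdd_injective _ _) Function.injective_id (by ext; simp) rfl (hz3 (s+s) le_rfl (by omega)) t1
  have v2 := u e' (z ∘ finAddFlip) (Fin.natAdd (d+r)) finAddFlip (Fin.natAdd_injective _ _) (Equiv.injective _) (by ext i; exact Fin.append_right _ _ i) rfl (hz4 (s+s) le_rfl (by omega)) t2
  haveI : Nonempty (Fin (d+r+(d+r))) := ⟨⟨0, by have := hp.hd; omega⟩⟩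
  exact (T_perm (P := pull H (Sum.elim (Fin.append e e') z)) (fun x σ hx => hH.sym _ σ hx) σ v1).con v2

lemma FracG (d r : ℕ) (δ ν ξ : ℝ) (hp : Par d r δ ν) (hξ : 0 < ξ) (ε : ℝ) (hε : 0 < ε) :
    ∃ s0 : ℕ, ∀ s ≥ s0, ∃ n0 : ℕ, ∀ (V : Type) [Finite V], n0 ≤ Nat.card V →
      ∀ H : (Fin (d+r) → V) → Prop, Host d r (δ + ξ) H →
      pr (fun R : Fin (d+r+s) → V => ¬ (Typ d r δ (pull H R) ∧ ∀ x, T (pull H R) x → G H s (R ∘ x))) ≤ ε := by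
  obtain ⟨s2, hs2⟩ := typ_sample d r 0 1 δ ξ hp.hr hξ
  obtain ⟨a, ha⟩ := exists_nat_gt ((2^(d+r)+1)/ε)
  refine ⟨s2+a+(d+r)+1, fun s hs => ?_⟩
  obtain ⟨n2, hn2⟩ := hs2 (d+r+s) (by omega)
  refine ⟨n2+1, fun V _ hV H hH => ?_⟩
  have hne : Nonempty V := (Nat.card_pos_iff.1 (by omega : 0 < Nat.card V)).1
  have b1 := hn2 V (by omega) H hH 0 le_rfl Fin.elim0 (fun i => i.elim0)
  have hs0 : (0:ℝ) < s := by exact_mod_cast (by omega : 0 < s)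
  have b2 : ∀ x : Fin (d+r) → Fin (d+r+s), pr (fun R : Fin (d+r+s) → V => T (pull H R) x ∧ ¬ G H s (R ∘ x)) ≤ 1 / (s:ℝ)^(d+r+1) := by
    intro x
    by_cases hx : Function.Injective x
    · exact G_fail (by omega) x hx
    · refine (pr_mono (q := fun _ => False) fun R hR => hx (Function.Injective.of_comp (hH.inj _ hR.1.1))).trans ?_
      simp only [pr, ind, if_false, ex, finsum_zero, zero_div]; positivity
  have b3 := pr_exists_le (fun (x : Fin (d+r) → Fin (d+r+s)) (R : Fin (d+r+s) → V) => T (pull H R) x ∧ ¬ G H s (R ∘ x)) _ b2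
  have b4 := pr_or (fun R : Fin (d+r+s) → V => ¬ Typ d r δ (pull H (Sum.elim (Fin.elim0 : Fin 0 → V) R))) (fun R => ∃ x, T (pull H R) x ∧ ¬ G H s (R ∘ x))
  refine le_trans (pr_mono ?_) (b4.trans (le_trans (add_le_add b1 b3) ?_))
  · intro R hR
    by_contra! hc
    refine hR ⟨?_, hc.2⟩
    refine Typ_equiv (Equiv.emptySum (Fin 0) _) ?_
    convert hc.1 using 1
    unfold pull; ext u; congr! 1; ext i; simp only [Function.comp]; rcases u i with a|a
    · exact a.elim0
    · rfl
  · rw [Nat.card_fun, Nat.card_fin, Nat.card_fin]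
    have hk : ((d+r+s:ℕ):ℝ) ≤ 2 * s := by exact_mod_cast (by omega : d+r+s ≤ 2*s)
    have hk' : (s:ℝ) ≤ ((d+r+s:ℕ):ℝ) := by exact_mod_cast (by omega : s ≤ d+r+s)
    have e1 : (((d+r+s)^(d+r):ℕ):ℝ) * (1 / (s:ℝ)^(d+r+1)) ≤ 2^(d+r) / s := by
      push_cast at hk ⊢
      calc ((d:ℝ)+r+s)^(d+r) * (1 / (s:ℝ)^(d+r+1)) ≤ (2*s)^(d+r) * (1 / (s:ℝ)^(d+r+1)) := by gcongr
        _ = _ := by rw [mul_pow, pow_succ]; field_simp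
    have e2 : 1 / ((d+r+s:ℕ):ℝ)^1 ≤ 1 / s := by rw [pow_one]; gcongr
    have e3 : (a:ℝ) ≤ s := by exact_mod_cast (by omega : a ≤ s)
    have e4 : (2^(d+r)+1) / (s:ℝ) ≤ ε := by
      rw [div_le_iff₀ hs0]; rw [div_lt_iff₀ hε] at ha; nlinarith
    have : (2^(d+r)+1) / (s:ℝ) = 1 / s + 2^(d+r)/s := by ring
    linarith

lemma FracG_pfm {V : Type} {d r s : ℕ} {δ ν : ℝ} (hp : Par d r δ ν) (hs : Sz d r ν s) {H : (Fin (d+r) → V) → Prop}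
    (hinj : ∀ x, H x → Function.Injective x) {R : Fin (d+r+s) → V} (h1 : Typ d r δ (pull H R)) (h2 : ∀ x, T (pull H R) x → G H s (R ∘ x)) :
    PFM (fun x => G H s (R ∘ x)) :=
  (pfm_of_typ hp (fun x hx => Function.Injective.of_comp (hinj _ hx)) h1 (hs.big hp.hν (by simp))).mono h2
end
end TH

open Finset
set_option linter.all false
namespace TH
open scoped Classical
noncomputable section

lemma Host_restrict {V W : Type} [Finite V] [Nonempty V] [Finite W] {d r : ℕ} {δ η : ℝ} {H : (Fin (d+r) → V) → Prop} (hH : Host d r δ H)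
    (j : W → V) (hj : Function.Injective j) (hη : r * (((Nat.card V:ℝ) - Nat.card W) / Nat.card V) ≤ η) : Host d r (δ - η) (pull H j) := by
  refine ⟨fun x σ h => hH.sym _ σ h, fun x h => Function.Injective.of_comp (hH.inj _ h), fun S hS => ?_⟩
  have h1 := hH.deg (j ∘ S) (hj.comp hS)
  have h2 := pr_restrict j hj r (fun B => H (Fin.append (j ∘ S) B))
  have h3 : ∀ B : Fin r → W, pull H j (Fin.append S B) = H (Fin.append (j ∘ S) (j ∘ B)) := fun B => by
    unfold pull; rw [append_comp]
  simp only [h3]; linarith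

lemma G_restrict {V W : Type} [Finite V] [Nonempty V] [Finite W] {q : ℕ} {H : (Fin q → V) → Prop} {s : ℕ}
    (j : W → V) (hj : Function.Injective j) (hη : s * (((Nat.card V:ℝ) - Nat.card W) / Nat.card V) ≤ 1 / (2 * (s:ℝ)^(q+1)))
    {e : Fin q → W} (he : G H s (j ∘ e)) :
    1 / (2 * (s:ℝ)^(q+1)) ≤ pr (fun R : Fin s → W => T (pull (pull H j) (Sum.elim e R)) Sum.inl) := by
  have h2 := pr_restrict j hj s (fun R => T (pull H (Sum.elim (j ∘ e) R)) Sum.inl)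
  have h3 : ∀ R : Fin s → W, pull (pull H j) (Sum.elim e R) = pull H (Sum.elim (j ∘ e) (j ∘ R)) := fun R => by
    unfold pull; ext x; congr! 1; ext i; simp only [Function.comp]; rcases x i with a|a <;> rfl
  simp only [h3]
  unfold G at he
  have e3 : 1 / (s:ℝ)^(q+1) = 1 / (2 * (s:ℝ)^(q+1)) + 1 / (2 * (s:ℝ)^(q+1)) := by rw [← add_div]; ring_nf
  linarith

lemma ex_pow {α : Type} [Finite α] [Nonempty α] {f : α → ℝ} (h0 : ∀ x, 0 ≤ f x) (p : ℕ) : (ex f)^p ≤ ex fun x => f x ^ p := by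
  cases nonempty_fintype α
  have h := Real.pow_arith_mean_le_arith_mean_pow univ (fun _ : α => 1 / (Fintype.card α:ℝ)) f (fun _ _ => by positivity)
    (by simp) (fun x _ => h0 x) p
  rw [ex_eq, ex_eq]
  convert h using 1
  · rw [← Finset.mul_sum]; congr 1; ring
  · rw [← Finset.mul_sum]; ring

lemma pr_pow {α : Type} [Finite α] [Nonempty α] (p : α → Prop) (N : ℕ) : pr (fun A : Fin N → α => ∀ c, p (A c)) = (pr p)^N := by
  unfold pr; rw [← ex_prod_pi]
  congr 1; ext A
  by_cases h : ∀ c, p (A c)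
  · simp [ind, h]
  · rw [ind_false h]; push Not at h; obtain ⟨c, hc⟩ := h
    exact (Finset.prod_eq_zero (mem_univ c) (ind_false hc)).symm

lemma ex_cons {V : Type} [Finite V] {m : ℕ} (f : (Fin (m+1) → V) → ℝ) :
    ex f = ex fun a => ex fun x : Fin m → V => f (Fin.cons a x) := by
  rw [← ex_equiv (Fin.consEquiv (fun _ => V)) f, ex_prod]; rfl

lemma blow0 {V : Type} [Finite V] [Nonempty V] (N : ℕ) : ∀ (m : ℕ) (Q : (Fin m → V) → Prop) ,
    (pr Q)^(N^m) ≤ pr (fun X : Fin m → Fin N → V => ∀ f : Fin m → Fin N, Q (fun i => X i (f i)))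
  | 0, Q => by
    simp only [pow_zero, pow_one]
    by_cases h : Q Fin.elim0
    · refine (pr_le_one _).trans (le_of_eq (pr_true fun X f => ?_).symm); convert h
    · refine le_trans (pr_mono (q := fun _ => False) fun x hx => h (by convert hx)) ?_
      simp only [pr, ind, if_false, ex, finsum_zero, zero_div]; exact pr_nonneg (fun X : Fin 0 → Fin N → V => ∀ f : Fin 0 → Fin N, Q (fun i => X i (f i)))
  | m+1, Q => by
    have ih := fun A : Fin N → V => blow0 N m (fun x => ∀ c, Q (Fin.cons (A c) x))
    have h1 : pr (fun X : Fin (m+1) → Fin N → V => ∀ f : Fin (m+1) → Fin N, Q (fun i => X i (f i))) =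
        ex fun A : Fin N → V => pr (fun X : Fin m → Fin N → V => ∀ f : Fin m → Fin N, ∀ c, Q (Fin.cons (A c) (fun i => X i (f i)))) := by
      unfold pr; rw [ex_cons]; congr! 5 with A X
      show (∀ f : Fin (m+1) → Fin N, _) ↔ ∀ (f : Fin m → Fin N) (c : Fin N), _
      rw [Fin.forall_fin_succ_pi, forall_comm]
      congr! 3 with f c
      ext i; refine Fin.cases ?_ (fun i => ?_) i <;> simp
    rw [h1]
    refine le_trans ?_ (ex_mono ih)
    refine le_trans ?_ (ex_pow (fun _ => pr_nonneg _) _)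
    rw [pow_succ, mul_comm, pow_mul]
    refine pow_le_pow_left₀ (pow_nonneg (pr_nonneg _) _) ?_ _
    have h2 : (ex fun A : Fin N → V => pr (fun x : Fin m → V => ∀ c, Q (Fin.cons (A c) x))) =
        ex fun x : Fin m → V => (pr fun a => Q (Fin.cons a x))^N := by
      unfold pr; rw [ex_comm]; congr 1; ext x
      exact pr_pow (fun a => Q (Fin.cons a x)) N
    rw [h2]
    refine le_trans ?_ (ex_pow (fun _ => pr_nonneg _) _)
    unfold pr; rw [ex_cons, ex_comm]

lemma blow {V κ β : Type} [Finite V] [Nonempty V] [Finite κ] [Finite β] {Q : (κ → V) → Prop} {ρ : ℝ} (hρ : 0 ≤ ρ) (h : ρ ≤ pr Q) :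
    ρ^((Nat.card β)^(Nat.card κ)) ≤ pr (fun X : κ × β → V => ∀ f : κ → β, Q (fun i => X (i, f i))) := by
  have e1 : κ ≃ Fin (Nat.card κ) := Finite.equivFin κ
  have e2 : β ≃ Fin (Nat.card β) := Finite.equivFin β
  have h1 := blow0 (V := V) (Nat.card β) (Nat.card κ) (fun x => Q (x ∘ e1))
  rw [show (pr fun x : Fin (Nat.card κ) → V => Q (x ∘ e1)) = pr Q from pr_equiv (Equiv.arrowCongr e1.symm (Equiv.refl V)) Q] at h1
  refine (pow_le_pow_left₀ hρ h _).trans (h1.trans (le_of_eq ?_))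
  let E : (κ × β → V) ≃ (Fin (Nat.card κ) → Fin (Nat.card β) → V) :=
    (Equiv.curry κ β V).trans (Equiv.arrowCongr e1 (Equiv.arrowCongr e2 (Equiv.refl V)))
  rw [← pr_equiv E]
  congr 1; ext X
  constructor
  · intro hX f
    convert hX (fun i => e2 (f (e1.symm i))) using 1
    ext i; simp [E]
  · intro hX f
    convert hX (fun i => e2.symm (f (e1 i))) using 1
    ext i; simp [E]

/-- base absorber density -/
lemma abs_base (d r : ℕ) (δ ν ξ : ℝ) (hp : Par d r δ ν) (hξ : 0 < ξ) (z0 : Fin (d+r)) (hz0 : z0 = Fin.castAdd r ⟨0, hp.hd⟩) :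
    ∃ s0 : ℕ, ∀ s ≥ s0, ∃ n0 : ℕ, ∀ (V : Type) [Finite V], n0 ≤ Nat.card V →
      ∀ H : (Fin (d+r) → V) → Prop, Host d r (δ + ξ) H → ∀ v : Fin (d+r) → V,
      1/2 ≤ pr (fun R : Fin (d+r+s) → V => ∃ p : (Fin (d+r) → Fin (d+r+s)) × (Fin (d+r) → Fin (d+r) → Fin (d+r+s)),
        G H s (R ∘ p.1) ∧ ∀ i, G H s (R ∘ p.2 i) ∧ p.2 i z0 = p.1 i ∧ H (Function.update (R ∘ p.2 i) z0 (v i))) := by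
  obtain ⟨s0, hs0⟩ := FracG d r δ ν ξ hp hξ (1/4) (by norm_num)
  obtain ⟨s1, hs1⟩ := Sz_ev d r hp.hν
  obtain ⟨s2, hs2⟩ := typ_sample d r 1 1 δ ξ hp.hr hξ
  obtain ⟨s3, hs3⟩ := exists_nat_gt ((r:ℝ) / (2 * ν))
  refine ⟨s0+s1+s2+s3+4*(d+r)+1, fun s hs => ?_⟩
  obtain ⟨n0, hn0⟩ := hs0 s (by omega)
  obtain ⟨n2, hn2⟩ := hs2 (d+r+s) (by omega)
  refine ⟨n0+n2+1, fun V _ hV H hH v => ?_⟩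
  have hne : Nonempty V := (Nat.card_pos_iff.1 (by omega : 0 < Nat.card V)).1
  have hsz := hs1 s (by omega)
  have hν := hp.hν
  have a1 := hn0 V (by omega) H hH
  have a2 := pr_exists_le (fun (i : Fin (d+r)) (R : Fin (d+r+s) → V) => ¬ Typ d r δ (pull H (Sum.elim (fun _ : Fin 1 => v i) R))) _
    (fun i => hn2 V (by omega) H hH 1 le_rfl (fun _ => v i) (fun a b _ => Subsingleton.elim _ _))
  have a3 : (Nat.card (Fin (d+r)):ℝ) * (1 / ((d+r+s:ℕ):ℝ)^1) ≤ 1/4 := by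
    rw [Nat.card_fin, pow_one, mul_one_div, div_le_iff₀ (by exact_mod_cast (by omega : 0 < d+r+s))]
    have : ((4*(d+r):ℕ):ℝ) ≤ ((d+r+s:ℕ):ℝ) := by exact_mod_cast (by omega)
    push_cast at this ⊢; linarith
  have a4 := pr_or (fun R : Fin (d+r+s) → V => ¬ (Typ d r δ (pull H R) ∧ ∀ x, T (pull H R) x → G H s (R ∘ x)))
    (fun R => ∃ i, ¬ Typ d r δ (pull H (Sum.elim (fun _ : Fin 1 => v i) R)))
  have a5 := pr_not (fun R : Fin (d+r+s) → V => ¬ (Typ d r δ (pull H R) ∧ ∀ x, T (pull H R) x → G H s (R ∘ x)) ∨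
    (∃ i, ¬ Typ d r δ (pull H (Sum.elim (fun _ : Fin 1 => v i) R))))
  refine le_trans (by linarith) (a5.symm.le.trans (pr_mono ?_))
  intro R hR
  push Not at hR
  obtain ⟨⟨hR1, hR2⟩, hR3⟩ := hR
  have hbig : Big d ν (Fintype.card (Fin (d+r+s))) := hsz.big hν (by simp)
  obtain ⟨st1, st2⟩ := struct hp.hr hp.hδ hν hp.hpow hR1 hbig.1 hbig.2
  obtain ⟨e, he⟩ := exists_of_pr (lt_of_lt_of_le (by linarith) st2)
  have key : ∀ i, ∃ f : Fin (d+r) → Fin (d+r+s), G H s (R ∘ f) ∧ f z0 = e i ∧ H (Function.update (R ∘ f) z0 (v i)) := by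
    intro i
    obtain ⟨S, hS, hS0⟩ : ∃ S : Fin d → Fin (d+r+s), Function.Injective S ∧ S ⟨0, hp.hd⟩ = e i := by
      let S0 : Fin d → Fin (d+r+s) := fun t => ⟨t, by omega⟩
      refine ⟨Equiv.swap (S0 ⟨0, hp.hd⟩) (e i) ∘ S0, (Equiv.injective _).comp (fun a b h => by simpa [S0, Fin.ext_iff] using h), by simp⟩
    obtain ⟨C, M, -, hC, hCpr, -, -⟩ := st1 S hS
    have hl := hR3 i (Function.update (Sum.inr ∘ S) ⟨0, hp.hd⟩ (Sum.inl 0)) (by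
      intro a b hab
      by_cases ha : a = ⟨0, hp.hd⟩ <;> by_cases hb : b = ⟨0, hp.hd⟩
      · rw [ha, hb]
      · subst ha; rw [Function.update_self, Function.update_of_ne hb] at hab; cases hab
      · subst hb; rw [Function.update_self, Function.update_of_ne ha] at hab; cases hab
      · rw [Function.update_of_ne hb, Function.update_of_ne ha] at hab; exact hS (Sum.inr_injective hab))
    have hl2 := pr_restrict (Sum.inr : Fin (d+r+s) → Fin 1 ⊕ Fin (d+r+s)) Sum.inr_injective r (fun B => pull H (Sum.elim (fun _ : Fin 1 => v i) R) (Fin.append (Function.update (Sum.inr ∘ S) ⟨0, hp.hd⟩ (Sum.inl 0)) B))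
    have hsmall : (r:ℝ) * ((((Nat.card (Fin 1 ⊕ Fin (d+r+s)):ℕ):ℝ) - (Nat.card (Fin (d+r+s)):ℕ)) / (Nat.card (Fin 1 ⊕ Fin (d+r+s)):ℕ)) < 2 * ν := by
      rw [Nat.card_sum, Nat.card_fin, Nat.card_fin]
      have : (s3:ℝ) ≤ s := by exact_mod_cast (by omega : s3 ≤ s)
      rw [div_lt_iff₀ (by linarith)] at hs3
      push_cast
      rw [← mul_div_assoc, div_lt_iff₀ (by positivity)]
      have : 0 ≤ ν * (d + r) := by positivity
      nlinarith
    haveI : Nonempty (Fin (d+r+s)) := ⟨e z0⟩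
    obtain ⟨B, hB1, hB2⟩ := exists_and_of_pr (p := fun B => B ∈ C) (q := fun x : Fin r → Fin (d+r+s) => pull H (Sum.elim (fun _ : Fin 1 => v i) R) (Fin.append (Function.update (Sum.inr ∘ S) ⟨0, hp.hd⟩ (Sum.inl 0)) (Sum.inr ∘ x))) (by
      have := hp.hδ1; linarith)
    refine ⟨Fin.append S B, hR2 _ (hC B hB1), by rw [hz0, Fin.append_left, hS0], ?_⟩
    unfold pull at hB2
    rw [append_comp] at hB2
    convert hB2 using 1
    rw [append_comp, hz0]
    ext t
    refine Fin.addCases (fun t => ?_) (fun t => ?_) t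
    · by_cases ht : t = ⟨0, hp.hd⟩
      · subst ht; rw [Function.update_self, Fin.append_left]; simp
      · rw [Function.update_of_ne (fun h => ht (Fin.castAdd_injective _ _ h))]
        simp [Function.update_of_ne ht]
    · rw [Function.update_of_ne (by intro h; have := congrArg Fin.val h; simp at this; have := hp.hd; omega)]
      simp
  choose f hf using key
  exact ⟨(e, f), hR2 e he, hf⟩

/-- `A` (blocks for `k+1` segments) can absorb `v`. Clone index `c0` is the core. -/
def AGood {V : Type} {k N : ℕ} (H : (Fin k → V) → Prop) (s : ℕ) (z0 : Fin k) (c0 : Fin N) (v : Fin k → V)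
    (A : Fin (k+1) × Fin k × Fin N → V) : Prop :=
  (∀ i (f : Fin k → Fin N), G H s (fun j => A (i, j, f j))) ∧
  (∀ (i : Fin k) (f : Fin k → Fin N), H (Function.update (fun j => A (i.succ, j, f j)) z0 (v i))) ∧
  (∀ f : Fin k → Option (Fin N), G H s (fun j => (f j).elim (A (j.succ, z0, c0)) (fun c => A (0, j, c))))

lemma abs_dens (d r : ℕ) (δ ν ξ : ℝ) (hp : Par d r δ ν) (hξ : 0 < ξ) (z0 : Fin (d+r)) (hz0 : z0 = Fin.castAdd r ⟨0, hp.hd⟩) :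
    ∃ s0 : ℕ, ∀ s ≥ s0, ∀ N (c0 : Fin N), ∃ c > (0:ℝ), ∃ n0 : ℕ, ∀ (V : Type) [Finite V], n0 ≤ Nat.card V →
      ∀ H : (Fin (d+r) → V) → Prop, Host d r (δ + ξ) H → ∀ v : Fin (d+r) → V,
      c ≤ pr (AGood H s z0 c0 v) := by
  obtain ⟨s0, hs0⟩ := abs_base d r δ ν ξ hp hξ z0 hz0
  refine ⟨s0 + 1, fun s hs N c0 => ?_⟩
  obtain ⟨n0, hn0⟩ := hs0 s (by omega)
  set PL := (Fin (d+r) → Fin (d+r+s)) × (Fin (d+r) → Fin (d+r) → Fin (d+r+s)) with hPL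
  have hPLne : Nonempty PL := ⟨(fun _ => ⟨0, by omega⟩, fun _ _ => ⟨0, by omega⟩)⟩
  have hPLpos : 0 < Nat.card PL := Nat.card_pos
  set β := Fin (d+r+1) × Fin (d+r) × Fin N with hβ
  refine ⟨((1/2) / Nat.card PL)^((Nat.card β)^(Nat.card (Fin (d+r+s)))), by positivity, n0+1, fun V _ hV H hH v => ?_⟩
  have hne : Nonempty V := (Nat.card_pos_iff.1 (by omega : 0 < Nat.card V)).1
  obtain ⟨⟨e, f⟩, hpl⟩ := pr_pigeon _ (by norm_num) (hn0 V (by omega) H hH v)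
  have hpos : 0 < (1/2:ℝ) / Nat.card PL := by positivity
  obtain ⟨R, hR⟩ := exists_of_pr (hpos.trans_le hpl)
  simp only at hR
  have hei : Function.Injective e := Function.Injective.of_comp (hH.inj _ (hR.1.H (by omega)))
  have hfi : ∀ i, Function.Injective (f i) := fun i => Function.Injective.of_comp (hH.inj _ ((hR.2 i).1.H (by omega)))
  have hfz : ∀ i, f i z0 = e i := fun i => (hR.2 i).2.1
  have hb := blow (β := β) hpos.le hpl
  refine hb.trans ?_
  let p : Fin (d+r+1) → Fin (d+r) → Fin (d+r+s) := fun i j => Fin.cases (e j) (fun i => f i j) i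
  have hpi : ∀ i, Function.Injective (p i) := fun i => Fin.cases hei (fun i => hfi i) i
  let Ψ : β → Fin (d+r+s) × β := fun b => (p b.1 b.2.1, b)
  have hΨ : Function.Injective Ψ := fun a b h => (Prod.ext_iff.1 h).2
  rw [← pr_marg (V := V) Ψ hΨ (AGood H s z0 c0 v)]
  refine pr_mono fun X hX => ?_
  have ext : ∀ (q : Fin (d+r) → Fin (d+r+s)), Function.Injective q → ∀ g : Fin (d+r) → β, ∃ F : Fin (d+r+s) → β, ∀ j, F (q j) = g j := by
    intro q hq g
    exact ⟨Function.extend q g (fun _ => g z0), fun j => hq.extend_apply _ _ _⟩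
  refine ⟨fun i c => ?_, fun i c => ?_, fun c => ?_⟩
  · obtain ⟨F, hF⟩ := ext (p i) (hpi i) (fun j => (i, j, c j))
    have h := hX F
    have h2 : (fun j => (X ∘ Ψ) (i, j, c j)) = (fun i => X (i, F i)) ∘ p i := by
      ext j; simp [Ψ, hF]
    rw [h2]
    revert h; refine Fin.cases (fun h => h.1) (fun i h => (h.2 i).1) i
  · obtain ⟨F, hF⟩ := ext (f i) (hfi i) (fun j => (i.succ, j, c j))
    have h := ((hX F).2 i).2.2
    convert h using 2
    ext j; simp [Ψ, hF, p]
  · obtain ⟨F, hF⟩ := ext e hei (fun j => (c j).elim (j.succ, z0, c0) (fun c => (0, j, c)))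
    have h := (hX F).1
    convert h using 1
    ext j; simp only [Function.comp, hF, Ψ, p]
    cases c j <;> simp [hfz]
end
end TH

open Finset
set_option linter.all false
namespace TH
open scoped Classical
noncomputable section

/-- tight path (list form) -/
def TP {ι : Type} {k : ℕ} (P : (Fin k → ι) → Prop) (l : List ι) : Prop :=
  ∀ i x, (∀ t : Fin k, l[i + t.1]? = some (x t)) → P x

section
variable {ι : Type} {k : ℕ} {P : (Fin k → ι) → Prop}

def Sym (P : (Fin k → ι) → Prop) : Prop := ∀ (x : Fin k → ι) (σ : Equiv.Perm (Fin k)), P x → P (x ∘ σ)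

lemma TP_glue {a b c : List ι} (hc : k ≤ c.length) (h1 : TP P (a ++ c)) (h2 : TP P (c ++ b)) : TP P (a ++ c ++ b) := by
  intro i x hx
  by_cases h : i + k ≤ a.length + c.length
  · refine h1 i x fun t => ?_
    rw [← hx t, List.getElem?_append_left (l₁ := a ++ c) (by rw [List.length_append]; omega)]
  · refine h2 (i - a.length) x fun t => ?_
    rw [← hx t, List.append_assoc, List.getElem?_append_right (l₁ := a) (by omega)]
    congr 1; omega

lemma TP_infix {a b c : List ι} (h : TP P (a ++ b ++ c)) : TP P b := by
  intro i x hx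
  refine h (a.length + i) x fun t => ?_
  have hlt : i + t.1 < b.length := by
    by_contra hh; have := hx t; rw [List.getElem?_eq_none (by omega)] at this; cases this
  rw [List.append_assoc, List.getElem?_append_right (by omega), List.getElem?_append_left (by omega), ← hx t]
  congr 1; omega

lemma TP_per (hk : 0 < k) (hs : Sym P) (S : Fin k → Set ι) (hS : ∀ x, (∀ j, x j ∈ S j) → P x) {l : List ι}
    (h : ∀ n v, l[n]? = some v → v ∈ S ⟨n % k, Nat.mod_lt _ hk⟩) : TP P l := by
  intro i x hx
  let σ0 : Fin k → Fin k := fun t => ⟨(i + t.1) % k, Nat.mod_lt _ hk⟩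
  have hσ : Function.Injective σ0 := by
    intro a b hab
    have h1 : (i + a.1) % k = (i + b.1) % k := congrArg Fin.val hab
    have h2 : a.1 ≡ b.1 [MOD k] := Nat.ModEq.add_left_cancel' i h1
    exact Fin.ext (h2.eq_of_lt_of_lt a.2 b.2)
  let σ : Equiv.Perm (Fin k) := Equiv.ofBijective σ0 (Finite.injective_iff_bijective.1 hσ)
  have : x = (x ∘ σ.symm) ∘ σ := by ext; simp
  rw [this]
  refine hs _ _ (hS _ fun j => ?_)
  have h1 := h _ _ (hx (σ.symm j))
  have h2 : (⟨(i + (σ.symm j).1) % k, Nat.mod_lt _ hk⟩ : Fin k) = j := σ.apply_symm_apply j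
  rw [h2] at h1; exact h1

lemma get_ofFn (a : Fin k → ι) {n : ℕ} {v} (h : (List.ofFn a)[n]? = some v) : ∃ hn : n < k, v = a ⟨n, hn⟩ := by
  rw [List.getElem?_ofFn] at h
  split_ifs at h with hn
  exact ⟨hn, (Option.some.inj h).symm⟩

lemma TP_two (hk : 0 < k) (hs : Sym P) {a b : Fin k → ι} (ha : P a) (hb : P b) (h : ∃ j, ∀ i, i ≠ j → a i = b i) :
    TP P (List.ofFn a ++ List.ofFn b) := by
  obtain ⟨j0, hj⟩ := h
  refine TP_per hk hs (fun j => {a j, b j}) (fun x hx => ?_) ?_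
  · rcases hx j0 with h0 | h0
    · have : x = a := by
        ext j; rcases hx j with h | h; exact h
        by_cases hjj : j = j0
        · rw [hjj, h0]
        · rw [hj j hjj]; exact h
      rw [this]; exact ha
    · have : x = b := by
        ext j; rcases hx j with h | h
        · by_cases hjj : j = j0
          · rw [hjj]; exact h0
          · rw [← hj j hjj]; exact h
        · exact h
      rw [this]; exact hb
  · intro n v hv
    by_cases hn : n < k
    · rw [List.getElem?_append_left (by simpa using hn)] at hv
      obtain ⟨_, rfl⟩ := get_ofFn a hv
      left; congr; exact (Nat.mod_eq_of_lt hn).symm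
    · rw [List.getElem?_append_right (by simpa using hn), List.length_ofFn] at hv
      obtain ⟨h', rfl⟩ := get_ofFn b hv
      right; congr; rw [Nat.mod_eq_sub_mod (by omega), Nat.mod_eq_of_lt h']

lemma TP_walk (hk : 0 < k) (hs : Sym P) {a b : Fin k → ι} (ha : P a) (h : Con P a b) :
    ∃ u m m', TP P u ∧ u = List.ofFn a ++ m ∧ u = m' ++ List.ofFn b ∧ k ∣ u.length := by
  induction h with
  | refl =>
    refine ⟨List.ofFn a, [], [], TP_per hk hs (fun j => {a j}) (fun x hx => ?_) ?_, by simp, by simp, by simp⟩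
    · rwa [show x = a from funext hx]
    · intro n v hv
      obtain ⟨h', rfl⟩ := get_ofFn a hv
      show _ = _; congr; exact (Nat.mod_eq_of_lt h').symm
  | @tail b c hab hbc ih =>
    obtain ⟨u, m, m', h1, h2, h3, h4⟩ := ih
    refine ⟨u ++ List.ofFn c, m ++ List.ofFn c, m' ++ List.ofFn b, ?_, by rw [h2]; simp, by rw [h3], by simpa using h4⟩
    rw [h3]; rw [h3] at h1
    exact TP_glue (by simp) h1 (TP_two hk hs hbc.1 hbc.2.1 hbc.2.2)

lemma TP_walk' (hk : 0 < k) (hs : Sym P) {a b : Fin k → ι} (ha : P a) (h : ∀ σ : Equiv.Perm (Fin k), Con P (a ∘ σ) b) (j : ℕ) (hj : j < k) :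
    ∃ u, TP P u ∧ k ≤ u.length ∧ (∀ t : Fin k, u[t.1]? = some (a t)) ∧ (∀ t : Fin k, u[u.length - k + t.1]? = some (b t)) ∧ u.length % k = j := by
  let σ0 : Fin k → Fin k := fun t => ⟨(j + t.1) % k, Nat.mod_lt _ hk⟩
  have hσ : Function.Injective σ0 := by
    intro a b hab
    have h1 : (j + a.1) % k = (j + b.1) % k := congrArg Fin.val hab
    have h2 : a.1 ≡ b.1 [MOD k] := Nat.ModEq.add_left_cancel' j h1
    exact Fin.ext (h2.eq_of_lt_of_lt a.2 b.2)
  let σ : Equiv.Perm (Fin k) := Equiv.ofBijective σ0 (Finite.injective_iff_bijective.1 hσ)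
  obtain ⟨u, m, m', h1, h2, h3, h4⟩ := TP_walk hk hs (hs _ σ ha) (h σ)
  have hp : ∀ n v, ((List.ofFn a).take j ++ List.ofFn (a ∘ σ))[n]? = some v → v = a ⟨n % k, Nat.mod_lt _ hk⟩ := by
    intro n v hv
    by_cases hn : n < j
    · rw [List.getElem?_append_left (by simp; omega), List.getElem?_take_of_lt hn] at hv
      obtain ⟨_, rfl⟩ := get_ofFn a hv
      congr; exact (Nat.mod_eq_of_lt (by omega)).symm
    · rw [List.getElem?_append_right (by simp; omega)] at hv
      obtain ⟨h', rfl⟩ := get_ofFn _ hv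
      show a _ = _
      congr 1; apply Fin.ext
      show (j + _) % k = n % k
      simp only [List.length_take, List.length_ofFn, min_eq_left hj.le]
      congr 1; omega
  have hlen : ((List.ofFn a).take j).length = j := by simp; omega
  have hulen : k ≤ u.length := by rw [h2]; simp
  refine ⟨(List.ofFn a).take j ++ u, ?_, ?_, ?_, ?_, ?_⟩
  · have h5 : TP P ((List.ofFn a).take j ++ List.ofFn (a ∘ σ)) :=
      TP_per hk hs (fun j => {a j}) (fun x hx => by rwa [show x = a from funext hx]) (fun n v hv => hp n v hv)
    rw [h2, ← List.append_assoc]; rw [h2] at h1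
    exact TP_glue (by simp) h5 h1
  · rw [List.length_append]; omega
  · intro t
    have hlt : t.1 < ((List.ofFn a).take j ++ List.ofFn (a ∘ σ)).length := by rw [List.length_append, hlen]; simp; omega
    rw [h2, ← List.append_assoc, List.getElem?_append_left hlt, List.getElem?_eq_getElem hlt]
    have := hp t.1 _ (List.getElem?_eq_getElem hlt)
    rw [this]; congr; exact Nat.mod_eq_of_lt t.2
  · intro t
    have hm : u.length = m'.length + k := by rw [h3]; simp
    rw [List.length_append, hlen, List.getElem?_append_right (by rw [hlen]; omega), h3, List.getElem?_append_right (by rw [hlen]; simp; omega)]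
    rw [List.getElem?_ofFn]
    have : j + (m' ++ List.ofFn b).length - k + t.1 - ((List.ofFn a).take j).length - m'.length = t.1 := by rw [hlen]; simp; omega
    simp only [this]; simp
  · rw [List.length_append, hlen, Nat.add_mod, Nat.mod_eq_zero_of_dvd h4]; simp [Nat.mod_eq_of_lt hj]

lemma row_prefix {l : List ι} {a : Fin k → ι} (h : ∀ t : Fin k, l[t.1]? = some (a t)) : ∃ m, l = List.ofFn a ++ m := by
  refine ⟨l.drop k, ?_⟩
  conv_lhs => rw [← List.take_append_drop k l]
  congr 1
  apply List.ext_getElem?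
  intro n
  by_cases hn : n < k
  · rw [List.getElem?_take_of_lt hn, h ⟨n, hn⟩, List.getElem?_ofFn, dif_pos hn]
  · rw [List.getElem?_eq_none (by simp; omega), List.getElem?_eq_none (by simp; omega)]

lemma row_suffix {l : List ι} {a : Fin k → ι} (hk : k ≤ l.length) (h : ∀ t : Fin k, l[l.length - k + t.1]? = some (a t)) : ∃ m, l = m ++ List.ofFn a := by
  refine ⟨l.take (l.length - k), ?_⟩
  conv_lhs => rw [← List.take_append_drop (l.length - k) l]
  congr 1
  apply List.ext_getElem?
  intro n
  rw [List.getElem?_drop]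
  by_cases hn : n < k
  · rw [h ⟨n, hn⟩, List.getElem?_ofFn, dif_pos hn]
  · rw [List.getElem?_eq_none (by omega), List.getElem?_eq_none (by simp; omega)]
end

/-- lifting a word to clones -/
lemma TP_clone {ι V : Type} {k N : ℕ} {P : (Fin k → ι) → Prop} {H : (Fin k → V) → Prop} (W : ι → ℕ → V)
    (hW : ∀ x, P x → ∀ c : Fin k → ℕ, (∀ j, c j < N) → H (fun j => W (x j) (c j)))
    (hinj : ∀ p q m n, m < N → n < N → W p m = W q n → m = n) {u : List ι} (hu : TP P u) (hN : u.length ≤ N) :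
    TP H (u.mapIdx fun n p => W p n) ∧ (u.mapIdx fun n p => W p n).Nodup := by
  constructor
  · intro i x hx
    have h1 : ∀ t : Fin k, ∃ y, u[i + t.1]? = some y ∧ W y (i + t.1) = x t := by
      intro t; have := hx t; rw [List.getElem?_mapIdx, Option.map_eq_some_iff] at this; exact this
    choose y hy using h1
    have := hW y (hu i y fun t => (hy t).1) (fun t => i + t.1) (fun t => by
      have : i + t.1 < u.length := by
        by_contra hh; have := (hy t).1; rw [List.getElem?_eq_none (by omega)] at this; cases this
      omega)
    convert this using 1
    ext t; exact (hy t).2.symm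
  · rw [List.nodup_iff_injective_get]
    intro a b hab
    have ha : a.1 < u.length := by simpa using a.2
    have hb : b.1 < u.length := by simpa using b.2
    simp only [List.get_eq_getElem, List.getElem_mapIdx] at hab
    exact Fin.ext (hinj _ _ _ _ (by omega) (by omega) hab)
end
end TH

open Finset
set_option linter.all false
namespace TH
open scoped Classical
noncomputable section

lemma pr_mem_le {V : Type} [Finite V] (Z : Finset V) : pr (fun v => v ∈ Z) ≤ Z.card / Nat.card V := by
  cases nonempty_fintype V
  rw [pr_card, Nat.card_eq_fintype_card]
  exact div_le_div_of_nonneg_right (by exact_mod_cast Finset.card_le_card (by intro x; simp)) (by positivity)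

lemma pr_arrow_fst {ι A V : Type} [Finite ι] [Finite A] [Finite V] [Nonempty A] [Nonempty V] (p : (ι → A) → Prop) :
    pr (fun y : ι → A × V => p (fun i => (y i).1)) = pr p := by
  rw [← pr_equiv (Equiv.arrowProdEquivProdArrow ι (fun _ => A) (fun _ => V)).symm, pr_prod]
  unfold pr
  congr 1; ext a; exact ex_const (α := ι → V) (ind (p a))

lemma pr_arrow_snd {ι A V : Type} [Finite ι] [Finite A] [Finite V] [Nonempty A] [Nonempty V] (p : (ι → V) → Prop) :
    pr (fun y : ι → A × V => p (fun i => (y i).2)) = pr p := by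
  rw [← pr_equiv (Equiv.arrowProdEquivProdArrow ι (fun _ => A) (fun _ => V)).symm, pr_prod]
  exact ex_const (α := ι → A) (pr p)

/-- clones of a positive density pattern over a two-sorted index set -/
lemma pick {ι A V : Type} [Finite ι] [Nonempty ι] [Finite A] [Finite V] [Nonempty A] [Nonempty V] {Q : (ι → A × V) → Prop} {ρ : ℝ} (hρ : 0 < ρ)
    (h : ρ ≤ pr Q) (N : ℕ) (Z : Finset V)
    (hA : ((Nat.card ι * N : ℕ):ℝ)^2 / Nat.card A ≤ ρ^(N^(Nat.card ι)) / 4)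
    (hV : ((Nat.card ι * N : ℕ):ℝ)^2 / Nat.card V ≤ ρ^(N^(Nat.card ι)) / 4)
    (hZ : ((Nat.card ι * N : ℕ):ℝ) * (Z.card / Nat.card V) ≤ ρ^(N^(Nat.card ι)) / 4) :
    ∃ Y : ι × Fin N → A × V, (∀ f : ι → Fin N, Q (fun i => Y (i, f i))) ∧ Function.Injective (fun q => (Y q).1) ∧
      Function.Injective (fun q => (Y q).2) ∧ ∀ q, (Y q).2 ∉ Z := by
  have h1 := blow (β := Fin N) hρ.le h
  rw [Nat.card_fin] at h1
  set ρ' := ρ^(N^(Nat.card ι)) with hρ'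
  have hpos : 0 < ρ' := by positivity
  have hc : Nat.card (ι × Fin N) = Nat.card ι * N := by rw [Nat.card_prod, Nat.card_fin]
  have h2 : pr (fun Y : ι × Fin N → A × V => ¬ Function.Injective (fun q => (Y q).1)) ≤ ρ'/4 := by
    rw [pr_arrow_fst (V := V) (fun y : ι × Fin N → A => ¬ Function.Injective y)]
    refine pr_not_inj.trans ?_; rw [hc]; exact hA
  have h3 : pr (fun Y : ι × Fin N → A × V => ¬ Function.Injective (fun q => (Y q).2)) ≤ ρ'/4 := by
    rw [pr_arrow_snd (A := A) (fun y : ι × Fin N → V => ¬ Function.Injective y)]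
    refine pr_not_inj.trans ?_; rw [hc]; exact hV
  have h4 : pr (fun Y : ι × Fin N → A × V => ∃ q, (Y q).2 ∈ Z) ≤ ρ'/4 := by
    rw [pr_arrow_snd (A := A) (fun y : ι × Fin N → V => ∃ q, y q ∈ Z)]
    refine (pr_exists_le (fun q (y : ι × Fin N → V) => y q ∈ Z) (Z.card / Nat.card V) fun q => ?_).trans ?_
    · rw [pr_coord q (fun v => v ∈ Z)]; exact pr_mem_le Z
    · rw [hc]; exact hZ
  by_contra hcon
  have h5 : pr (fun X : ι × Fin N → A × V => ∀ f : ι → Fin N, Q (fun i => X (i, f i))) ≤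
      pr (fun Y : ι × Fin N → A × V => (¬ Function.Injective (fun q => (Y q).1) ∨ ¬ Function.Injective (fun q => (Y q).2)) ∨ ∃ q, (Y q).2 ∈ Z) := by
    apply pr_mono; intro Y hY
    by_contra hh; push Not at hh
    exact hcon ⟨Y, hY, hh.1.1, hh.1.2, hh.2⟩
  have h6 := pr_or (fun Y : ι × Fin N → A × V => ¬ Function.Injective (fun q => (Y q).1) ∨ ¬ Function.Injective (fun q => (Y q).2)) (fun Y => ∃ q, (Y q).2 ∈ Z)
  have h7 := pr_or (fun Y : ι × Fin N → A × V => ¬ Function.Injective (fun q => (Y q).1)) (fun Y => ¬ Function.Injective (fun q => (Y q).2))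
  linarith

/-- a block: all transversals are good -/
def Blk {V β : Type} {k : ℕ} (Gd : (Fin k → V) → Prop) (X : Fin k → β → V) : Prop := ∀ f : Fin k → β, Gd (fun j => X j (f j))

def BC {V : Type} {k : ℕ} (H Gd : (Fin k → V) → Prop) (b0 ℓ : ℕ) (γ : ℝ) : Prop :=
  ∀ X X' : Fin k → Fin b0 → V, Function.Injective (fun p : Fin (k+k) × Fin b0 => (Fin.append X X' : Fin (k+k) → Fin b0 → V) p.1 p.2) →
    Blk Gd X → Blk Gd X' → ∀ Z : Finset V, (Z.card:ℝ) ≤ γ * Nat.card V → ∀ j < k, ∃ w : List V, TP H w ∧ w.Nodup ∧ w.length ≤ ℓ ∧ w.length % k = j ∧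
      k ≤ w.length ∧ (∃ (f : Fin k → Fin b0) (m : List V), w = List.ofFn (fun j => X j (f j)) ++ m) ∧ (∃ (f : Fin k → Fin b0) (m : List V), w = m ++ List.ofFn (fun j => X' j (f j))) ∧
      ∀ v ∈ w, (∃ j c, v = X j c) ∨ (∃ j c, v = X' j c) ∨ v ∉ Z

lemma BlockConnect (d r : ℕ) (δ ν ξ : ℝ) (hp : Par d r δ ν) (hξ : 0 < ξ) :
    ∃ s0 : ℕ, ∀ s ≥ s0, ∃ b0 > 0, ∃ ℓ : ℕ, ∃ γ > 0, ∃ n0 : ℕ, ∀ (V : Type) [Finite V], n0 ≤ Nat.card V →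
      ∀ H : (Fin (d+r) → V) → Prop, Host d r (δ + ξ) H → BC H (G H s) b0 ℓ γ := by
  obtain ⟨s0, hs0⟩ := G_connect d r δ ν ξ hp hξ
  refine ⟨s0 + 1, fun s hs => ?_⟩
  obtain ⟨n1, hn1⟩ := hs0 s (by omega)
  set k := d + r with hk
  have hk0 : 0 < k := by have := hp.hd; omega
  have hspos : 0 < s := by omega
  let ι := Fin (k+k) ⊕ Fin (s+s)
  haveI : Nonempty ι := ⟨Sum.inr ⟨0, by omega⟩⟩
  let Ty := (Fin k → ι) → Prop
  let val : Ty → Prop := fun P => Sym P ∧ P (Sum.inl ∘ Fin.castAdd k) ∧ ∀ σ : Equiv.Perm (Fin k), Con P ((Sum.inl ∘ Fin.castAdd k) ∘ σ) (Sum.inl ∘ Fin.natAdd k)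
  have hword : ∀ q : Ty × Fin k, ∃ u : List ι, val q.1 → TP q.1 u ∧ k ≤ u.length ∧ (∀ t : Fin k, u[t.1]? = some (Sum.inl (Fin.castAdd k t))) ∧
      (∀ t : Fin k, u[u.length - k + t.1]? = some (Sum.inl (Fin.natAdd k t))) ∧ u.length % k = q.2.1 := by
    rintro ⟨P, j⟩
    by_cases hv : val P
    · obtain ⟨u, hu⟩ := TP_walk' hk0 hv.1 hv.2.1 hv.2.2 j.1 j.2
      exact ⟨u, fun _ => hu⟩
    · exact ⟨[], fun h => absurd h hv⟩
  choose u hu using hword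
  obtain ⟨N, hN⟩ := (Set.finite_range (fun q => (u q).length)).bddAbove
  replace hN : ∀ q, (u q).length ≤ N := fun q => hN ⟨q, rfl⟩
  set ρ : ℝ := 1 / (2 * ((s:ℝ)^(k+1))^2) / Nat.card Ty with hρ
  have hTy : 0 < Nat.card Ty := Nat.card_pos
  have hρ0 : 0 < ρ := by positivity
  set ρ' := ρ^(N^(Nat.card ι)) with hρ'
  have hρ'0 : 0 < ρ' := by positivity
  set M : ℝ := ((Nat.card ι * N : ℕ):ℝ) with hM
  have hM0 : 0 ≤ M := by positivity
  obtain ⟨b0, hb0⟩ := exists_nat_gt (M^2 * 4 / ρ')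
  have hb0p : 0 < b0 := by
    have : (0:ℝ) < b0 := lt_of_le_of_lt (by positivity) hb0
    exact_mod_cast this
  obtain ⟨n2, hn2⟩ := exists_nat_gt (M^2 * 4 / ρ')
  obtain ⟨n3, hn3⟩ := exists_nat_gt (M * ((k+k)*b0) * 8 / ρ')
  refine ⟨b0, hb0p, N, ρ' / (8 * (M+1)), by positivity, max n1 (max n2 n3) + 1, fun V _ hn H hH X X' hX hB hB' Z hZ j hj => ?_⟩
  have hVpos : 0 < Nat.card V := by omega
  haveI : Nonempty V := (Nat.card_pos_iff.1 hVpos).1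
  haveI : Nonempty (Fin b0) := ⟨⟨0, hb0p⟩⟩
  have hVr : (0:ℝ) < Nat.card V := by exact_mod_cast hVpos
  let X2 : Fin (k+k) → Fin b0 → V := Fin.append X X'
  let W : ι → Fin b0 × V → V := fun p a => Sum.elim (fun q => X2 q a.1) (fun _ => a.2) p
  let g : (ι → Fin b0 × V) → ι → V := fun y p => W p (y p)
  have hval : ∀ y : ι → Fin b0 × V, (∀ σ : Equiv.Perm (Fin k), Con (pull H (g y)) ((Sum.inl ∘ Fin.castAdd k) ∘ σ) (Sum.inl ∘ Fin.natAdd k)) → val (pull H (g y)) := by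
    intro y hy
    refine ⟨fun x σ h => hH.sym _ σ h, ?_, hy⟩
    have : H (fun t => X t (y (Sum.inl (Fin.castAdd k t))).1) := G.H hspos (hB _)
    show H _
    convert this using 1
    ext t
    show X2 (Fin.castAdd k t) _ = _
    simp only [X2, Fin.append_left]; rfl
  have hpr : 1 / (2 * ((s:ℝ)^(k+1))^2) ≤ pr (fun y : ι → Fin b0 × V => ∃ P : Ty, val P ∧ pull H (g y) = P) := by
    have h1 : pr (fun y : ι → Fin b0 × V => ∀ σ : Equiv.Perm (Fin k), Con (pull H (g y)) ((Sum.inl ∘ Fin.castAdd k) ∘ σ) (Sum.inl ∘ Fin.natAdd k)) ≤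
      pr (fun y : ι → Fin b0 × V => ∃ P : Ty, val P ∧ pull H (g y) = P) := pr_mono fun y hy => ⟨_, hval y hy, rfl⟩
    refine le_trans ?_ h1
    unfold pr; rw [ex_sumArrow]
    apply const_le_ex; intro y1
    let e : Fin k → V := fun t => X t (y1 (Fin.castAdd k t)).1
    let e' : Fin k → V := fun t => X' t (y1 (Fin.natAdd k t)).1
    have happ : Fin.append e e' = fun p => X2 p (y1 p).1 := by
      ext p; refine Fin.addCases (fun t => ?_) (fun t => ?_) p
      · simp [X2, e]
      · simp only [X2, e', Fin.append_right]
    have hinj : Function.Injective (Fin.append e e') := by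
      rw [happ]; intro p q hpq
      have := hX (a₁ := (p, (y1 p).1)) (a₂ := (q, (y1 q).1)) hpq
      exact congrArg Prod.fst this
    have h2 := hn1 V (by omega) H hH e e' (hB _) (hB' _) hinj
    rw [← pr_arrow_snd (A := Fin b0)] at h2
    refine h2.trans (pr_mono fun z hz σ => ?_)
    have h3 : g (Sum.elim y1 z) = Sum.elim (Fin.append e e') (fun i => (z i).2) := by
      rw [happ]; ext p; rcases p with p | p <;> rfl
    rw [h3]; exact hz σ
  obtain ⟨P, hP⟩ := pr_pigeon (fun (P : Ty) (y : ι → Fin b0 × V) => val P ∧ pull H (g y) = P) (by positivity) hpr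
  have hvP : val P := by
    obtain ⟨y, hy⟩ := exists_of_pr (hρ0.trans_le hP); exact hy.1
  let Z' : Finset V := Z ∪ Finset.univ.image (fun p : Fin (k+k) × Fin b0 => X2 p.1 p.2)
  have hZ' : (Z'.card : ℝ) ≤ Z.card + (k+k)*b0 := by
    have h1 : Z'.card ≤ Z.card + (k+k)*b0 := by
      refine (Finset.card_union_le _ _).trans (Nat.add_le_add_left (Finset.card_image_le.trans ?_) _)
      simp
    exact_mod_cast h1
  have hnV : ∀ m ≤ max n1 (max n2 n3), (m:ℝ) ≤ Nat.card V := fun m hm => by exact_mod_cast (by omega : m ≤ Nat.card V)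
  obtain ⟨Y, hY1, hY2, hY3, hY4⟩ := pick hρ0 hP N Z' (by
      rw [Nat.card_fin, div_le_iff₀ (by exact_mod_cast hb0p)]
      rw [div_lt_iff₀ hρ'0] at hb0; show M^2 ≤ ρ'/4*_; linarith) (by
      rw [div_le_iff₀ hVr]
      rw [div_lt_iff₀ hρ'0] at hn2; show M^2 ≤ ρ'/4*_; nlinarith [hnV n2 (by omega)]) (by
      rw [← mul_div_assoc, div_le_iff₀ hVr]
      show M * _ ≤ ρ'/4 * _
      rw [div_lt_iff₀ hρ'0] at hn3
      have h1 : M * (Z.card:ℝ) ≤ ρ'/8 * Nat.card V := by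
        calc M * (Z.card:ℝ) ≤ (M+1) * (ρ' / (8 * (M+1)) * Nat.card V) := by gcongr; linarith
          _ = ρ'/8 * Nat.card V := by field_simp
      have h2 : M * ((k+k)*b0) ≤ ρ'/8 * Nat.card V := by nlinarith [hnV n3 (by omega)]
      calc M * (Z'.card:ℝ) ≤ M * (Z.card + (k+k)*b0) := by gcongr
        _ ≤ _ := by linarith)
  have hNp : 0 < N := by
    have := hN (P, ⟨j, hj⟩); have := (hu (P, ⟨j, hj⟩) hvP).2.1; omega
  let WW : ι → ℕ → V := fun p n => W p (Y (p, ⟨n % N, Nat.mod_lt _ hNp⟩))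
  obtain ⟨hu1, hu2, hu3, hu4, hu5⟩ := hu (P, ⟨j, hj⟩) hvP
  have hlen := hN (P, ⟨j, hj⟩)
  generalize u (P, ⟨j, hj⟩) = uu at *
  have hx2 : ∀ q c, X2 q c ∈ Z' := fun q c => by
    apply Finset.mem_union_right; simp only [Finset.mem_image, Finset.mem_univ, true_and]; exact ⟨(q, c), rfl⟩
  have hA : ∀ x, P x → ∀ c : Fin k → ℕ, (∀ j, c j < N) → H (fun j => WW (x j) (c j)) := by
    intro x hx c hc
    have hxi : Function.Injective x := by
      have h1 := (hY1 fun _ => ⟨0, hNp⟩).2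
      rw [← h1] at hx
      exact Function.Injective.of_comp (hH.inj _ hx)
    have h1 := (hY1 (Function.extend x (fun t => (⟨c t, hc t⟩ : Fin N)) fun _ => ⟨0, hNp⟩)).2
    rw [← h1] at hx
    unfold pull at hx
    convert hx using 1
    ext t
    show W _ _ = W _ _
    simp only [hxi.extend_apply]
    congr 4; exact Nat.mod_eq_of_lt (hc t)
  have hB : ∀ p q m n, m < N → n < N → WW p m = WW q n → m = n := by
    intro p q m n hm hn h
    have e0 : ∀ a : Fin N, (⟨m % N, Nat.mod_lt _ hNp⟩ : Fin N) = ⟨n % N, Nat.mod_lt _ hNp⟩ → m = n := by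
      intro _ h; have := congrArg Fin.val h; simp only [Nat.mod_eq_of_lt hm, Nat.mod_eq_of_lt hn] at this; exact this
    rcases p with p | p <;> rcases q with q | q
    · have h1 : (p, _) = (q, _) := hX h
      have h2 := hY2 (congrArg Prod.snd h1)
      exact e0 ⟨0, hNp⟩ (congrArg Prod.snd h2)
    · exact absurd (hx2 p _) (by rw [show X2 p _ = _ from h]; exact hY4 _)
    · exact absurd (hx2 q _) (by rw [← show _ = X2 q _ from h]; exact hY4 _)
    · exact e0 ⟨0, hNp⟩ (congrArg Prod.snd (hY3 h))
  obtain ⟨t1, t2⟩ := TP_clone (N := N) (P := P) (H := H) (u := uu) WW hA hB hu1 hlen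
  · refine ⟨uu.mapIdx fun n p => WW p n, t1, t2, by simpa using hlen, by simpa using hu5, by simpa using hu2, ?_, ?_, ?_⟩
    · refine ⟨fun t => (Y (Sum.inl (Fin.castAdd k t), ⟨t.1 % N, Nat.mod_lt _ hNp⟩)).1, row_prefix fun t => ?_⟩
      rw [List.getElem?_mapIdx, hu3 t]
      simp only [Option.map_some, WW, W, Sum.elim_inl, X2, Fin.append_left]
    · refine ⟨fun t => (Y (Sum.inl (Fin.natAdd k t), ⟨(uu.length - k + t.1) % N, Nat.mod_lt _ hNp⟩)).1, row_suffix (by simpa using hu2) fun t => ?_⟩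
      rw [List.getElem?_mapIdx, List.length_mapIdx, hu4 t]
      simp only [Option.map_some, WW, W, Sum.elim_inl, X2, Fin.append_right]; rfl
    · intro v hv
      rw [List.mem_mapIdx] at hv
      obtain ⟨i, hi, rfl⟩ := hv
      rcases uu[i] with p | p
      · refine Fin.addCases (fun t => ?_) (fun t => ?_) p
        · left; simp only [WW, W, Sum.elim_inl, X2, Fin.append_left]; exact ⟨_, _, rfl⟩
        · right; left; simp only [WW, W, Sum.elim_inl, X2, Fin.append_right]; exact ⟨_, _, rfl⟩
      · right; right; intro hz; exact hY4 _ (Finset.mem_union_left _ hz)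
end
end TH

open Finset
set_option linter.all false
namespace TH
open scoped Classical
noncomputable section

def R3 {V : Type} {T : Type} {k b : ℕ} (Y : T → Fin k → Fin b → V) : T × Fin k × Fin b → V := fun p => Y p.1 p.2.1 p.2.2

/-- rounding a perfect fractional matching -/
lemma round_pfm {k s : ℕ} {P : (Fin k → Fin s) → Prop} (hP : PFM P) (h : ℕ) :
    ∃ (m : ℕ) (x : Fin m → Fin k → Fin s) (ψ : Fin m → Fin k → Fin h), (∀ t, P (x t)) ∧
      (∀ t j t' j', x t j = x t' j' → ψ t j = ψ t' j' → t = t' ∧ j = j') ∧ (h:ℝ) * s - k * (s:ℝ)^k ≤ m * k := by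
  obtain ⟨w, h0, h1, h2'⟩ := hP
  have h2 : ∀ a, ∑ x, w x * (#{j | x j = a} : ℝ) = 1 := fun a => by convert h2' a
  let n : (Fin k → Fin s) → ℕ := fun x => ⌊w x * h⌋₊
  have hn1 : ∀ x, (n x : ℝ) ≤ w x * h := fun x => Nat.floor_le (mul_nonneg (h0 x) (by positivity))
  have hn2 : ∀ x, w x * h - 1 ≤ n x := fun x => by have := Nat.lt_floor_add_one (w x * h); linarith
  let T0 := Σ x : Fin k → Fin s, Fin (n x)
  have hcard : ∀ a : Fin s, Fintype.card {q : T0 × Fin k // q.1.1 q.2 = a} ≤ h := by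
    intro a
    have e1 : Fintype.card {q : T0 × Fin k // q.1.1 q.2 = a} = ∑ x, n x * #{j | x j = a} := by
      rw [Fintype.card_subtype, Finset.card_filter, Fintype.sum_prod_type]
      rw [Fintype.sum_sigma]
      refine Finset.sum_congr rfl fun x _ => ?_
      simp only [Finset.card_filter, Finset.sum_const, Finset.card_univ, Fintype.card_fin, smul_eq_mul]
      have key : ∀ C : ℕ, (∑ _x : Fin (n x), C) = n x * C := fun C => by simp
      rw [← key]
    rw [e1]
    have e2 : ((∑ x, n x * #{j | x j = a} : ℕ):ℝ) ≤ h := by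
      push_cast
      calc ∑ x, (n x:ℝ) * #{j | x j = a} ≤ ∑ x, h * (w x * #{j | x j = a}) := by
            refine Finset.sum_le_sum fun x _ => ?_
            have := mul_le_mul_of_nonneg_right (hn1 x) (Nat.cast_nonneg (#{j | x j = a}))
            calc _ ≤ _ := this
              _ = _ := by ring
        _ = h := by rw [← Finset.mul_sum, h2 a, mul_one]
    exact_mod_cast e2
  have hemb : ∀ a : Fin s, ∃ φ : {q : T0 × Fin k // q.1.1 q.2 = a} → Fin h, Function.Injective φ := fun a => by
    obtain ⟨φ⟩ := Function.Embedding.nonempty_of_card_le (α := {q : T0 × Fin k // q.1.1 q.2 = a}) (β := Fin h) (by simpa using hcard a)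
    exact ⟨φ, φ.injective⟩
  choose φ hφ using hemb
  have e : T0 ≃ Fin (Fintype.card T0) := Fintype.equivFin T0
  refine ⟨Fintype.card T0, fun t => (e.symm t).1, fun t j => φ ((e.symm t).1 j) ⟨(e.symm t, j), rfl⟩, fun t => ?_, fun t j t' j' hx hψ => ?_, ?_⟩
  · apply h1; intro hw
    have h3 := (e.symm t).2.2
    simp [n, hw] at h3
  · have key : ∀ (a a' : Fin s) (p : {q : T0 × Fin k // q.1.1 q.2 = a}) (p' : {q : T0 × Fin k // q.1.1 q.2 = a'}), a = a' → φ a p = φ a' p' → p.1 = p'.1 := by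
      rintro a a' p p' rfl hh; rw [hφ a hh]
    have := key _ _ _ _ hx hψ
    exact ⟨e.symm.injective (congrArg Prod.fst this), congrArg Prod.snd this⟩
  · have e1 : Fintype.card T0 = ∑ x, n x := by simp [T0]
    rw [e1]; push_cast
    have e3 : ∑ x, w x * k = s := by
      have : ∀ x : Fin k → Fin s, (k:ℝ) = ∑ a : Fin s, (#{j | x j = a} : ℝ) := by
        intro x
        have := Finset.card_eq_sum_card_fiberwise (s := (univ : Finset (Fin k))) (f := x) (t := univ) (by simp)
        rw [Finset.card_univ, Fintype.card_fin] at this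
        exact_mod_cast this
      calc ∑ x, w x * k = ∑ x, ∑ a : Fin s, w x * (#{j | x j = a} : ℝ) := by
            refine Finset.sum_congr rfl fun x _ => ?_
            rw [← Finset.mul_sum, ← this x]
        _ = ∑ a : Fin s, ∑ x, w x * (#{j | x j = a} : ℝ) := Finset.sum_comm
        _ = s := by rw [Finset.sum_congr rfl fun a _ => h2 a]; simp
    calc (h:ℝ) * s - k * (s:ℝ)^k = ∑ x : Fin k → Fin s, ((w x * h - 1) * k) := by
          have e4 : (h:ℝ) * s = ∑ x : Fin k → Fin s, w x * h * k := by
            rw [← e3, Finset.mul_sum]; refine Finset.sum_congr rfl fun x _ => by ring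
          rw [e4]; simp only [sub_mul, Finset.sum_sub_distrib]
          congr 1; simp; ring
      _ ≤ ∑ x, (n x:ℝ) * k := Finset.sum_le_sum fun x _ => mul_le_mul_of_nonneg_right (hn2 x) (by positivity)
      _ = _ := by rw [Finset.sum_mul]

lemma gadget0 (k s b h : ℕ) (hs : 0 < s) (hb : 0 < b) (hh : 0 < h) : ∃ L0 : ℕ, ∀ L ≥ L0, ∀ (V : Type) (Gd : (Fin k → V) → Prop),
    (∀ x, Gd x → Function.Injective x) → ∀ X : Fin s → Fin L → V, Function.Injective (fun p : Fin s × Fin L => X p.1 p.2) →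
    pr (fun y : Fin s → Fin L => ¬ PFM (fun x : Fin k → Fin s => Gd (fun i => X (x i) (y (x i))))) ≤ 1/8 →
    ∀ D : Finset V, (∀ a, 2 * s * #{c | X a c ∈ D} ≤ L) →
    ∃ (m : ℕ) (Y : Fin m → Fin k → Fin b → V), Function.Injective (R3 Y) ∧ (∀ t, Blk Gd (Y t)) ∧
      (∀ t j c, Y t j c ∉ D ∧ ∃ a c', Y t j c = X a c') ∧ (∀ a, #{c | ∃ t j e, Y t j e = X a c} ≤ h * b) ∧
      (h:ℝ) * s - k * (s:ℝ)^k ≤ m * k := by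
  let Ty := (Fin k → Fin s) → Prop
  have hTy : 0 < Nat.card Ty := Nat.card_pos
  set ρ : ℝ := (3/8) / Nat.card Ty with hρ
  have hρ0 : 0 < ρ := by positivity
  set ρ' := ρ^((h*b)^s) with hρ'
  have hρ'0 : 0 < ρ' := by positivity
  obtain ⟨L0, hL0⟩ := exists_nat_gt (((s * (h*b) : ℕ):ℝ)^2 / ρ')
  refine ⟨L0 + 1, fun L hL V Gd hG X hX hpr D hD => ?_⟩
  have hLp : 0 < L := by omega
  haveI : Nonempty (Fin L) := ⟨⟨0, hLp⟩⟩
  have h1 : pr (fun y : Fin s → Fin L => ∃ a, X a (y a) ∈ D) ≤ 1/2 := by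
    refine (pr_exists_le (fun a (y : Fin s → Fin L) => X a (y a) ∈ D) (1/(2*s)) fun a => ?_).trans ?_
    · rw [pr_coord a (fun c => X a c ∈ D), pr_card, Fintype.card_fin, div_le_div_iff₀ (by positivity) (by positivity)]
      have := hD a
      have h2 : ((2 * s * #{c | X a c ∈ D} : ℕ):ℝ) ≤ L := by exact_mod_cast this
      push_cast at h2; linarith
    · rw [Nat.card_fin]; apply le_of_eq; field_simp
  have h2 : 3/8 ≤ pr (fun y : Fin s → Fin L => ∃ P : Ty, PFM P ∧ (∀ a, X a (y a) ∉ D) ∧ (fun x : Fin k → Fin s => Gd (fun i => X (x i) (y (x i)))) = P) := by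
    have a1 := pr_not (fun y : Fin s → Fin L => PFM (fun x : Fin k → Fin s => Gd (fun i => X (x i) (y (x i)))))
    have a2 := pr_sub (fun y : Fin s → Fin L => PFM (fun x : Fin k → Fin s => Gd (fun i => X (x i) (y (x i))))) (fun y => ∃ a, X a (y a) ∈ D)
    refine le_trans ?_ (pr_mono (p := fun y : Fin s → Fin L => PFM (fun x : Fin k → Fin s => Gd (fun i => X (x i) (y (x i)))) ∧ ¬ ∃ a, X a (y a) ∈ D) ?_)
    · linarith
    · rintro y ⟨a3, a4⟩; push Not at a4; exact ⟨_, a3, a4, rfl⟩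
  obtain ⟨P, hP⟩ := pr_pigeon (fun (P : Ty) (y : Fin s → Fin L) => PFM P ∧ (∀ a, X a (y a) ∉ D) ∧ (fun x : Fin k → Fin s => Gd (fun i => X (x i) (y (x i)))) = P) (by norm_num) h2
  have hPP : PFM P := by obtain ⟨y, hy⟩ := exists_of_pr (hρ0.trans_le hP); exact hy.1
  have h3 := blow (β := Fin h × Fin b) hρ0.le hP
  rw [Nat.card_prod, Nat.card_fin, Nat.card_fin, Nat.card_fin] at h3
  have h4 : pr (fun y : Fin s × (Fin h × Fin b) → Fin L => ¬ Function.Injective y) < ρ' := by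
    refine lt_of_le_of_lt pr_not_inj ?_
    rw [Nat.card_fin, div_lt_iff₀ (by positivity)]
    simp only [Nat.card_prod, Nat.card_fin]
    rw [div_lt_iff₀ hρ'0] at hL0
    have : (L0:ℝ) ≤ L := by exact_mod_cast (by omega : L0 ≤ L)
    nlinarith
  obtain ⟨y, hy1, hy2⟩ : ∃ y : Fin s × (Fin h × Fin b) → Fin L, (∀ f : Fin s → Fin h × Fin b, PFM P ∧ (∀ a, X a (y (a, f a)) ∉ D) ∧ (fun x : Fin k → Fin s => Gd (fun i => X (x i) (y (x i, f (x i))))) = P) ∧ ¬ ¬ Function.Injective y := by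
    refine exists_of_pr (lt_of_lt_of_le ?_ (pr_sub _ _))
    linarith
  rw [not_not] at hy2
  obtain ⟨m, x, ψ, hx1, hx2, hx3⟩ := round_pfm hPP h
  have hxi : ∀ t, Function.Injective (x t) := by
    intro t
    have h5 := hx1 t
    rw [← (hy1 fun _ => (⟨0, hh⟩, ⟨0, hb⟩)).2.2] at h5
    have h6 := hG _ h5
    intro i i' hii; apply h6; simp only [hii]
  refine ⟨m, fun t j c => X (x t j) (y (x t j, (ψ t j, c))), ?_, ?_, ?_, ?_, hx3⟩
  · rintro ⟨t, j, c⟩ ⟨t', j', c'⟩ he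
    have h5 := hX (a₁ := (x t j, y (x t j, (ψ t j, c)))) (a₂ := (x t' j', y (x t' j', (ψ t' j', c')))) he
    have h6 := hy2 (congrArg Prod.snd h5)
    simp only [Prod.mk.injEq] at h6
    obtain ⟨rfl, rfl⟩ := hx2 _ _ _ _ h6.1 h6.2.1
    rw [h6.2.2]
  · intro t f
    have h5 := hx1 t
    rw [← (hy1 (Function.extend (x t) (fun j => (ψ t j, f j)) fun _ => (⟨0, hh⟩, ⟨0, hb⟩))).2.2] at h5
    simp only [(hxi t).extend_apply] at h5
    exact h5
  · intro t j c
    exact ⟨(hy1 fun _ => (ψ t j, c)).2.1 _, _, _, rfl⟩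
  · intro a
    calc #{c | ∃ t j e, X (x t j) (y (x t j, (ψ t j, e))) = X a c} ≤ #((univ : Finset (Fin h × Fin b)).image fun q => y (a, q)) := by
          apply Finset.card_le_card
          intro c hc
          simp only [Finset.mem_filter, Finset.mem_univ, true_and] at hc
          obtain ⟨t, j, e, he⟩ := hc
          have h5 := hX (a₁ := (x t j, y (x t j, (ψ t j, e)))) (a₂ := (a, c)) he
          simp only [Prod.mk.injEq] at h5
          rw [← h5.2, h5.1]
          exact Finset.mem_image_of_mem _ (Finset.mem_univ _)
      _ ≤ h * b := Finset.card_image_le.trans (by simp)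

lemma gadget (k s b h : ℕ) (hs : 0 < s) (hb : 0 < b) (hh : 0 < h) : ∃ L0 : ℕ, ∀ L ≥ L0, ∀ (V : Type) (Gd : (Fin k → V) → Prop),
    (∀ x, Gd x → Function.Injective x) → ∀ X : Fin s → Fin L → V, Function.Injective (fun p : Fin s × Fin L => X p.1 p.2) →
    pr (fun y : Fin s → Fin L => ¬ PFM (fun x : Fin k → Fin s => Gd (fun i => X (x i) (y (x i))))) ≤ 1/8 →
    ∀ a : ℕ, 2 * s * (a * (h * b)) ≤ L →
    ∃ (m : ℕ) (Y : Fin m → Fin k → Fin b → V), Function.Injective (R3 Y) ∧ (∀ t, Blk Gd (Y t)) ∧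
      (∀ t j c, ∃ a c', Y t j c = X a c') ∧ (∀ i, #{c | ∃ t j e, Y t j e = X i c} ≤ a * (h * b)) ∧
      a * ((h:ℝ) * s - k * (s:ℝ)^k) ≤ m * k := by
  obtain ⟨L0, hL0⟩ := gadget0 k s b h hs hb hh
  refine ⟨L0, fun L hL V Gd hG X hX hpr a => ?_⟩
  induction a with
  | zero => exact fun _ => ⟨0, fun t => t.elim0, fun p => p.1.elim0, fun t => t.elim0, fun t => t.elim0, by simp, by simp⟩
  | succ a ih =>
    intro ha
    have ha' : 2 * s * (a * (h * b)) ≤ L := le_trans (by gcongr; omega) ha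
    obtain ⟨m, Y, h1, h2, h3, h4, h5⟩ := ih ha'
    let D : Finset V := univ.image (R3 Y)
    have hDm : ∀ v, v ∈ D ↔ ∃ t j e, Y t j e = v := by
      intro v; simp [D, R3]
    obtain ⟨m', Y', g1, g2, g3, g4, g5⟩ := hL0 L hL V Gd hG X hX hpr D (fun i => by
      simp only [hDm]; exact le_trans (Nat.mul_le_mul_left _ (h4 i)) ha')
    have key : ∀ t j c, ∀ p, R3 Y p ≠ Y' t j c := fun t j c p hp => (g3 t j c).1 ((hDm _).2 ⟨_, _, _, hp⟩)
    refine ⟨m + m', Fin.append Y Y', ?_, ?_, ?_, ?_, ?_⟩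
    · rintro ⟨t, j, c⟩ ⟨t', j', c'⟩
      refine Fin.addCases (fun t => ?_) (fun t => ?_) t <;> refine Fin.addCases (fun t' => ?_) (fun t' => ?_) t' <;>
        simp only [R3, Fin.append_left, Fin.append_right] <;> intro he
      · have := h1 (a₁ := (t, j, c)) (a₂ := (t', j', c')) he
        simp only [Prod.mk.injEq] at this ⊢; simp [this]
      · exact absurd he (key _ _ _ (t, j, c))
      · exact absurd he.symm (key _ _ _ (t', j', c'))
      · have := g1 (a₁ := (t, j, c)) (a₂ := (t', j', c')) he
        simp only [Prod.mk.injEq] at this ⊢; simp [this]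
    · intro t; refine Fin.addCases (fun t => ?_) (fun t => ?_) t
      · rw [Fin.append_left]; exact h2 t
      · rw [Fin.append_right]; exact g2 t
    · intro t j c; refine Fin.addCases (fun t => ?_) (fun t => ?_) t
      · rw [Fin.append_left]; exact h3 t j c
      · rw [Fin.append_right]; exact (g3 t j c).2
    · intro i
      calc _ ≤ #(({c | ∃ t j e, Y t j e = X i c} : Finset (Fin L)) ∪ ({c | ∃ t j e, Y' t j e = X i c} : Finset (Fin L))) := by
            apply Finset.card_le_card; intro c hc
            simp only [Finset.mem_filter, Finset.mem_univ, true_and, Finset.mem_union] at hc ⊢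
            obtain ⟨t, j, e, he⟩ := hc
            revert he; refine Fin.addCases (fun t => ?_) (fun t => ?_) t
            · rw [Fin.append_left]; exact fun he => Or.inl ⟨_, _, _, he⟩
            · rw [Fin.append_right]; exact fun he => Or.inr ⟨_, _, _, he⟩
        _ ≤ a * (h * b) + h * b := (Finset.card_union_le _ _).trans (Nat.add_le_add (h4 i) (g4 i))
        _ = _ := by ring
    · push_cast; nlinarith
end
end TH

open Finset
set_option linter.all false
namespace TH
open scoped Classical
noncomputable section

lemma groups {k s L : ℕ} {ε : ℝ} (hs : 0 < s) (hL : 0 < L) {V κ : Type} [Finite V] [Fintype κ] {Gd : (Fin k → V) → Prop} (X : κ → Fin L → V)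
    (hX : Function.Injective fun p : κ × Fin L => X p.1 p.2)
    (hpr : pr (fun R : Fin s → V => ¬ PFM (fun x : Fin k → Fin s => Gd (R ∘ x))) ≤ ε) (hc : 2 * s^2 ≤ Fintype.card κ)
    (hn : s * (((Nat.card V:ℝ) - Fintype.card κ * L) / Nat.card V) ≤ ε) :
    ∃ Ψ : Fin (Fintype.card κ / s) → Fin s → κ, (Function.Injective fun p : Fin (Fintype.card κ / s) × Fin s => Ψ p.1 p.2) ∧
      ∃ S : Finset (Fin (Fintype.card κ / s)), (1 - 32*ε) * ((Fintype.card κ / s : ℕ):ℝ) ≤ #S ∧ ∀ i ∈ S,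
        pr (fun y : Fin s → Fin L => ¬ PFM (fun x : Fin k → Fin s => Gd (fun j => X (Ψ i (x j)) (y (x j))))) ≤ 1/8 := by
  set c := Fintype.card κ with hcc
  set g := c / s with hg
  have hcp : 0 < c := lt_of_lt_of_le (by positivity) hc
  haveI : Nonempty κ := Fintype.card_pos_iff.1 hcp
  haveI : Nonempty (Fin L) := ⟨⟨0, hL⟩⟩
  haveI : Nonempty V := ⟨X (Classical.arbitrary _) (Classical.arbitrary _)⟩
  let e : κ ≃ Fin c := Fintype.equivFin κ
  have hlt : ∀ (i : Fin g) (j : Fin s), i.1 * s + j.1 < c := by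
    intro i j
    have h1 : (i.1 + 1) * s ≤ g * s := Nat.mul_le_mul_right _ i.2
    have h2 : g * s ≤ c := Nat.div_mul_le_self c s
    have := j.2
    nlinarith
  let Ψ0 : Fin g → Fin s → κ := fun i j => e.symm ⟨i.1 * s + j.1, hlt i j⟩
  have hΨ0 : Function.Injective fun p : Fin g × Fin s => Ψ0 p.1 p.2 := by
    rintro ⟨i, j⟩ ⟨i', j'⟩ h
    have h1 := congrArg Fin.val (e.symm.injective h)
    simp only at h1
    have h2 : i.1 = i'.1 := by
      have a1 : (i.1 * s + j.1) / s = i.1 := by rw [mul_comm, Nat.mul_add_div hs, Nat.div_eq_of_lt j.2, add_zero]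
      have a2 : (i'.1 * s + j'.1) / s = i'.1 := by rw [mul_comm, Nat.mul_add_div hs, Nat.div_eq_of_lt j'.2, add_zero]
      rw [← a1, ← a2, h1]
    rw [h2] at h1
    simp only [Prod.mk.injEq]; exact ⟨Fin.ext h2, Fin.ext (by omega)⟩
  let B : (Fin s → κ) → ℝ := fun φ => pr (fun y : Fin s → Fin L => ¬ PFM (fun x : Fin k → Fin s => Gd (fun j => X (φ (x j)) (y (x j)))))
  have hB0 : ∀ φ, 0 ≤ B φ := fun φ => pr_nonneg _
  have hB : ex B ≤ 2 * ε := by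
    have h1 := pr_restrict' (fun p : κ × Fin L => X p.1 p.2) hX s (fun R : Fin s → V => ¬ PFM (fun x : Fin k → Fin s => Gd (R ∘ x)))
    rw [← pr_equiv (Equiv.arrowProdEquivProdArrow (Fin s) (fun _ => κ) (fun _ => Fin L)).symm, pr_prod] at h1
    have h2 : (Nat.card (κ × Fin L) : ℝ) = c * L := by rw [Nat.card_prod, Nat.card_fin, Nat.card_eq_fintype_card]; push_cast; rfl
    rw [h2] at h1
    calc ex B ≤ _ := h1
      _ ≤ 2 * ε := by linarith
  let f : (Fin s → κ) → ℝ := fun φ => ind (1/8 < B φ)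
  have hf : ∀ φ, f φ ≤ 8 * B φ := by
    intro φ
    by_cases h : 1/8 < B φ
    · simp only [f]; rw [ind_true h]; linarith
    · simp only [f]; rw [ind_false h]; have := hB0 φ; linarith
  set I := (univ.filter fun φ : Fin s → κ => Function.Injective φ) with hI
  have hIc : (c:ℝ)^s / 2 ≤ #I := by
    have h1 := pr_not_inj (ι := Fin s) (V := κ)
    have h2 := pr_not (fun φ : Fin s → κ => Function.Injective φ)
    have h3 := pr_card (fun φ : Fin s → κ => Function.Injective φ)
    rw [Nat.card_fin, Nat.card_eq_fintype_card] at h1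
    rw [h2, h3, Fintype.card_fun, Fintype.card_fin] at h1
    have h4 : (s:ℝ)^2 / (Fintype.card κ) ≤ 1/2 := by
      rw [div_le_iff₀ (by exact_mod_cast hcp)]
      have : ((2 * s^2 : ℕ):ℝ) ≤ Fintype.card κ := by exact_mod_cast hc
      push_cast at this; linarith
    have h5 : 1/2 ≤ (#I : ℝ) / ((c^s : ℕ):ℝ) := by rw [hI]; linarith
    rw [le_div_iff₀ (by positivity)] at h5
    push_cast at h5; linarith
  have hE : ∀ i, (ex fun σ : Equiv.Perm κ => f (σ ∘ Ψ0 i)) ≤ 32 * ε := by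
    intro i
    have h1 := ex_perm (Ψ0 i) (fun j j' h => congrArg Prod.snd (hΨ0 (a₁ := (i, j)) (a₂ := (i, j')) h)) f
    have h2 : ∑ φ ∈ I, f φ ≤ 16 * ε * (c:ℝ)^s := by
      calc ∑ φ ∈ I, f φ ≤ ∑ φ : Fin s → κ, 8 * B φ := (Finset.sum_le_sum fun φ _ => hf φ).trans
              (Finset.sum_le_sum_of_subset_of_nonneg (subset_univ _) fun φ _ _ => by have := hB0 φ; positivity)
        _ = 8 * (c:ℝ)^s * ex B := by
            rw [ex_eq, ← Finset.mul_sum, Fintype.card_fun, Fintype.card_fin]; push_cast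
            have : (0:ℝ) < (c:ℝ)^s := by positivity
            field_simp; rfl
        _ ≤ 8 * (c:ℝ)^s * (2 * ε) := by gcongr
        _ = _ := by ring
    have h3 : (ex fun σ : Equiv.Perm κ => f (σ ∘ Ψ0 i)) * #I ≤ 16 * ε * (c:ℝ)^s := by
      refine le_trans (le_of_eq ?_) h2; rw [hI]; convert h1
    have h4 : 0 ≤ (ex fun σ : Equiv.Perm κ => f (σ ∘ Ψ0 i)) := ex_nonneg fun _ => ind_nonneg _
    have h5 : (0:ℝ) < (c:ℝ)^s := by positivity
    have h6 : (ex fun σ : Equiv.Perm κ => f (σ ∘ Ψ0 i)) * ((c:ℝ)^s / 2) ≤ 16 * ε * (c:ℝ)^s := (mul_le_mul_of_nonneg_left hIc h4).trans h3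
    by_contra hcon; push Not at hcon
    nlinarith
  obtain ⟨σ, hσ⟩ : ∃ σ : Equiv.Perm κ, ∑ i, f (σ ∘ Ψ0 i) ≤ 32 * ε * g := by
    apply exists_le_of_ex
    rw [ex_sum]
    refine (Finset.sum_le_sum fun i _ => hE i).trans (le_of_eq ?_)
    simp; ring
  refine ⟨fun i j => σ (Ψ0 i j), fun p q h => hΨ0 (σ.injective h), univ.filter (fun i => B (σ ∘ Ψ0 i) ≤ 1/8), ?_, fun i hi => (Finset.mem_filter.1 hi).2⟩
  have h1 : ∑ i, f (σ ∘ Ψ0 i) = #(univ.filter fun i => ¬ B (σ ∘ Ψ0 i) ≤ 1/8) := by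
    rw [Finset.card_filter]; push_cast
    refine Finset.sum_congr rfl fun i _ => ?_
    simp only [f, ind, not_le]
  have h2 := Finset.card_filter_add_card_filter_not (s := (univ : Finset (Fin g))) (fun i => B (σ ∘ Ψ0 i) ≤ 1/8)
  rw [Finset.card_univ, Fintype.card_fin] at h2
  have h3 : (#(univ.filter fun i => B (σ ∘ Ψ0 i) ≤ 1/8) : ℝ) + #(univ.filter fun i => ¬ B (σ ∘ Ψ0 i) ≤ 1/8) = g := by exact_mod_cast h2
  linarith

def Cov (k s : ℕ) (ε u : ℝ) : Prop := ∀ b > 0, ∃ n0 : ℕ, ∀ (V : Type) [Finite V], n0 ≤ Nat.card V → ∀ Gd : (Fin k → V) → Prop,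
  (∀ x, Gd x → Function.Injective x) → pr (fun R : Fin s → V => ¬ PFM (fun x : Fin k → Fin s => Gd (R ∘ x))) ≤ ε →
  ∃ (m : ℕ) (Y : Fin m → Fin k → Fin b → V), Function.Injective (R3 Y) ∧ (∀ t, Blk Gd (Y t)) ∧ (1 - u) * Nat.card V ≤ m * k * b

lemma cov_comb {k s b L a h : ℕ} (hs : 0 < s) (hL : L = 2 * s * (a * (h * b))) {V κ : Type} [Fintype κ] {Gd : (Fin k → V) → Prop} {m g : ℕ}
    (cell : κ → Fin L → V) (hcell : Function.Injective fun p : κ × Fin L => cell p.1 p.2) (old : Fin m → Fin k → κ)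
    (hold : ∀ t j t' j', old t j = old t' j' → t = t' ∧ j = j') (hblk : ∀ t, Blk Gd (fun j => cell (old t j)))
    (Ψ : Fin g → Fin s → κ) (hΨ : Function.Injective fun p : Fin g × Fin s => Ψ p.1 p.2) (S : Finset (Fin g))
    (hS : ∀ i ∈ S, ∃ (m : ℕ) (Y : Fin m → Fin k → Fin b → V), Function.Injective (R3 Y) ∧ (∀ t, Blk Gd (Y t)) ∧
      (∀ t j c, ∃ a c', Y t j c = cell (Ψ i a) c') ∧ (∀ i', #{c | ∃ t j e, Y t j e = cell (Ψ i i') c} ≤ a * (h * b)) ∧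
      a * ((h:ℝ) * s - k * (s:ℝ)^k) ≤ m * k) :
    ∃ (m' : ℕ) (Y : Fin m' → Fin k → Fin b → V), Function.Injective (R3 Y) ∧ (∀ t, Blk Gd (Y t)) ∧
      (m:ℝ) * k * ((2*s-1) * (a * (h * b))) + #S * (a * ((h:ℝ) * s - k * (s:ℝ)^k)) * b ≤ m' * k * b := by
  have hS' : ∀ i, ∃ (m : ℕ) (Y : Fin m → Fin k → Fin b → V), i ∈ S → Function.Injective (R3 Y) ∧ (∀ t, Blk Gd (Y t)) ∧
      (∀ t j c, ∃ a c', Y t j c = cell (Ψ i a) c') ∧ (∀ i', #{c | ∃ t j e, Y t j e = cell (Ψ i i') c} ≤ a * (h * b)) ∧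
      a * ((h:ℝ) * s - k * (s:ℝ)^k) ≤ m * k := by
    intro i
    by_cases hi : i ∈ S
    · obtain ⟨m, Y, h⟩ := hS i hi; exact ⟨m, Y, fun _ => h⟩
    · exact ⟨0, fun t => t.elim0, fun h => absurd h hi⟩
  choose mg Y hY using hS'
  have h1 := fun i hi => (hY i hi).1
  have h2 := fun i hi => (hY i hi).2.1
  have h3 := fun i hi => (hY i hi).2.2.1
  have h4 := fun i hi => (hY i hi).2.2.2.1
  have h5 := fun i hi => (hY i hi).2.2.2.2
  have hem : ∀ q : κ, ∃ em : Fin ((2*s-1)*(a*h)) × Fin b → Fin L, Function.Injective em ∧ ∀ p, ∀ i ∈ S, ∀ t j e, Y i t j e ≠ cell q (em p) := by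
    intro q
    let U : Finset (Fin L) := {c | ∃ i ∈ S, ∃ t j e, Y i t j e = cell q c}
    have hU : #U ≤ a * (h * b) := by
      by_cases hq : ∃ i ∈ S, ∃ i', Ψ i i' = q
      · obtain ⟨i, hi, i', rfl⟩ := hq
        refine (Finset.card_le_card ?_).trans (h4 i hi i')
        intro c hc
        simp only [U, Finset.mem_filter, Finset.mem_univ, true_and] at hc ⊢
        obtain ⟨i2, hi2, t, j, e, he⟩ := hc
        obtain ⟨a', c', hac⟩ := h3 i2 hi2 t j e
        have e1 := hcell (a₁ := (Ψ i2 a', c')) (a₂ := (Ψ i i', c)) (hac.symm.trans he)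
        have e2 := hΨ (a₁ := (i2, a')) (a₂ := (i, i')) (congrArg Prod.fst e1)
        have e3 : i2 = i := congrArg Prod.fst e2
        subst e3
        exact ⟨t, j, e, he⟩
      · have : U = ∅ := by
          rw [Finset.eq_empty_iff_forall_notMem]; intro c hc
          simp only [U, Finset.mem_filter, Finset.mem_univ, true_and] at hc
          obtain ⟨i2, hi2, t, j, e, he⟩ := hc
          obtain ⟨a', c', hac⟩ := h3 i2 hi2 t j e
          have e1 := hcell (a₁ := (Ψ i2 a', c')) (a₂ := (q, c)) (hac.symm.trans he)
          exact hq ⟨i2, hi2, a', congrArg Prod.fst e1⟩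
        rw [this]; simp
    have hUc : Fintype.card (Fin ((2*s-1)*(a*h)) × Fin b) ≤ Fintype.card {c // c ∈ Uᶜ} := by
      rw [Fintype.card_coe, Finset.card_compl, Fintype.card_prod, Fintype.card_fin, Fintype.card_fin, Fintype.card_fin]
      obtain ⟨s', rfl⟩ : ∃ s', s = s' + 1 := ⟨s-1, by omega⟩
      have e1 : 2 * (s'+1) - 1 = 2 * s' + 1 := by omega
      rw [e1]
      have e2 : L = (2*s'+1)*(a*h)*b + a * (h*b) := by rw [hL]; ring
      omega
    obtain ⟨em⟩ := Function.Embedding.nonempty_of_card_le hUc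
    refine ⟨fun p => (em p).1, fun p p' hpp => em.injective (Subtype.ext hpp), fun p i hi t j e he => ?_⟩
    have := (em p).2
    simp only [U, Finset.mem_compl, Finset.mem_filter, Finset.mem_univ, true_and] at this
    exact this ⟨i, hi, t, j, e, he⟩
  choose em he1 he2 using hem
  let T' := (Fin m × Fin ((2*s-1)*(a*h))) ⊕ (Σ i : S, Fin (mg i.1))
  let Z : T' → Fin k → Fin b → V := fun t => match t with
    | Sum.inl p => fun j c => cell (old p.1 j) (em (old p.1 j) (p.2, c))
    | Sum.inr p => Y p.1.1 p.2
  have hZ : Function.Injective (R3 Z) := by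
    rintro ⟨t | ⟨⟨i, hi⟩, t⟩, j, c⟩ ⟨t' | ⟨⟨i', hi'⟩, t'⟩, j', c'⟩ he
    · have e1 := hcell (a₁ := (old t.1 j, _)) (a₂ := (old t'.1 j', _)) he
      obtain ⟨e2, e3⟩ := hold _ _ _ _ (congrArg Prod.fst e1)
      obtain ⟨t1, t2⟩ := t; obtain ⟨t1', t2'⟩ := t'
      simp only at e2 e3; subst e2; subst e3
      have e4 := he1 _ (congrArg Prod.snd e1)
      simp only [Prod.mk.injEq] at e4; rw [e4.1, e4.2]
    · exact absurd he.symm (he2 _ _ i' hi' _ _ _)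
    · exact absurd he (he2 _ _ i hi _ _ _)
    · obtain ⟨a1, c1, hac⟩ := h3 i hi t j c
      obtain ⟨a2, c2, hac'⟩ := h3 i' hi' t' j' c'
      have e1 := hcell (a₁ := (Ψ i a1, c1)) (a₂ := (Ψ i' a2, c2)) (hac.symm.trans (Eq.trans he hac'))
      have e2 := hΨ (a₁ := (i, a1)) (a₂ := (i', a2)) (congrArg Prod.fst e1)
      have e3 : i = i' := congrArg Prod.fst e2
      subst e3
      have e4 := h1 i hi (a₁ := (t, j, c)) (a₂ := (t', j', c')) he
      simp only [Prod.mk.injEq] at e4; rw [e4.1, e4.2.1, e4.2.2]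
  have hZB : ∀ t', Blk Gd (Z t') := by
    rintro (p | p)
    · intro f; exact hblk p.1 (fun j => em (old p.1 j) (p.2, f j))
    · exact h2 _ p.1.2 _
  let e := Fintype.equivFin T'
  refine ⟨Fintype.card T', fun t => Z (e.symm t), fun p q hpq => ?_, fun t => ?_, ?_⟩
  · have := hZ (a₁ := (e.symm p.1, p.2)) (a₂ := (e.symm q.1, q.2)) hpq
    simp only [Prod.mk.injEq] at this
    exact Prod.ext (e.symm.injective this.1) this.2
  · exact hZB _
  · have e1 : Fintype.card T' = m * ((2*s-1)*(a*h)) + ∑ i : S, mg i.1 := by simp [T']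
    have e2 : (((2*s-1 : ℕ)):ℝ) = 2*s-1 := by
      rw [Nat.cast_sub (by omega)]; push_cast; ring
    rw [e1]; push_cast; rw [e2]
    have e3 : (#S:ℝ) * (a * ((h:ℝ) * s - k * (s:ℝ)^k)) ≤ (∑ i : S, (mg i.1 : ℝ)) * k := by
      rw [Finset.sum_mul]
      calc _ = ∑ i : S, (a * ((h:ℝ) * s - k * (s:ℝ)^k)) := by simp
        _ ≤ _ := Finset.sum_le_sum fun i _ => h5 i.1 i.2
    have e4 := mul_le_mul_of_nonneg_right e3 (Nat.cast_nonneg (α := ℝ) b)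
    have e5 : ((m:ℝ) * ((2*s-1)*(a*h)) + ∑ i : S, (mg i.1 : ℝ)) * k * b = (m:ℝ) * k * ((2*s-1) * (a * (h * b))) + (∑ i : S, (mg i.1 : ℝ)) * k * b := by ring
    rw [e5]; linarith

lemma cov_arith {k s b a h L n K S m : ℕ} {ε u : ℝ} (hs : 0 < s) (hε : 0 < ε) (hε1 : ε ≤ 1/80) (hLp : 0 < L) (hL : L = 2 * s * (a * (h * b)))
    (hh : (k:ℝ) * (s:ℝ)^k / (ε * s) < h) (hnr : (0:ℝ) < n) (hsL : ((s:ℝ)+1) * L ≤ ε * n) (hcLr : (n:ℝ) ≤ (K + 1) * L)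
    (hS1 : (1 - 32*ε) * ((K / s : ℕ):ℝ) ≤ S) (hX3 : (1 - u) * n ≤ m * k * L) :
    (1 - (u * (1 - 1/(2*s)) + 40*ε/(2*s))) * n ≤ (m:ℝ) * k * ((2*s-1) * (a * (h * b))) + S * (a * ((h:ℝ) * s - k * (s:ℝ)^k)) * b := by
  have hsr : (0:ℝ) < s := by exact_mod_cast hs
  set g := K / s with hg
  have hLr : (L:ℝ) = 2 * s * (a * (h * b)) := by rw [hL]; push_cast; ring
  have q1 : (m:ℝ) * k * ((2*s-1) * (a * (h * b))) = m * k * L * (1 - 1/(2*s)) := by rw [hLr]; field_simp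
  have q2 : (1-ε) * (L/2) ≤ (a * ((h:ℝ) * s - k * (s:ℝ)^k)) * b := by
    rw [div_lt_iff₀ (by positivity)] at hh
    have : (L:ℝ)/2 = (a * b) * (h * s) := by rw [hLr]; ring
    rw [this]
    have e1 : (0:ℝ) ≤ a * b := by positivity
    linarith [mul_le_mul_of_nonneg_left hh.le e1]
  have q3 : (1-ε) * n ≤ s * g * L := by
    have e1 : K < (g + 1) * s := by
      have := Nat.lt_div_mul_add (a := K) hs
      rw [← hg] at this; linarith
    have e2 : (K : ℝ) ≤ (g+1) * s := by exact_mod_cast e1.le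
    have : (0:ℝ) < L := by exact_mod_cast hLp
    linarith [mul_le_mul_of_nonneg_right e2 this.le]
  have q4 : (1-40*ε) * n / (2*s) ≤ S * (a * ((h:ℝ) * s - k * (s:ℝ)^k)) * b := by
    have e1 : (S:ℝ) * ((1-ε) * (L/2)) ≤ S * ((a * ((h:ℝ) * s - k * (s:ℝ)^k)) * b) := mul_le_mul_of_nonneg_left q2 (by positivity)
    have e2 : (1 - 32*ε) * (g:ℝ) * ((1-ε) * (L/2)) ≤ S * ((1-ε) * (L/2)) := mul_le_mul_of_nonneg_right hS1 (mul_nonneg (by linarith) (by positivity))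
    have e3 : (1-40*ε) * n / (2*s) ≤ (1 - 32*ε) * (g:ℝ) * ((1-ε) * (L/2)) := by
      rw [div_le_iff₀ (by positivity)]
      have e4 : (1 - 32*ε) * (1-ε) * ((1-ε) * n) ≤ (1 - 32*ε) * (1-ε) * (s * g * L) := mul_le_mul_of_nonneg_left q3 (mul_nonneg (by linarith) (by linarith))
      have e5 : (1-40*ε) ≤ (1 - 32*ε) * (1-ε) * (1-ε) := by
        have := mul_nonneg (mul_pos hε hε).le (by linarith : 0 ≤ 65 - 32*ε)
        linarith
      linarith [mul_le_mul_of_nonneg_right e5 hnr.le]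
    linarith
  have q5 : (1-u) * n * (1 - 1/(2*s)) ≤ m * k * L * (1 - 1/(2*s)) := by
    refine mul_le_mul_of_nonneg_right hX3 ?_
    rw [sub_nonneg, div_le_one (by positivity)]
    have : (1:ℝ) ≤ s := by exact_mod_cast hs
    linarith
  rw [q1]
  have q6 : (1 - (u * (1 - 1/(2*s)) + 40*ε/(2*s))) * n = (1-u) * n * (1 - 1/(2*s)) + (1-40*ε) * n / (2*s) := by field_simp; ring
  rw [q6]; linarith


lemma cov_step {k s : ℕ} {ε u : ℝ} (hs : 0 < s) (hε : 0 < ε) (hε1 : ε ≤ 1/80) (hC : Cov k s ε u) :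
    Cov k s ε (u * (1 - 1/(2*s)) + 40*ε/(2*s)) := by
  intro b hb
  obtain ⟨h, hh⟩ := exists_nat_gt ((k:ℝ) * (s:ℝ)^k / (ε * s))
  have hsr : (0:ℝ) < s := by exact_mod_cast hs
  have hhp : 0 < h := by
    have : (0:ℝ) < h := lt_of_le_of_lt (by positivity) hh
    exact_mod_cast this
  obtain ⟨L0, hL0⟩ := gadget k s b h hs hb hhp
  set a := L0 + 1 with ha
  set L := 2 * s * (a * (h * b)) with hL
  have hLL : L0 ≤ L := by
    have : 0 < 2 * s * (h * b) := by positivity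
    have : L = (2 * s * (h*b)) * a := by rw [hL]; ring
    rw [this]; nlinarith
  have hLp : 0 < L := by rw [hL, ha]; positivity
  obtain ⟨n1, hn1⟩ := hC L hLp
  obtain ⟨n2, hn2⟩ := exists_nat_gt (((s:ℝ)+1) * L / ε)
  refine ⟨n1 + n2 + (2*s^2+1)*L, fun V _ hV Gd hG hpr => ?_⟩
  cases nonempty_fintype V
  obtain ⟨m, X, hX1, hX2, hX3⟩ := hn1 V (by omega) Gd hG hpr
  set n := Nat.card V with hn
  have hnc : Fintype.card V = n := by rw [hn, Nat.card_eq_fintype_card]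
  let U : Finset V := (univ.image (R3 X))ᶜ
  have hUc : #U = n - m * (k * L) := by
    rw [Finset.card_compl, Finset.card_image_of_injective _ hX1, hnc]; simp
  have hle : m * (k * L) ≤ n := by
    have := Fintype.card_le_of_injective _ hX1
    rw [hnc] at this; simpa using this
  set m0 := #U / L with hm0
  obtain ⟨ch⟩ : Nonempty (Fin m0 × Fin L ↪ U) := Function.Embedding.nonempty_of_card_le (by
    rw [Fintype.card_coe, Fintype.card_prod, Fintype.card_fin, Fintype.card_fin]; exact Nat.div_mul_le_self _ _)
  let κ := (Fin m × Fin k) ⊕ Fin m0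
  let cell : κ → Fin L → V := fun q c => match q with
    | Sum.inl p => X p.1 p.2 c
    | Sum.inr i => (ch (i, c)).1
  have hdis : ∀ p c q, X (p : Fin m × Fin k).1 p.2 c ≠ (ch q).1 := by
    intro p c q h
    have := (ch q).2
    rw [Finset.mem_compl] at this
    exact this (Finset.mem_image.2 ⟨(p.1, p.2, c), mem_univ _, h⟩)
  have hcell : Function.Injective fun p : κ × Fin L => cell p.1 p.2 := by
    rintro ⟨p | i, c⟩ ⟨p' | i', c'⟩ he
    · have := hX1 (a₁ := (p.1, p.2, c)) (a₂ := (p'.1, p'.2, c')) he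
      simp only [Prod.mk.injEq] at this
      rw [show p = p' from Prod.ext this.1 this.2.1, this.2.2]
    · exact absurd he (hdis _ _ _)
    · exact absurd he.symm (hdis _ _ _)
    · have := ch.injective (Subtype.ext he)
      simp only [Prod.mk.injEq] at this; rw [this.1, this.2]
  have hκ : Fintype.card κ = m * k + m0 := by simp [κ]
  have hcL : n < (Fintype.card κ + 1) * L := by
    have h1 := Nat.lt_div_mul_add (a := #U) hLp
    rw [← hm0] at h1
    rw [hκ]; have : (m*k+m0+1)*L = m*(k*L) + (m0 * L + L) := by ring
    rw [this]; omega
  have hcard : 2 * s^2 ≤ Fintype.card κ := by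
    have : (2*s^2+1)*L < (Fintype.card κ + 1) * L := by omega
    have := Nat.lt_of_mul_lt_mul_right this
    omega
  have hnp : 0 < n := by have : 0 < (2*s^2+1)*L := by positivity
                         omega
  have hnr : (0:ℝ) < n := by exact_mod_cast hnp
  have hsL : ((s:ℝ)+1) * L ≤ ε * n := by
    rw [div_lt_iff₀ hε] at hn2
    have : (n2:ℝ) ≤ n := by exact_mod_cast (by omega : n2 ≤ n)
    linarith [mul_le_mul_of_nonneg_right this hε.le]
  have hcLr : (n:ℝ) ≤ (Fintype.card κ + 1) * L := by exact_mod_cast hcL.le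
  obtain ⟨Ψ, hΨ, S, hS1, hS2⟩ := groups hs hLp (Gd := Gd) cell hcell hpr hcard (by
    rw [← mul_div_assoc, div_le_iff₀ hnr]
    have : (0:ℝ) < L := by exact_mod_cast hLp
    linarith [mul_le_mul_of_nonneg_left hcLr hsr.le, mul_pos hsr this])
  obtain ⟨m', Y, r1, r2, r3⟩ := cov_comb hs hL (Gd := Gd) cell hcell (fun (t : Fin m) (j : Fin k) => (Sum.inl (t, j) : κ))
    (fun t j t' j' he => Prod.mk.inj (Sum.inl.inj he)) (fun t => hX2 t) Ψ hΨ S (fun i hi => hL0 L hLL V Gd hG (fun j => cell (Ψ i j)) (fun p q he => by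
      have e1 := hcell (a₁ := (Ψ i p.1, p.2)) (a₂ := (Ψ i q.1, q.2)) he
      have e2 := hΨ (a₁ := (i, p.1)) (a₂ := (i, q.1)) (congrArg Prod.fst e1)
      exact Prod.ext (congrArg Prod.snd e2) (congrArg (fun z : κ × Fin L => z.2) e1)) (hS2 i hi) a le_rfl)
  refine ⟨m', Y, r1, r2, le_trans ?_ r3⟩
  exact cov_arith hs hε hε1 hLp hL hh hnr hsL hcLr hS1 hX3

lemma cover (k s : ℕ) {ε : ℝ} (hs : 0 < s) (hε : 0 < ε) (hε1 : ε ≤ 1/80) : Cov k s ε (41*ε) := by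
  have hsr : (1:ℝ) ≤ s := by exact_mod_cast hs
  set θ : ℝ := 1 - 1/(2*s) with hθ
  have hθ0 : 0 ≤ θ := by rw [hθ, sub_nonneg, div_le_one (by positivity)]; linarith
  have hθ1 : θ < 1 := by rw [hθ]; have : 0 < 1/(2*(s:ℝ)) := by positivity
                         linarith
  have key : ∀ i : ℕ, Cov k s ε (θ^i + 40*ε) := by
    intro i
    induction i with
    | zero =>
      intro b hb
      refine ⟨0, fun V _ _ Gd _ _ => ⟨0, fun t => t.elim0, fun p => p.1.elim0, fun t => t.elim0, ?_⟩⟩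
      have : (0:ℝ) ≤ Nat.card V := by positivity
      rw [pow_zero]; push_cast; linarith [mul_nonneg hε.le this]
    | succ i ih =>
      have := cov_step hs hε hε1 ih
      convert this using 1
      rw [← hθ, pow_succ]; have : 40*ε/(2*s) = 40*ε*(1-θ) := by rw [hθ]; field_simp; ring
      rw [this]; ring
  obtain ⟨i, hi⟩ := exists_pow_lt_of_lt_one hε hθ1
  intro b hb
  obtain ⟨n0, hn0⟩ := key i b hb
  refine ⟨n0, fun V _ hV Gd hG hpr => ?_⟩
  obtain ⟨m, Y, h1, h2, h3⟩ := hn0 V hV Gd hG hpr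
  refine ⟨m, Y, h1, h2, le_trans ?_ h3⟩
  have : (0:ℝ) ≤ Nat.card V := by positivity
  linarith [mul_le_mul_of_nonneg_right hi.le this]
end
end TH

open Finset
set_option linter.all false
namespace TH
open scoped Classical
noncomputable section

def pre {V : Type} (w c : ℕ → List V) (N : ℕ) : List V := (List.range N).flatMap fun i => w i ++ c i

lemma pre_succ {V : Type} (w c : ℕ → List V) (N : ℕ) : pre w c (N+1) = pre w c N ++ (w N ++ c N) := by
  simp [pre, List.range_succ]

lemma chain {V : Type} {k : ℕ} {H : (Fin k → V) → Prop} (w c : ℕ → List V) (N : ℕ) (h0 : TP H (w 0))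
    (hk : ∀ i < N, k ≤ (w i).length) (h : ∀ i < N, TP H (w i ++ c i ++ w (i+1))) : TP H (pre w c N ++ w N) := by
  induction N with
  | zero => simpa [pre] using h0
  | succ N ih =>
    have h1 := ih (fun i hi => hk i (by omega)) (fun i hi => h i (by omega))
    have h2 := h N (by omega)
    rw [pre_succ]
    rw [List.append_assoc] at h2
    have := TP_glue (hk N (by omega)) h1 h2
    simpa [List.append_assoc] using this

/-- gluing a segment between two words -/
lemma glue_seg {V : Type} {k : ℕ} {H : (Fin k → V) → Prop} {w w' c m m' : List V} {x y : Fin k → V} (hw : TP H w) (hw' : TP H w')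
    (h1 : w = m ++ List.ofFn x) (h2 : w' = List.ofFn y ++ m') (hc : TP H (List.ofFn x ++ c ++ List.ofFn y)) : TP H (w ++ c ++ w') := by
  subst h1; subst h2
  have a1 : TP H (m ++ List.ofFn x ++ (c ++ List.ofFn y)) := TP_glue (by simp) hw (by simpa [List.append_assoc] using hc)
  have a2 := TP_glue (a := m ++ List.ofFn x ++ c) (c := List.ofFn y) (b := m') (by simp) (by simpa [List.append_assoc] using a1) hw'
  simpa [List.append_assoc] using a2

structure WordOK {V : Type} {k : ℕ} (H : (Fin k → V) → Prop) {b0 : ℕ} (ℓ : ℕ) (X X' : Fin k → Fin b0 → V) (ρ : ℕ) (w : List V) : Prop where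
  tp : TP H w
  nd : w.Nodup
  len : w.length ≤ ℓ
  res : w.length % k = ρ
  klen : k ≤ w.length
  st : ∃ (f : Fin k → Fin b0) (m : List V), w = List.ofFn (fun j => X j (f j)) ++ m
  en : ∃ (f : Fin k → Fin b0) (m : List V), w = m ++ List.ofFn (fun j => X' j (f j))

lemma words {V : Type} [Finite V] {k : ℕ} {H Gd : (Fin k → V) → Prop} {b0 ℓ : ℕ} {γ : ℝ} (hBC : BC H Gd b0 ℓ γ) (N : ℕ)
    (B : ℕ → Bool → Fin k → Fin b0 → V)
    (hB : ∀ i i' s s' j j' c c', i < N → i' < N → B i s j c = B i' s' j' c' → i = i' ∧ s = s' ∧ j = j' ∧ c = c')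
    (hblk : ∀ i < N, ∀ s, Blk Gd (B i s)) (Z : Finset V) (hZB : ∀ i < N, ∀ s j c, B i s j c ∉ Z) (ρ : ℕ → ℕ) (hρ : ∀ i, ρ i < k)
    (hcard : (Z.card:ℝ) + N * (2 * k * b0 + ℓ) ≤ γ * Nat.card V) :
    ∃ w : ℕ → List V, (∀ i < N, WordOK H ℓ (B i false) (B i true) (ρ i) (w i)) ∧
      (∀ i < N, ∀ v ∈ w i, v ∉ Z ∧ ∀ i' < N, ∀ s j c, v = B i' s j c → i' = i) ∧
      (∀ i < N, ∀ i' < N, i ≠ i' → List.Disjoint (w i) (w i')) := by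
  have key : ∀ n ≤ N, ∃ w : ℕ → List V, (∀ i < n, WordOK H ℓ (B i false) (B i true) (ρ i) (w i)) ∧
      (∀ i < n, ∀ v ∈ w i, v ∉ Z ∧ ∀ i' < N, ∀ s j c, v = B i' s j c → i' = i) ∧
      (∀ i < n, ∀ i' < n, i ≠ i' → List.Disjoint (w i) (w i')) := by
    intro n
    induction n with
    | zero => exact fun _ => ⟨fun _ => [], by simp, by simp, by simp⟩
    | succ n ih =>
      intro hn
      obtain ⟨w, h1, h2, h3⟩ := ih (by omega)
      let Blks : Finset V := (univ : Finset (Fin N × Bool × Fin k × Fin b0)).image fun p => B p.1 p.2.1 p.2.2.1 p.2.2.2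
      let Wd : Finset V := (Finset.range n).biUnion fun i => (w i).toFinset
      have hc1 : #Blks ≤ N * (2 * k * b0) := by
        refine Finset.card_image_le.trans (le_of_eq ?_)
        rw [Finset.card_univ]; simp only [Fintype.card_prod, Fintype.card_fin, Fintype.card_bool]; ring
      have hc2 : #Wd ≤ N * ℓ := by
        calc #Wd ≤ ∑ i ∈ Finset.range n, #((w i).toFinset) := Finset.card_biUnion_le
          _ ≤ ∑ i ∈ Finset.range n, ℓ := Finset.sum_le_sum fun i hi => (List.toFinset_card_le _).trans (h1 i (Finset.mem_range.1 hi)).len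
          _ = n * ℓ := by simp
          _ ≤ _ := Nat.mul_le_mul_right _ (by omega)
      have hc3 : ((Z ∪ Blks ∪ Wd).card : ℝ) ≤ γ * Nat.card V := by
        refine le_trans ?_ hcard
        have : (Z ∪ Blks ∪ Wd).card ≤ Z.card + N * (2 * k * b0) + N * ℓ :=
          (Finset.card_union_le _ _).trans (Nat.add_le_add ((Finset.card_union_le _ _).trans (Nat.add_le_add_left hc1 _)) hc2)
        calc ((Z ∪ Blks ∪ Wd).card : ℝ) ≤ ((Z.card + N * (2 * k * b0) + N * ℓ : ℕ):ℝ) := by exact_mod_cast this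
          _ = _ := by push_cast; ring
      have hinj : Function.Injective (fun p : Fin (k+k) × Fin b0 => (Fin.append (B n false) (B n true) : Fin (k+k) → Fin b0 → V) p.1 p.2) := by
        rintro ⟨p, c⟩ ⟨p', c'⟩
        refine Fin.addCases (fun t => ?_) (fun t => ?_) p <;> refine Fin.addCases (fun t' => ?_) (fun t' => ?_) p' <;>
          simp only [Fin.append_left, Fin.append_right] <;> intro he <;> obtain ⟨-, hs, hj, hc⟩ := hB _ _ _ _ _ _ _ _ (by omega) (by omega) he
        · rw [hj, hc]
        · exact absurd hs (by decide)
        · exact absurd hs (by decide)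
        · rw [hj, hc]
      obtain ⟨w', g1, g2, g3, g4, g5, g6, g7, g8⟩ := hBC _ _ hinj (hblk n (by omega) _) (hblk n (by omega) _) _ hc3 (ρ n) (hρ n)
      have hfree : ∀ v ∈ w', v ∉ Z ∧ (∀ i' < N, ∀ s j c, v = B i' s j c → i' = n) ∧ ∀ i < n, v ∉ w i := by
        intro v hv
        have hown : ∀ s j c, v = B n s j c → v ∉ Z ∧ (∀ i' < N, ∀ s j c, v = B i' s j c → i' = n) ∧ ∀ i < n, v ∉ w i := by
          rintro s j c rfl
          refine ⟨hZB n (by omega) _ _ _, fun i' hi' s' j' c' he => (hB _ _ _ _ _ _ _ _ (by omega) hi' he).1.symm, fun i hi hm => ?_⟩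
          have := (h2 i hi _ hm).2 n (by omega) s j c rfl
          omega
        rcases g8 v hv with ⟨j, c, h⟩ | ⟨j, c, h⟩ | h
        · exact hown _ _ _ h
        · exact hown _ _ _ h
        · simp only [Finset.mem_union, not_or] at h
          refine ⟨h.1.1, fun i' hi' s j c he => absurd (Finset.mem_image.2 ⟨(⟨i', hi'⟩, s, j, c), mem_univ _, he.symm⟩) h.1.2, fun i hi hm => ?_⟩
          exact h.2 (Finset.mem_biUnion.2 ⟨i, Finset.mem_range.2 hi, List.mem_toFinset.2 hm⟩)
      refine ⟨fun i => if i = n then w' else w i, fun i hi => ?_, fun i hi => ?_, fun i hi i' hi' hne => ?_⟩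
      · by_cases h : i = n
        · subst h; simp only [if_true]; exact ⟨g1, g2, g3, g4, g5, g6, g7⟩
        · simp only [if_neg h]; exact h1 i (by omega)
      · by_cases h : i = n
        · subst h; simp only [if_true]; exact fun v hv => ⟨(hfree v hv).1, (hfree v hv).2.1⟩
        · simp only [if_neg h]; exact h2 i (by omega)
      · by_cases h : i = n
        · have h' : i' ≠ n := by omega
          simp only [if_pos h, if_neg h']
          intro v hv hv'; exact (hfree v hv).2.2 i' (by omega) hv'
        · by_cases h' : i' = n
          · simp only [if_pos h', if_neg h]
            intro v hv hv'; exact (hfree v hv').2.2 i (by omega) hv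
          · simp only [if_neg h', if_neg h]; exact h3 i (by omega) i' (by omega) hne
  exact key N le_rfl

/-- good blocks avoiding a small set -/
lemma wblock (k b : ℕ) (c : ℝ) (hc : 0 < c) : ∃ n0 : ℕ, ∀ (V : Type) [Finite V], n0 ≤ Nat.card V → ∀ Gd : (Fin k → V) → Prop, c ≤ pr Gd →
    ∀ Z : Finset V, k * ((Z.card:ℝ) / Nat.card V) ≤ c/2 →
    ∃ W : Fin k → Fin b → V, Function.Injective (fun p : Fin k × Fin b => W p.1 p.2) ∧ Blk Gd W ∧ ∀ j a, W j a ∉ Z := by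
  set ρ' := (c/2)^(b^k) with hρ'
  have hρ0 : 0 < ρ' := by positivity
  obtain ⟨n0, hn0⟩ := exists_nat_gt (((k * b : ℕ):ℝ)^2 / ρ')
  refine ⟨n0 + 1, fun V _ hV Gd hG Z hZ => ?_⟩
  have hVp : 0 < Nat.card V := by omega
  haveI : Nonempty V := (Nat.card_pos_iff.1 hVp).1
  have h1 : c/2 ≤ pr (fun e : Fin k → V => Gd e ∧ ¬ ∃ j, e j ∈ Z) := by
    have a1 := pr_sub Gd (fun e : Fin k → V => ∃ j, e j ∈ Z)
    have a2 := pr_exists_le (fun j (e : Fin k → V) => e j ∈ Z) (Z.card / Nat.card V) (fun j => by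
      rw [pr_coord j (fun v => v ∈ Z)]; exact pr_mem_le Z)
    rw [Nat.card_fin] at a2
    linarith
  have h2 := blow (β := Fin b) (by positivity) h1
  rw [Nat.card_fin, Nat.card_fin] at h2
  have h3 : pr (fun X : Fin k × Fin b → V => ¬ Function.Injective X) < ρ' := by
    refine lt_of_le_of_lt pr_not_inj ?_
    have : (0:ℝ) < Nat.card V := by exact_mod_cast hVp
    rw [div_lt_iff₀ this]
    simp only [Nat.card_prod, Nat.card_fin]
    rw [div_lt_iff₀ hρ0] at hn0
    have : (n0:ℝ) ≤ Nat.card V := by exact_mod_cast (by omega : n0 ≤ Nat.card V)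
    nlinarith
  obtain ⟨X, hX, hX'⟩ : ∃ X : Fin k × Fin b → V, (∀ f : Fin k → Fin b, Gd (fun i => X (i, f i)) ∧ ¬ ∃ j, X (j, f j) ∈ Z) ∧ ¬ ¬ Function.Injective X := by
    refine exists_of_pr (lt_of_lt_of_le ?_ (pr_sub _ _))
    linarith
  rw [not_not] at hX'
  exact ⟨fun j a => X (j, a), hX', fun f => (hX f).1, fun j a h => (hX fun _ => a).2 ⟨j, h⟩⟩

lemma exp_beats (k : ℕ) (a : ℝ) (ha : 0 < a) : ∃ n0 : ℕ, ∀ n ≥ n0, (n:ℝ)^k * Real.exp (-(a * n)) < 1/4 := by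
  have h1 := Real.tendsto_pow_mul_exp_neg_atTop_nhds_zero k
  have h2 : Filter.Tendsto (fun n : ℕ => a * (n:ℝ)) Filter.atTop Filter.atTop :=
    Filter.Tendsto.const_mul_atTop ha tendsto_natCast_atTop_atTop
  have h3 := h1.comp h2
  have h4 := h3.eventually (gt_mem_nhds (show (0:ℝ) < a^k * (1/4) by positivity))
  obtain ⟨n0, hn0⟩ := Filter.eventually_atTop.1 h4
  refine ⟨n0, fun n hn => ?_⟩
  have := hn0 n hn
  simp only [Function.comp, mul_pow] at this
  have hak : 0 < a^k := by positivity
  nlinarith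

/-- a sparse random family of disjoint absorbers -/
lemma family (k M : ℕ) (c : ℝ) (hc : 0 < c) (hM : 0 < M) (τ : ℝ) (hτ : 0 < τ) (hτ1 : τ ≤ c / (32 * (M:ℝ)^2)) : ∃ n0 : ℕ, ∀ (V AI : Type) [Finite V] [Finite AI], Nat.card AI = M →
    n0 ≤ Nat.card V → ∀ Q : (Fin k → V) → (AI → V) → Prop, (∀ v, c ≤ pr (Q v)) →
    ∃ (t : ℕ) (A : Fin t → AI → V), (t:ℝ) ≤ τ * Nat.card V ∧ (Function.Injective fun p : Fin t × AI => A p.1 p.2) ∧ (∀ j, ∃ v, Q v (A j)) ∧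
      ∀ v, c * τ / 4 * Nat.card V ≤ #{j | Q v (A j)} := by
  obtain ⟨n1, hn1⟩ := exp_beats k (c^2/32 * (τ/2)) (by positivity)
  obtain ⟨n2, hn2⟩ := exists_nat_gt (2/τ)
  refine ⟨n1 + n2 + 1, fun V AI _ _ hAI hV Q hQ => ?_⟩
  set n := Nat.card V with hn
  have hnp : 0 < n := by omega
  have hnr : (0:ℝ) < n := by exact_mod_cast hnp
  haveI : Nonempty V := (Nat.card_pos_iff.1 hnp).1
  set t0 := ⌊τ * n⌋₊ with ht0
  have ht1 : (t0:ℝ) ≤ τ * n := Nat.floor_le (by positivity)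
  have ht2 : τ * n / 2 ≤ t0 := by
    have h1 := Nat.lt_floor_add_one (τ * n)
    rw [div_lt_iff₀ hτ] at hn2
    have : (n2:ℝ) ≤ n := by exact_mod_cast (by omega : n2 ≤ n)
    rw [← ht0] at h1
    nlinarith
  have ht0p : (0:ℝ) < t0 := lt_of_lt_of_le (by positivity) ht2
  let cnt : (Fin t0 × AI → V) → (Fin k → V) → ℝ := fun A v => ∑ j, ind (Q v fun q => A (j, q))
  let bad : (Fin t0 × AI → V) → Fin t0 → Prop := fun A j => ∃ p : AI × (Fin t0 × AI), (j, p.1) ≠ p.2 ∧ A (j, p.1) = A p.2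
  have E1 : pr (fun A : Fin t0 × AI → V => ∃ v, cnt A v ≤ (c - c/4) * t0) < 1/4 := by
    have a1 : ∀ v, pr (fun A : Fin t0 × AI → V => cnt A v ≤ (c - c/4) * t0) ≤ Real.exp (-((c/4)^2/2) * t0) := by
      intro v
      have a2 := hoeffding (Y := AI → V) (f := fun y => ind (Q v y)) (fun _ => ind_nonneg _) (fun _ => ind_le_one _) (ξ := c/4) (ρ := c) (by positivity) (hQ v) t0
      rw [← pr_equiv (Equiv.curry (Fin t0) AI V)] at a2
      exact a2
    refine lt_of_le_of_lt (pr_exists_le _ _ a1) ?_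
    refine lt_of_le_of_lt ?_ (hn1 n (by omega))
    have e1 : (Nat.card (Fin k → V) : ℝ) = (n:ℝ)^k := by
      rw [Nat.card_fun, Nat.card_fin]; push_cast; rfl
    rw [e1]; gcongr
    nlinarith [mul_le_mul_of_nonneg_left ht2 (by positivity : 0 ≤ c^2/32)]
  have E2 : pr (fun A : Fin t0 × AI → V => c/4 * t0 ≤ ∑ j, ind (bad A j)) ≤ 1/2 := by
    refine (markov (fun A => Finset.sum_nonneg fun j _ => ind_nonneg _) (by positivity)).trans ?_
    rw [div_le_iff₀ (by positivity), ex_sum]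
    have b1 : ∀ j, (ex fun A : Fin t0 × AI → V => ind (bad A j)) ≤ c/32 := by
      intro j
      have b2 := pr_exists_le (fun (p : AI × (Fin t0 × AI)) (A : Fin t0 × AI → V) => (j, p.1) ≠ p.2 ∧ A (j, p.1) = A p.2) (1/n) (fun p => by
        by_cases h : (j, p.1) = p.2
        · refine (pr_mono (q := fun _ => False) (fun x hx => hx.1 h)).trans ?_
          simp [pr, ind, ex]
        · exact (pr_mono fun x hx => hx.2).trans (pr_collide _ _ h))
      refine le_trans b2 ?_
      simp only [Nat.card_prod, Nat.card_fin, hAI]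
      push_cast
      rw [← mul_div_assoc, mul_one, div_le_iff₀ hnr]
      rw [le_div_iff₀ (by positivity)] at hτ1
      have hMM : (0:ℝ) ≤ (M:ℝ)^2 := by positivity
      nlinarith [mul_le_mul_of_nonneg_right ht1 hMM, mul_le_mul_of_nonneg_right hτ1 hnr.le]
    calc _ ≤ ∑ j : Fin t0, c/32 := Finset.sum_le_sum fun j _ => b1 j
      _ = t0 * (c/32) := by simp
      _ ≤ _ := by nlinarith [mul_pos hc ht0p]
  obtain ⟨A, hA⟩ : ∃ A : Fin t0 × AI → V, ¬ ((∃ v, cnt A v ≤ (c - c/4) * t0) ∨ c/4 * t0 ≤ ∑ j, ind (bad A j)) := by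
    by_contra hcon; rw [not_exists] at hcon; simp only [not_not] at hcon
    have c1 := pr_true (p := fun A : Fin t0 × AI → V => (∃ v, cnt A v ≤ (c - c/4) * t0) ∨ c/4 * t0 ≤ ∑ j, ind (bad A j)) hcon
    have c2 := pr_or (fun A : Fin t0 × AI → V => ∃ v, cnt A v ≤ (c - c/4) * t0) (fun A => c/4 * t0 ≤ ∑ j, ind (bad A j))
    linarith
  push Not at hA
  obtain ⟨hA1, hA2⟩ := hA
  let S : Finset (Fin t0) := univ.filter fun j => ¬ bad A j ∧ ∃ v, Q v fun q => A (j, q)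
  let e : Fin #S ≃ S := (Finset.equivFin S).symm
  refine ⟨#S, fun j q => A ((e j).1, q), ?_, ?_, fun j => (Finset.mem_filter.1 (e j).2).2.2, fun v => ?_⟩
  · refine le_trans ?_ ht1
    have := Finset.card_le_univ S
    rw [Fintype.card_fin] at this
    exact_mod_cast this
  · rintro ⟨j, q⟩ ⟨j', q'⟩ he
    by_contra hne
    have h1 : ¬ bad A (e j).1 := (Finset.mem_filter.1 (e j).2).2.1
    apply h1
    refine ⟨(q, ((e j').1, q')), fun h => hne ?_, he⟩
    simp only [Prod.mk.injEq] at h ⊢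
    exact ⟨e.injective (Subtype.ext h.1), h.2⟩
  · have d1 := hA1 v
    have d2 : cnt A v ≤ #{j : Fin #S | Q v fun q => A ((e j).1, q)} + ∑ j, ind (bad A j) := by
      have d3 : cnt A v ≤ ∑ j, (ind (j ∈ S ∧ Q v fun q => A (j, q)) + ind (bad A j)) := by
        refine Finset.sum_le_sum fun j _ => ?_
        by_cases h : Q v fun q => A (j, q)
        · by_cases h' : bad A j
          · rw [ind_true h, ind_true h']; linarith [ind_nonneg (j ∈ S ∧ Q v fun q => A (j, q))]
          · rw [ind_true h, ind_true (⟨Finset.mem_filter.2 ⟨mem_univ _, h', v, h⟩, h⟩ : j ∈ S ∧ Q v fun q => A (j, q))]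
            linarith [ind_nonneg (bad A j)]
        · rw [ind_false h]; exact add_nonneg (ind_nonneg _) (ind_nonneg _)
      rw [Finset.sum_add_distrib] at d3
      refine d3.trans (add_le_add_left ?_ _)
      have d4 : ∑ j, ind (j ∈ S ∧ Q v fun q => A (j, q)) = (#{j | j ∈ S ∧ Q v fun q => A (j, q)} : ℝ) := by
        rw [Finset.card_filter]; push_cast
        exact Finset.sum_congr rfl fun j _ => by by_cases h : j ∈ S ∧ Q v fun q => A (j, q) <;> simp [ind, h]
      rw [d4]
      have d5 : #{j | j ∈ S ∧ Q v fun q => A (j, q)} ≤ #{j : Fin #S | Q v fun q => A ((e j).1, q)} := by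
        refine Finset.card_le_card_of_surjOn (fun j => (e j).1) ?_
        intro j hj
        simp only [Finset.coe_filter, Finset.mem_univ, true_and, Set.mem_setOf_eq] at hj
        refine ⟨e.symm ⟨j, hj.1⟩, ?_, by simp⟩
        simp only [Finset.coe_filter, Finset.mem_univ, true_and, Set.mem_setOf_eq, Equiv.apply_symm_apply]
        exact hj.2
      exact_mod_cast d5
    nlinarith [mul_le_mul_of_nonneg_left ht2 hc.le]
end
end TH

open Finset
set_option linter.all false
namespace TH
open scoped Classical
noncomputable section

lemma rows_get {ι : Type} {k : ℕ} (hk : 0 < k) : ∀ (R : List (Fin k → ι)) n v, (R.flatMap fun a => List.ofFn a)[n]? = some v → ∃ a ∈ R, v = a ⟨n % k, Nat.mod_lt _ hk⟩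
  | [], n, v, h => by simp at h
  | a :: R, n, v, h => by
    rw [List.flatMap_cons] at h
    by_cases hn : n < k
    · rw [List.getElem?_append_left (by simpa using hn)] at h
      obtain ⟨h', rfl⟩ := get_ofFn a h
      exact ⟨a, by simp, by congr; exact (Nat.mod_eq_of_lt hn).symm⟩
    · rw [List.getElem?_append_right (by simpa using hn), List.length_ofFn] at h
      obtain ⟨b, hb, h2⟩ := rows_get hk R _ _ h
      refine ⟨b, by simp [hb], ?_⟩
      rw [h2]; congr 2; exact (Nat.mod_eq_sub_mod (by omega)).symm

lemma TP_rows {ι : Type} {k : ℕ} {P : (Fin k → ι) → Prop} (hk : 0 < k) (hs : Sym P) (S : Fin k → Set ι) (hS : ∀ x, (∀ j, x j ∈ S j) → P x)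
    (R : List (Fin k → ι)) (hR : ∀ a ∈ R, ∀ j, a j ∈ S j) : TP P (R.flatMap fun a => List.ofFn a) := by
  refine TP_per hk hs S hS fun n v h => ?_
  obtain ⟨a, ha, rfl⟩ := rows_get hk R n v h
  exact hR a ha _

lemma TP_rows2 {ι : Type} {k : ℕ} {P : (Fin k → ι) → Prop} (hk : 0 < k) (hs : Sym P) (S : Fin k → Set ι) (hS : ∀ x, (∀ j, x j ∈ S j) → P x)
    {a b : Fin k → ι} (ha : ∀ j, a j ∈ S j) (hb : ∀ j, b j ∈ S j) : TP P (List.ofFn a ++ List.ofFn b) := by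
  have := TP_rows hk hs S hS [a, b] (by simp [ha, hb])
  simpa using this

lemma TP_rows3 {ι : Type} {k : ℕ} {P : (Fin k → ι) → Prop} (hk : 0 < k) (hs : Sym P) (S : Fin k → Set ι) (hS : ∀ x, (∀ j, x j ∈ S j) → P x)
    {a b c : Fin k → ι} (ha : ∀ j, a j ∈ S j) (hb : ∀ j, b j ∈ S j) (hc : ∀ j, c j ∈ S j) : TP P (List.ofFn a ++ List.ofFn b ++ List.ofFn c) := by
  have := TP_rows hk hs S hS [a, b, c] (by simp [ha, hb, hc])
  simpa using this

/-- connecting words through a sequence of segments, with two end blocks -/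
lemma assemble {V : Type} [Finite V] {k : ℕ} (hk : 0 < k) {H Gd : (Fin k → V) → Prop} {b0 ℓ : ℕ} {γ : ℝ} (hBC : BC H Gd b0 ℓ γ) (hs : Sym H) (hGH : ∀ x, Gd x → H x)
    (M b' : ℕ) (ρ : ℕ → ℕ) (hρ : ∀ i, ρ i < k) (seg : ℕ → Fin k → ℕ → V) (wv : Fin k → ℕ → V)
    (hseg : ∀ n n' x x' m m', n < M → n' < M → m < 2*b0+1 → m' < 2*b0+1 → seg n x m = seg n' x' m' → n = n' ∧ x = x' ∧ m = m')
    (hwv : ∀ x x' m m', m < 2*(b0+b') → m' < 2*(b0+b') → wv x m = wv x' m' → x = x' ∧ m = m')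
    (hdis : ∀ n x m x' m', n < M → m < 2*b0+1 → m' < 2*(b0+b') → seg n x m ≠ wv x' m')
    (bseg : ∀ n < M, ∀ f : Fin k → ℕ, (∀ x, f x < 2*b0+1) → Gd fun x => seg n x (f x))
    (bwv : ∀ f : Fin k → ℕ, (∀ x, f x < 2*(b0+b')) → Gd fun x => wv x (f x))
    (hcard : ((M * k + k * (2*(b0+b')) : ℕ):ℝ) + (M+1 : ℕ) * (2 * k * b0 + ℓ) ≤ γ * Nat.card V) :
    ∃ w : ℕ → List V, (∀ i < M+1, (w i).Nodup ∧ (w i).length ≤ ℓ ∧ (w i).length % k = ρ i) ∧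
      (∀ i < M+1, ∀ v ∈ w i, (∀ n < M, ∀ x, v ≠ seg n x 0) ∧ ∀ x m, m < b' → v ≠ wv x (2*b0+m) ∧ v ≠ wv x (2*b0+b'+m)) ∧
      (∀ i < M+1, ∀ i' < M+1, i ≠ i' → List.Disjoint (w i) (w i')) ∧
      ∀ c : ℕ → List V, (∀ n < M, ∀ f f' : Fin k → ℕ, (∀ x, f x < 2*b0+1) → (∀ x, f' x < 2*b0+1) →
        TP H (List.ofFn (fun x => seg n x (f x)) ++ c n ++ List.ofFn fun x => seg n x (f' x))) →
        TP H (pre w c M ++ w M) ∧ (∃ (f : Fin k → Fin b0) (m : List V), pre w c M ++ w M = List.ofFn (fun j => wv j (f j)) ++ m) ∧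
        (∃ (f : Fin k → Fin b0) (m : List V), pre w c M ++ w M = m ++ List.ofFn (fun j => wv j (b0 + f j))) ∧
        ∀ g g' : Fin k → Fin b', TP H (List.ofFn (fun x => wv x (2*b0+g x)) ++ (pre w c M ++ w M) ++ List.ofFn fun x => wv x (2*b0+b'+g' x)) := by
  let B : ℕ → Bool → Fin k → Fin b0 → V := fun i s x c => if s then (if i < M then seg i x (c+1) else wv x (b0+c)) else
    (if i = 0 then wv x c else seg (i-1) x (c+b0+1))
  have Bt1 : ∀ i, i < M → ∀ x c, B i true x c = seg i x (c+1) := fun i hi x c => by simp [B, hi]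
  have Bt2 : ∀ i, ¬ i < M → ∀ x c, B i true x c = wv x (b0+c) := fun i hi x c => by simp only [B, if_true, if_neg hi]
  have Bf1 : ∀ i, i = 0 → ∀ x c, B i false x c = wv x c := fun i hi x c => by simp [B, hi]
  have Bf2 : ∀ i, i ≠ 0 → ∀ x c, B i false x c = seg (i-1) x (c+b0+1) := fun i hi x c => by simp [B, hi]
  -- description of block vertices
  have hdesc : ∀ i < M+1, ∀ s x (c : Fin b0), (∃ n m, n < M ∧ 0 < m ∧ m < 2*b0+1 ∧ B i s x c = seg n x m ∧ ((s = true ∧ n = i ∧ m = c+1) ∨ (s = false ∧ i = n+1 ∧ m = c+b0+1))) ∨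
      (∃ m, m < 2*b0 ∧ B i s x c = wv x m ∧ ((s = true ∧ i = M ∧ m = b0+c) ∨ (s = false ∧ i = 0 ∧ m = c))) := by
    intro i hi s x c
    have := c.2
    cases s with
    | true =>
      by_cases h : i < M
      · exact Or.inl ⟨i, c+1, h, by omega, by omega, Bt1 i h x c, Or.inl ⟨rfl, rfl, rfl⟩⟩
      · exact Or.inr ⟨b0+c, by omega, Bt2 i h x c, Or.inl ⟨rfl, by omega, rfl⟩⟩
    | false =>
      by_cases h : i = 0
      · exact Or.inr ⟨c, by omega, Bf1 i h x c, Or.inr ⟨rfl, h, rfl⟩⟩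
      · exact Or.inl ⟨i-1, c+b0+1, by omega, by omega, by omega, Bf2 i h x c, Or.inr ⟨rfl, by omega, rfl⟩⟩
  let Zs : Finset V := ((univ : Finset (Fin M × Fin k)).image fun p => seg p.1 p.2 0)
  let Zw : Finset V := ((univ : Finset (Fin k × Fin (2*(b0+b')))).filter fun p => 2*b0 ≤ p.2.1).image fun p => wv p.1 p.2
  have hZ : ((Zs ∪ Zw).card:ℝ) + (M+1 : ℕ) * (2 * k * b0 + ℓ) ≤ γ * Nat.card V := by
    refine le_trans ?_ hcard
    gcongr
    refine (card_union_le _ _).trans (Nat.add_le_add ?_ ?_)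
    · refine card_image_le.trans ?_; rw [card_univ, Fintype.card_prod, Fintype.card_fin, Fintype.card_fin]
    · refine card_image_le.trans ((card_filter_le _ _).trans ?_); rw [card_univ, Fintype.card_prod, Fintype.card_fin, Fintype.card_fin]
  obtain ⟨w, hw1, hw2, hw3⟩ := words hBC (M+1) B (by
      intro i i' s s' j j' c c' hi hi' he
      have h1 := c.2
      have h2 := c'.2
      rcases hdesc i hi s j c with ⟨n, m, a1, a0, a2, a3, a4⟩ | ⟨m, a2, a3, a4⟩ <;> rcases hdesc i' hi' s' j' c' with ⟨n', m', a1', a0', a2', a3', a4'⟩ | ⟨m', a2', a3', a4'⟩ <;> rw [a3, a3'] at he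
      · obtain ⟨e1, e2, e3⟩ := hseg _ _ _ _ _ _ a1 a1' a2 a2' he
        rcases a4 with ⟨rfl, y, z⟩ | ⟨rfl, y, z⟩ <;> rcases a4' with ⟨rfl, y', z'⟩ | ⟨rfl, y', z'⟩
        · exact ⟨by omega, rfl, e2, Fin.ext (by omega)⟩
        · omega
        · omega
        · exact ⟨by omega, rfl, e2, Fin.ext (by omega)⟩
      · exact absurd he (hdis _ _ _ _ _ a1 a2 (by omega))
      · exact absurd he.symm (hdis _ _ _ _ _ a1' a2' (by omega))
      · obtain ⟨e2, e3⟩ := hwv _ _ _ _ (by omega) (by omega) he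
        rcases a4 with ⟨rfl, y, z⟩ | ⟨rfl, y, z⟩ <;> rcases a4' with ⟨rfl, y', z'⟩ | ⟨rfl, y', z'⟩
        · exact ⟨by omega, rfl, e2, Fin.ext (by omega)⟩
        · omega
        · omega
        · exact ⟨by omega, rfl, e2, Fin.ext (by omega)⟩)
    (by
      intro i hi s f
      cases s with
      | true =>
        by_cases h : i < M
        · simp only [Bt1 i h]; exact bseg i h (fun x => f x + 1) (fun x => by have := (f x).2; show (f x).1 + 1 < _; omega)
        · simp only [Bt2 i h]; exact bwv (fun x => b0 + f x) (fun x => by have := (f x).2; show b0 + (f x).1 < _; omega)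
      | false =>
        by_cases h : i = 0
        · simp only [Bf1 i h]; exact bwv (fun x => f x) (fun x => by have := (f x).2; omega)
        · simp only [Bf2 i h]; exact bseg (i-1) (by omega) (fun x => f x + b0 + 1) (fun x => by have := (f x).2; show (f x).1 + b0 + 1 < _; omega))
    (Zs ∪ Zw) (by
      intro i hi s j c hm
      rcases Finset.mem_union.1 hm with hm | hm
      · obtain ⟨p, -, hp⟩ := Finset.mem_image.1 hm
        rcases hdesc i hi s j c with ⟨n, m, a1, a0, a2, a3, a4⟩ | ⟨m, a2, a3, a4⟩
        · rw [a3] at hp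
          have := (hseg _ _ _ _ _ _ p.1.2 a1 (by omega) a2 hp).2.2
          omega
        · rw [a3] at hp; exact hdis _ _ _ _ _ p.1.2 (by omega) (by omega) hp
      · obtain ⟨p, hp0, hp⟩ := Finset.mem_image.1 hm
        have hp1 := (Finset.mem_filter.1 hp0).2
        rcases hdesc i hi s j c with ⟨n, m, a1, a0, a2, a3, a4⟩ | ⟨m, a2, a3, a4⟩
        · rw [a3] at hp; exact hdis _ _ _ _ _ a1 a2 p.2.2 hp.symm
        · rw [a3] at hp; have := (hwv _ _ _ _ p.2.2 (by omega) hp).2; omega)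
    ρ hρ hZ
  refine ⟨w, fun i hi => ⟨(hw1 i hi).nd, (hw1 i hi).len, (hw1 i hi).res⟩, fun i hi v hv => ⟨fun n hn x he => ?_, fun x m hm => ⟨fun he => ?_, fun he => ?_⟩⟩, hw3, fun c hc => ?_⟩
  · exact (hw2 i hi v hv).1 (Finset.mem_union_left _ (Finset.mem_image.2 ⟨(⟨n, hn⟩, x), mem_univ _, he.symm⟩))
  · exact (hw2 i hi v hv).1 (Finset.mem_union_right _ (Finset.mem_image.2 ⟨(x, ⟨2*b0+m, by omega⟩), by simp, he.symm⟩))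
  · exact (hw2 i hi v hv).1 (Finset.mem_union_right _ (Finset.mem_image.2 ⟨(x, ⟨2*b0+b'+m, by omega⟩), by simp; omega, he.symm⟩))
  · have hch : TP H (pre w c M ++ w M) := by
      refine chain w c M (hw1 0 (by omega)).tp (fun i hi => (hw1 i (by omega)).klen) fun i hi => ?_
      obtain ⟨f, m, hf⟩ := (hw1 i (by omega)).en
      obtain ⟨f', m', hf'⟩ := (hw1 (i+1) (by omega)).st
      refine glue_seg (hw1 i (by omega)).tp (hw1 (i+1) (by omega)).tp hf hf' ?_
      simp only [Bt1 i hi, Bf2 (i+1) (by omega), Nat.add_sub_cancel]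
      exact hc i hi _ _ (fun x => by have := (f x).2; show (f x).1 + 1 < _; omega) (fun x => by have := (f' x).2; show (f' x).1 + b0 + 1 < _; omega)
    let S : Fin k → Set V := fun x => {v | ∃ m, m < 2*(b0+b') ∧ v = wv x m}
    have hS : ∀ y, (∀ x, y x ∈ S x) → H y := by
      intro y hy
      choose f hf1 hf2 using hy
      rw [show y = fun x => wv x (f x) from funext hf2]
      exact hGH _ (bwv f hf1)
    have hpre : ∃ (f : Fin k → Fin b0) (m : List V), pre w c M ++ w M = List.ofFn (fun j => wv j (f j)) ++ m := by
      obtain ⟨f, m, hf⟩ := (hw1 0 (by omega)).st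
      simp only [Bf1 0 rfl] at hf
      cases M with
      | zero => exact ⟨f, m, by simpa [pre] using hf⟩
      | succ M => 
        refine ⟨f, m ++ c 0 ++ ((List.range' 1 M).flatMap fun i => w i ++ c i) ++ w (M+1), ?_⟩
        rw [pre, List.range_eq_range', List.range'_succ, List.flatMap_cons, hf]; simp
    obtain ⟨f', m', hf'⟩ := (hw1 M (by omega)).en
    simp only [Bt2 M (by omega)] at hf'
    refine ⟨hch, hpre, ⟨f', pre w c M ++ m', ?_⟩, fun g g' => ?_⟩
    · conv_lhs => rw [hf']
      simp [List.append_assoc]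
    obtain ⟨f, m, hf⟩ := hpre
    have t1 : TP H (List.ofFn (fun x => wv x (2*b0+g x)) ++ (pre w c M ++ w M)) := by
      rw [hf, ← List.append_assoc]
      refine TP_glue (by simp) (TP_rows2 hk hs S hS (fun x => ?_) (fun x => ?_)) (by rw [← hf]; exact hch)
      · exact ⟨_, by have := (g x).2; omega, rfl⟩
      · exact ⟨_, by have := (f x).2; omega, rfl⟩
    have t2 : TP H (List.ofFn (fun x => wv x (b0+f' x)) ++ List.ofFn fun x => wv x (2*b0+b'+g' x)) := by
      refine TP_rows2 hk hs S hS (fun x => ?_) (fun x => ?_)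
      · exact ⟨_, by have := (f' x).2; omega, rfl⟩
      · exact ⟨_, by have := (g' x).2; omega, rfl⟩
    have e1 : List.ofFn (fun x => wv x (2*b0+g x)) ++ (pre w c M ++ w M) = (List.ofFn (fun x => wv x (2*b0+g x)) ++ (pre w c M ++ m')) ++ List.ofFn (fun x => wv x (b0+f' x)) := by
      conv_lhs => rw [hf']
      simp [List.append_assoc]
    rw [e1] at t1 ⊢
    exact TP_glue (by simp) t1 t2
end
end TH

open Finset
set_option linter.all false
namespace TH
open scoped Classical
noncomputable section

lemma ofFn_ms {V : Type} {k : ℕ} (f : Fin k → V) : ((List.ofFn f : List V) : Multiset V) = ∑ x, {f x} := by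
  induction k with
  | zero => simp
  | succ k ih => rw [List.ofFn_succ, Fin.sum_univ_succ, ← ih, ← Multiset.cons_coe, Multiset.singleton_add]

lemma pre_ms {V : Type} (w c : ℕ → List V) (N : ℕ) : ((pre w c N : List V) : Multiset V) = ∑ i ∈ range N, (((w i : List V) : Multiset V) + ((c i : List V) : Multiset V)) := by
  induction N with
  | zero => simp [pre]
  | succ N ih => rw [pre_succ, Finset.sum_range_succ, ← ih]; simp

lemma sum_blocks {X : Type} [AddCommMonoid X] (q : ℕ) (f : ℕ → X) (t : ℕ) : ∑ n ∈ range (t * q), f n = ∑ j ∈ range t, ∑ i : Fin q, f (j * q + i) := by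
  induction t with
  | zero => simp
  | succ t ih =>
    rw [Nat.succ_mul, Finset.sum_range_add, ih, Finset.sum_range_succ]
    congr 1
    exact Finset.sum_range fun i => f (t * q + i)

lemma pre_nodup {V : Type} (w c : ℕ → List V) (N : ℕ) (hw : ∀ i < N, (w i).Nodup) (hc : ∀ i < N, (c i).Nodup)
    (hwc : ∀ i < N, ∀ j < N, List.Disjoint (w i) (c j)) (hww : ∀ i < N, ∀ j < N, i ≠ j → List.Disjoint (w i) (w j))
    (hcc : ∀ i < N, ∀ j < N, i ≠ j → List.Disjoint (c i) (c j)) : (pre w c N).Nodup := by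
  refine List.nodup_flatMap.2 ⟨fun i hi => ?_, ?_⟩
  · have hi := List.mem_range.1 hi
    exact List.nodup_append'.2 ⟨hw i hi, hc i hi, hwc i hi i hi⟩
  · refine List.Pairwise.imp_of_mem ?_ List.nodup_range
    intro i j hi hj hij
    have hi := List.mem_range.1 hi
    have hj := List.mem_range.1 hj
    intro v hv hv'
    rcases List.mem_append.1 hv with h | h <;> rcases List.mem_append.1 hv' with h' | h'
    · exact hww i hi j hj hij h h'
    · exact hwc i hi j hj h h'
    · exact hwc j hj i hi h' h
    · exact hcc i hi j hj hij h h'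

def core1 {V : Type} {k N : ℕ} (A : Fin (k+1) × Fin k × Fin N → V) (z0 : Fin k) (c0 : Fin N) (o : Option (Fin k → V)) (i : Fin (k+1)) : List V :=
  Fin.cases (o.elim [] fun _ => List.ofFn fun x => A (x.succ, z0, c0))
    (fun i => o.elim (List.ofFn fun x => A (i.succ, x, c0)) fun v => List.ofFn (Function.update (fun x => A (i.succ, x, c0)) z0 (v i))) i

lemma upd_ms {V : Type} {k : ℕ} (a : Fin k → V) (z : Fin k) (v : V) : ({a z} : Multiset V) + ∑ x, {Function.update a z v x} = ∑ x, ({a x} : Multiset V) + {v} := by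
  rw [← Finset.add_sum_erase univ _ (mem_univ z), ← Finset.add_sum_erase univ (fun x => ({a x} : Multiset V)) (mem_univ z)]
  have : ∑ x ∈ univ.erase z, ({Function.update a z v x} : Multiset V) = ∑ x ∈ univ.erase z, {a x} :=
    Finset.sum_congr rfl fun x hx => by rw [Function.update_of_ne (Finset.ne_of_mem_erase hx)]
  rw [this, Function.update_self]; abel

lemma core1_ms {V : Type} {k N : ℕ} (A : Fin (k+1) × Fin k × Fin N → V) (z0 : Fin k) (c0 : Fin N) (o : Option (Fin k → V)) :
    ∑ i, ((core1 A z0 c0 o i : List V) : Multiset V) = ∑ i, ((core1 A z0 c0 none i : List V) : Multiset V) + o.elim 0 fun v => ∑ i, {v i} := by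
  cases o with
  | none => simp
  | some v =>
    rw [Fin.sum_univ_succ, Fin.sum_univ_succ]
    simp only [core1, Fin.cases_zero, Fin.cases_succ, Option.elim, ofFn_ms]
    rw [← Finset.sum_add_distrib, Finset.sum_congr rfl fun i _ => upd_ms (fun x => A (Fin.succ i, x, c0)) z0 (v i), Finset.sum_add_distrib]
    simp

lemma core1_TP {V : Type} [Finite V] {k N s : ℕ} (hk : 0 < k) (hs : 0 < s) {H : (Fin k → V) → Prop} (hsym : Sym H) (A : Fin (k+1) × Fin k × Fin N → V) (z0 : Fin k) (c0 : Fin N) (o : Option (Fin k → V))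
    (hA : ∀ i (f : Fin k → Fin N), G H s (fun j => A (i, j, f j))) (ho : ∀ v, o = some v → AGood H s z0 c0 v A) (i : Fin (k+1)) (f f' : Fin k → Fin N) :
    TP H (List.ofFn (fun x => A (i, x, f x)) ++ core1 A z0 c0 o i ++ List.ofFn fun x => A (i, x, f' x)) := by
  have hbase : ∀ i y, (∀ x, y x ∈ {v | ∃ c, v = A (i, x, c)}) → H y := by
    intro i y hy
    choose g hg using hy
    rw [show y = fun x => A (i, x, g x) from funext hg]
    exact (hA i g).H hs
  cases o with
  | none =>
    refine Fin.cases ?_ (fun i => ?_) i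
    · simp only [core1, Fin.cases_zero, Option.elim, List.append_nil]
      exact TP_rows2 hk hsym (fun x => {v | ∃ c, v = A (0, x, c)}) (hbase 0) (fun x => ⟨_, rfl⟩) (fun x => ⟨_, rfl⟩)
    · simp only [core1, Fin.cases_succ, Option.elim]
      exact TP_rows3 hk hsym (fun x => {v | ∃ c, v = A (i.succ, x, c)}) (hbase i.succ) (fun x => ⟨_, rfl⟩) (fun x => ⟨_, rfl⟩) (fun x => ⟨_, rfl⟩)
  | some v =>
    obtain ⟨-, h2, h3⟩ := ho v rfl
    refine Fin.cases ?_ (fun i => ?_) i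
    · simp only [core1, Fin.cases_zero, Option.elim]
      refine TP_rows3 hk hsym (fun x => {v | ∃ c : Option (Fin N), v = c.elim (A (x.succ, z0, c0)) (fun c => A (0, x, c))}) (fun y hy => ?_) (fun x => ⟨some (f x), rfl⟩) (fun x => ⟨none, rfl⟩) (fun x => ⟨some (f' x), rfl⟩)
      choose g hg using hy
      rw [show y = _ from funext hg]
      exact (h3 g).H hs
    · simp only [core1, Fin.cases_succ, Option.elim]
      refine TP_rows3 hk hsym (fun x => {y | (∃ c, y = A (i.succ, x, c)) ∨ (x = z0 ∧ y = v i)}) (fun y hy => ?_) (fun x => Or.inl ⟨_, rfl⟩) (fun x => ?_) (fun x => Or.inl ⟨_, rfl⟩)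
      · by_cases hz : y z0 = v i
        · have : ∀ x, ∃ c, x ≠ z0 → y x = A (i.succ, x, c) := fun x => by
            rcases hy x with ⟨c, hc⟩ | ⟨hx, -⟩
            · exact ⟨c, fun _ => hc⟩
            · exact ⟨c0, fun h => absurd hx h⟩
          choose g hg using this
          have e : y = Function.update (fun j => A (i.succ, j, g j)) z0 (v i) := by
            ext x
            by_cases hx : x = z0
            · rw [hx, Function.update_self, hz]
            · rw [Function.update_of_ne hx, hg x hx]
          rw [e]; exact h2 i g
        · refine hbase i.succ y fun x => ?_
          rcases hy x with h | ⟨rfl, h⟩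
          · exact h
          · exact absurd h hz
      · by_cases hx : x = z0
        · right; subst hx; exact ⟨rfl, Function.update_self ..⟩
        · left; exact ⟨c0, Function.update_of_ne hx ..⟩

lemma split_tuples {V : Type} (L : Finset V) (p k : ℕ) (h : #L = p * k) : ∃ Lf : Fin p → Fin k → V, ∑ a, ∑ x, ({Lf a x} : Multiset V) = L.val := by
  let e : Fin p × Fin k ≃ L := finProdFinEquiv.trans ((finCongr h.symm).trans L.equivFin.symm)
  refine ⟨fun a x => (e (a, x)).1, ?_⟩
  rw [← Fintype.sum_prod_type' (f := fun a x => ({(e (a, x)).1} : Multiset V))]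
  rw [← Finset.sum_multiset_singleton L, ← Finset.sum_coe_sort L]
  exact Equiv.sum_comp e fun y => ({y.1} : Multiset V)

lemma hall_assign {p t : ℕ} (R : Fin p → Fin t → Prop) (h : ∀ a, p ≤ #{j | R a j}) : ∃ φ : Fin p → Fin t, Function.Injective φ ∧ ∀ a, R a (φ a) := by
  obtain ⟨φ, h1, h2⟩ := (Finset.all_card_le_biUnion_card_iff_exists_injective (fun a => univ.filter (R a))).1 (by
    intro S
    rcases S.eq_empty_or_nonempty with rfl | ⟨a, ha⟩
    · simp
    · calc #S ≤ p := by simpa using Finset.card_le_univ S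
        _ ≤ _ := h a
        _ ≤ _ := Finset.card_le_card (Finset.subset_biUnion_of_mem (fun a => univ.filter (R a)) ha))
  exact ⟨φ, h1, fun a => (Finset.mem_filter.1 (h2 a)).2⟩

lemma assign_opt {V : Type} {p t k : ℕ} (Lf : Fin p → Fin k → V) (φ : Fin p → Fin t) (hφ : Function.Injective φ) :
    ∃ o : ℕ → Option (Fin k → V), (∀ j v, o j = some v → ∃ a, (φ a).1 = j ∧ v = Lf a) ∧ ∑ j ∈ range t, (o j).elim 0 (fun v => ∑ i, ({v i} : Multiset V)) = ∑ a, ∑ x, {Lf a x} := by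
  let o : ℕ → Option (Fin k → V) := fun j => if h : ∃ a, (φ a).1 = j then some (Lf h.choose) else none
  have ho : ∀ a, o (φ a) = some (Lf a) := by
    intro a
    have h : ∃ a', (φ a').1 = (φ a).1 := ⟨a, rfl⟩
    have : h.choose = a := hφ (Fin.ext h.choose_spec)
    simp only [o, dif_pos h, this]
  refine ⟨o, fun j v hv => ?_, ?_⟩
  · by_cases h : ∃ a, (φ a).1 = j
    · simp only [o, dif_pos h, Option.some.injEq] at hv
      exact ⟨_, h.choose_spec, hv.symm⟩
    · simp [o, h] at hv
  · rw [← Finset.sum_subset (s₁ := univ.image fun a => (φ a).1)]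
    · rw [Finset.sum_image fun a _ b _ hab => hφ (Fin.ext hab)]
      exact Finset.sum_congr rfl fun a _ => by rw [ho]; rfl
    · intro j hj; obtain ⟨a, -, rfl⟩ := Finset.mem_image.1 hj; exact Finset.mem_range.2 (φ a).2
    · intro j _ hj
      have : ¬ ∃ a, (φ a).1 = j := fun ⟨a, ha⟩ => hj (Finset.mem_image.2 ⟨a, mem_univ _, ha⟩)
      simp [o, this]
end
end TH

open Finset
set_option linter.all false
namespace TH
open scoped Classical
noncomputable section

lemma core1_mem {V : Type} {k N : ℕ} {A : Fin (k+1) × Fin k × Fin N → V} {z0 : Fin k} {c0 : Fin N} {i : Fin (k+1)} {v : V} (h : v ∈ core1 A z0 c0 none i) : ∃ x, v = A (i, x, c0) := by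
  revert h
  refine Fin.cases ?_ (fun i => ?_) i
  · simp [core1]
  · simp only [core1, Fin.cases_succ, Option.elim, List.mem_ofFn']
    rintro ⟨x, rfl⟩; exact ⟨x, rfl⟩

lemma core1_nodup {V : Type} {k N : ℕ} {A : Fin (k+1) × Fin k × Fin N → V} (hA : Function.Injective A) {z0 : Fin k} {c0 : Fin N} (i : Fin (k+1)) : (core1 A z0 c0 none i).Nodup := by
  refine Fin.cases ?_ (fun i => ?_) i
  · simp [core1]
  · simp only [core1, Fin.cases_succ, Option.elim]
    refine List.nodup_ofFn.2 fun x y h => ?_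
    have := hA h
    simpa using this

def AbsOut {V : Type} {k : ℕ} (H : (Fin k → V) → Prop) (s b' : ℕ) (Z : Finset V) (W : Bool → Fin k → Fin b' → V) : Prop :=
  (∀ s s' j j' c c', W s j c = W s' j' c' → s = s' ∧ j = j' ∧ c = c') ∧ (∀ (a : Fin k → Bool) (f : Fin k → Fin b'), G H s (fun x => W (a x) x (f x))) ∧ (∀ a j c, W a j c ∉ Z)

def Absorbs {V : Type} {k b' : ℕ} (H : (Fin k → V) → Prop) (Z : Finset V) (W : Bool → Fin k → Fin b' → V) (L : Finset V) : Prop :=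
  ∃ core : List V, core.Nodup ∧ core.toFinset = Z ∪ L ∧ ∀ f f' : Fin k → Fin b', TP H (List.ofFn (fun x => W false x (f x)) ++ core ++ List.ofFn (fun x => W true x (f' x)))

lemma AP_det {V : Type} [Finite V] {k b0 ℓ s t b' : ℕ} {γ : ℝ} (hk : 0 < k) (hs : 0 < s) (hb0 : 0 < b0) {H : (Fin k → V) → Prop} (hsym : Sym H) (hBC : BC H (G H s) b0 ℓ γ)
    (A : ℕ → Fin (k+1) × Fin k × Fin (2*b0+1) → V) (hAinj : ∀ j j' q q', j < t → j' < t → A j q = A j' q' → j = j' ∧ q = q')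
    (hAG : ∀ j < t, ∀ i (f : Fin k → Fin (2*b0+1)), G H s (fun x => A j (i, x, f x)))
    (Wb : Fin k → Fin (2*(b0+b')) → V) (hWinj : Function.Injective fun p : Fin k × Fin (2*(b0+b')) => Wb p.1 p.2) (hWb : Blk (G H s) Wb)
    (hAW : ∀ j < t, ∀ q x c, A j q ≠ Wb x c) (z0 : Fin k)
    (hcard : ((t*(k+1) * k + k * (2*(b0+b')) : ℕ):ℝ) + (t*(k+1)+1 : ℕ) * (2 * k * b0 + ℓ) ≤ γ * Nat.card V) :
    ∃ (Z : Finset V) (W : Bool → Fin k → Fin b' → V), #Z ≤ t*(k+1)*k + (t*(k+1)+1)*ℓ ∧ AbsOut H s b' Z W ∧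
      ∀ (L : Finset V) (p : ℕ), Disjoint L Z → #L = p * k → (∀ v, p ≤ #{j : Fin t | AGood H s z0 0 v (A j)}) → Absorbs H Z W L := by
  set M := t*(k+1) with hM
  let iF : ℕ → Fin (k+1) := fun n => ⟨n % (k+1), Nat.mod_lt _ (by omega)⟩
  let cl : ℕ → Fin (2*b0+1) := fun m => ⟨m % (2*b0+1), Nat.mod_lt _ (by omega)⟩
  let cw : ℕ → Fin (2*(b0+b')) := fun m => ⟨m % (2*(b0+b')), Nat.mod_lt _ (by omega)⟩
  let seg : ℕ → Fin k → ℕ → V := fun n x m => A (n/(k+1)) (iF n, x, cl m)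
  let wv : Fin k → ℕ → V := fun x m => Wb x (cw m)
  have hdiv : ∀ n, n < M → n/(k+1) < t := fun n hn => Nat.div_lt_of_lt_mul (by rw [hM] at hn; linarith)
  have hseg : ∀ n n' x x' m m', n < M → n' < M → m < 2*b0+1 → m' < 2*b0+1 → seg n x m = seg n' x' m' → n = n' ∧ x = x' ∧ m = m' := by
    intro n n' x x' m m' hn hn' hm hm' he
    obtain ⟨e1, e2⟩ := hAinj _ _ _ _ (hdiv n hn) (hdiv n' hn') he
    simp only [Prod.mk.injEq] at e2
    obtain ⟨e2, e3, e4⟩ := e2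
    have e2 : n % (k+1) = n' % (k+1) := congrArg Fin.val e2
    have e4 : m % (2*b0+1) = m' % (2*b0+1) := congrArg Fin.val e4
    rw [Nat.mod_eq_of_lt hm, Nat.mod_eq_of_lt hm'] at e4
    refine ⟨?_, e3, e4⟩
    rw [← Nat.div_add_mod n (k+1), ← Nat.div_add_mod n' (k+1), e1, e2]
  have hwv : ∀ x x' m m', m < 2*(b0+b') → m' < 2*(b0+b') → wv x m = wv x' m' → x = x' ∧ m = m' := by
    intro x x' m m' hm hm' he
    have h1 := hWinj (a₁ := (x, cw m)) (a₂ := (x', cw m')) he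
    simp only [Prod.mk.injEq] at h1
    have e4 : m % (2*(b0+b')) = m' % (2*(b0+b')) := congrArg Fin.val h1.2
    rw [Nat.mod_eq_of_lt hm, Nat.mod_eq_of_lt hm'] at e4
    exact ⟨h1.1, e4⟩
  obtain ⟨w, hw1, hw2, hw3, hw4⟩ := assemble hk hBC hsym (fun x hx => hx.H hs) M b' (fun _ => 0) (fun _ => hk) seg wv hseg hwv
    (fun n x m x' m' hn _ _ => hAW _ (hdiv n hn) _ _ _) (fun n hn f _ => hAG _ (hdiv n hn) _ _) (fun f _ => hWb _) hcard
  let c : (ℕ → Option (Fin k → V)) → ℕ → List V := fun o n => if n < M then core1 (A (n/(k+1))) z0 0 (o (n/(k+1))) (iF n) else []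
  let no : ℕ → Option (Fin k → V) := fun _ => none
  have hcmem : ∀ n v, v ∈ c no n → n < M ∧ ∃ x, v = seg n x 0 := by
    intro n v hv
    by_cases hn : n < M
    · simp only [c, if_pos hn] at hv
      obtain ⟨x, hx⟩ := core1_mem hv
      exact ⟨hn, x, hx.trans (by simp only [seg]; congr)⟩
    · simp [c, hn] at hv
  have hms : ∀ o, ((pre w (c o) M ++ w M : List V) : Multiset V) = ((pre w (c no) M ++ w M : List V) : Multiset V) + ∑ j ∈ range t, (o j).elim 0 (fun v => ∑ i, ({v i} : Multiset V)) := by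
    intro o
    have h1 : ∀ o, ∑ n ∈ range M, ((c o n : List V) : Multiset V) = ∑ j ∈ range t, ∑ i, ((core1 (A j) z0 0 (o j) i : List V) : Multiset V) := by
      intro o
      rw [hM, sum_blocks]
      refine Finset.sum_congr rfl fun j hj => Finset.sum_congr rfl fun i _ => ?_
      have hj := Finset.mem_range.1 hj
      have hlt : j * (k+1) + i < M := by
        have : (j+1)*(k+1) ≤ t*(k+1) := Nat.mul_le_mul_right _ hj
        have := i.2; rw [hM]; linarith
      have e1 : (j * (k+1) + i.1) / (k+1) = j := by
        rw [Nat.mul_comm, Nat.mul_add_div (by omega), Nat.div_eq_of_lt i.2]; rfl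
      have e2 : iF (j * (k+1) + i.1) = i := Fin.ext (by
        show (j * (k+1) + i.1) % (k+1) = i
        rw [Nat.mul_comm, Nat.mul_add_mod, Nat.mod_eq_of_lt i.2])
      simp only [c, if_pos hlt, e1, e2]
    rw [← Multiset.coe_add, ← Multiset.coe_add, pre_ms, pre_ms, Finset.sum_add_distrib, Finset.sum_add_distrib, h1, h1, Finset.sum_congr rfl fun j _ => core1_ms (A j) z0 0 (o j), Finset.sum_add_distrib]
    simp only [no]; abel
  have hnd : (pre w (c no) M ++ w M).Nodup := by
    have e : pre w (c no) M ++ w M = pre w (c no) (M+1) := by rw [pre_succ]; simp [c]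
    rw [e]
    refine pre_nodup _ _ _ (fun i hi => (hw1 i hi).1) (fun i hi => ?_) (fun i hi j hj v hv hv' => ?_) hw3 (fun i hi j hj hij v hv hv' => ?_)
    · by_cases h : i < M
      · simp only [c, if_pos h]
        exact core1_nodup (fun q q' he => (hAinj _ _ _ _ (hdiv i h) (hdiv i h) he).2) _
      · simp [c, h]
    · obtain ⟨h1, x, h2⟩ := hcmem j v hv'
      exact (hw2 i hi v hv).1 j h1 x h2
    · obtain ⟨h1, x, h2⟩ := hcmem i v hv
      obtain ⟨h1', x', h2'⟩ := hcmem j v hv'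
      exact hij (hseg _ _ _ _ _ _ h1 h1' (by omega) (by omega) (h2.symm.trans h2')).1
  have hmemQ : ∀ v, v ∈ pre w (c no) M ++ w M → (∃ i < M+1, v ∈ w i) ∨ ∃ n < M, ∃ x, v = seg n x 0 := by
    intro v hv
    rcases List.mem_append.1 hv with h | h
    · obtain ⟨i, hi, h⟩ := List.mem_flatMap.1 h
      have hi := List.mem_range.1 hi
      rcases List.mem_append.1 h with h | h
      · exact Or.inl ⟨i, by omega, h⟩
      · exact Or.inr ⟨i, (hcmem i v h).1, (hcmem i v h).2⟩
    · exact Or.inl ⟨M, by omega, h⟩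
  let off : Bool → ℕ := fun a => if a then 2*b0+b' else 2*b0
  have hoff : ∀ a, (a = true ∧ off a = 2*b0+b') ∨ (a = false ∧ off a = 2*b0) := by intro a; cases a <;> simp [off]
  let W : Bool → Fin k → Fin b' → V := fun a x m => wv x (off a + m)
  refine ⟨(pre w (c no) M ++ w M).toFinset, W, ?_, ⟨?_, fun a f => hWb _, ?_⟩, ?_⟩
  · rw [List.toFinset_card_of_nodup hnd, ← Multiset.coe_card, ← Multiset.coe_add, pre_ms, Multiset.card_add, Multiset.card_sum]
    have h1 : ∀ n ∈ range M, Multiset.card (((w n : List V) : Multiset V) + ((c no n : List V) : Multiset V)) ≤ ℓ + k := by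
      intro n hn
      have hn := Finset.mem_range.1 hn
      rw [Multiset.card_add, Multiset.coe_card, Multiset.coe_card]
      refine Nat.add_le_add (hw1 n (by omega)).2.1 ?_
      simp only [c, if_pos hn]
      refine Fin.cases ?_ (fun i => ?_) (iF n) <;> simp [core1, no]
    have h2 := Finset.sum_le_sum h1
    have h3 : Multiset.card ((w M : List V) : Multiset V) ≤ ℓ := (hw1 M (by omega)).2.1
    rw [Finset.sum_const, card_range, smul_eq_mul] at h2
    nlinarith
  · intro a a' j j' m m' he
    have h1 := m.2
    have h2 := m'.2
    rcases hoff a with ⟨e1, e2⟩ | ⟨e1, e2⟩ <;> rcases hoff a' with ⟨e1', e2'⟩ | ⟨e1', e2'⟩ <;>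
      obtain ⟨g1, g2⟩ := hwv j j' (off a + m) (off a' + m') (by omega) (by omega) he
    · exact ⟨by rw [e1, e1'], g1, Fin.ext (by omega)⟩
    · omega
    · omega
    · exact ⟨by rw [e1, e1'], g1, Fin.ext (by omega)⟩
  · intro a j m hm
    have h1 := m.2
    rcases hmemQ _ (List.mem_toFinset.1 hm) with ⟨i, hi, h⟩ | ⟨n, hn, x, h⟩
    · have := (hw2 i hi _ h).2 j m h1
      rcases hoff a with ⟨e1, e2⟩ | ⟨e1, e2⟩
      · exact this.2 (by simp only [W, e2])
      · exact this.1 (by simp only [W, e2])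
    · exact hAW _ (hdiv n hn) _ _ _ h.symm
  · intro L p hL hLp hp
    obtain ⟨Lf, hLf⟩ := split_tuples L p k hLp
    obtain ⟨φ, hφ1, hφ2⟩ := hall_assign (fun a (j : Fin t) => AGood H s z0 0 (Lf a) (A j)) (fun a => hp _)
    obtain ⟨o, ho1, ho2⟩ := assign_opt Lf φ hφ1
    have hQ := hms o
    rw [ho2, hLf] at hQ
    refine ⟨pre w (c o) M ++ w M, ?_, ?_, fun f f' => ?_⟩
    · rw [← Multiset.coe_nodup, hQ, Multiset.nodup_add]
      refine ⟨Multiset.coe_nodup.2 hnd, L.nodup, ?_⟩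
      rw [Multiset.disjoint_left]
      intro v hv hv'
      exact Finset.disjoint_left.1 hL hv' (List.mem_toFinset.2 hv)
    · ext v
      rw [List.mem_toFinset, ← Multiset.mem_coe, hQ, Multiset.mem_add, Finset.mem_union, List.mem_toFinset]; rfl
    · refine (hw4 (c o) (fun n hn g g' _ _ => ?_)).2.2.2 f f'
      simp only [c, if_pos hn]
      refine core1_TP hk hs hsym _ z0 0 _ (hAG _ (hdiv n hn)) (fun v hv => ?_) (iF n) (fun x => cl (g x)) (fun x => cl (g' x))
      obtain ⟨a, h1, rfl⟩ := ho1 _ _ hv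
      rw [← h1]; exact hφ2 a
end
end TH

open Finset
set_option linter.all false
namespace TH
open scoped Classical
noncomputable section

lemma AP0 (k s b0 ℓ : ℕ) (γ c : ℝ) (hk : 0 < k) (hs : 0 < s) (hb0 : 0 < b0) (hγ : 0 < γ) (hc : 0 < c) (z0 : Fin k) : ∀ σ > (0:ℝ), ∃ β > (0:ℝ), ∀ b' : ℕ, ∃ n0 : ℕ, ∀ (V : Type) [Finite V], n0 ≤ Nat.card V →
    ∀ H : (Fin k → V) → Prop, Sym H → BC H (G H s) b0 ℓ γ → (∀ v, c ≤ pr (AGood (N := 2*b0+1) H s z0 0 v)) → ∃ (Z : Finset V) (W : Bool → Fin k → Fin b' → V), (#Z:ℝ) ≤ σ * Nat.card V ∧ AbsOut H s b' Z W ∧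
      ∀ L : Finset V, Disjoint L Z → (#L:ℝ) ≤ β * Nat.card V → k ∣ #L → Absorbs H Z W L := by
  intro σ hσ
  have hkr : (1:ℝ) ≤ k := by exact_mod_cast hk
  set q := (k+1)*(k*(2*b0+1)) with hq
  have hq0 : 0 < q := by positivity
  have hqr : (1:ℝ) ≤ q := by exact_mod_cast hq0
  set C1 : ℝ := k + 2*k*b0 + ℓ with hC1
  have hC1p : 0 < C1 := by positivity
  obtain ⟨τ, hτ, t1, t2, t3, t4⟩ : ∃ τ > (0:ℝ), τ ≤ c / (32 * (q:ℝ)^2) ∧ τ ≤ γ / (2*(k+1)*C1) ∧ τ ≤ σ / (2*(k+1)*C1) ∧ τ ≤ c / (2*k*q) :=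
    ⟨min (min (c / (32 * (q:ℝ)^2)) (γ / (2*(k+1)*C1))) (min (σ / (2*(k+1)*C1)) (c / (2*k*q))), by
      refine lt_min (lt_min ?_ ?_) (lt_min ?_ ?_) <;> positivity,
      (min_le_left _ _).trans (min_le_left _ _), (min_le_left _ _).trans (min_le_right _ _), (min_le_right _ _).trans (min_le_left _ _), (min_le_right _ _).trans (min_le_right _ _)⟩
  rw [le_div_iff₀ (by positivity)] at t2 t3 t4
  obtain ⟨n3, hn3⟩ := family k q c hc hq0 τ hτ t1
  refine ⟨c*τ/4, by positivity, fun b' => ?_⟩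
  obtain ⟨n4, hn4⟩ := wblock k (2*(b0+b')) c hc
  set C2 : ℝ := k*(2*(b0+b')) + (2*k*b0+ℓ) with hC2
  obtain ⟨n5, hn5⟩ := exists_nat_gt (C2*2/γ)
  obtain ⟨n6, hn6⟩ := exists_nat_gt (C2*2/σ)
  refine ⟨n3+n4+n5+n6+1, fun V _ hV H hsym hBC hden => ?_⟩
  set n := Nat.card V with hn
  have hnp : 0 < n := by omega
  have hnr : (0:ℝ) < n := by exact_mod_cast hnp
  haveI : Nonempty V := (Nat.card_pos_iff.1 hnp).1
  obtain ⟨t, A, ht, hAinj, hAv, hAcnt⟩ := hn3 V (Fin (k+1) × Fin k × Fin (2*b0+1)) (by simp [hq]) (by omega) (fun v A => AGood H s z0 0 v A) hden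
  have hG : c ≤ pr (G H s) := by
    refine (hden (fun _ => Classical.arbitrary V)).trans ?_
    have h1 := pr_marg (V := V) (fun x : Fin k => ((0, x, 0) : Fin (k+1) × Fin k × Fin (2*b0+1))) (fun x y h => by simpa using h) (G H s)
    rw [← h1]
    exact pr_mono fun A hA => hA.1 0 fun _ => 0
  let Zf : Finset V := univ.image fun p : Fin t × (Fin (k+1) × Fin k × Fin (2*b0+1)) => A p.1 p.2
  have hZf : (#Zf:ℝ) ≤ t * q := by
    have : #Zf ≤ t * q := card_image_le.trans (by rw [card_univ]; simp [hq])
    exact_mod_cast this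
  obtain ⟨Wb, hW1, hW2, hW3⟩ := hn4 V (by omega) (G H s) hG Zf (by
    rw [← mul_div_assoc, div_le_iff₀ hnr]
    have : (k:ℝ) * #Zf ≤ k * ((τ * n) * q) := by gcongr; exact hZf.trans (by gcongr)
    have := mul_le_mul_of_nonneg_right t4 hnr.le
    linarith)
  let A' : ℕ → Fin (k+1) × Fin k × Fin (2*b0+1) → V := fun j => if h : j < t then A ⟨j, h⟩ else fun _ => Classical.arbitrary V
  have hA' : ∀ j (h : j < t), A' j = A ⟨j, h⟩ := fun j h => by simp [A', h]
  have h5 : C2 ≤ γ * n / 2 := by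
    rw [div_lt_iff₀ hγ] at hn5
    have : (n5:ℝ) ≤ n := by exact_mod_cast (by omega : n5 ≤ n)
    have := mul_le_mul_of_nonneg_right this hγ.le
    linarith
  have h6 : C2 ≤ σ * n / 2 := by
    rw [div_lt_iff₀ hσ] at hn6
    have : (n6:ℝ) ≤ n := by exact_mod_cast (by omega : n6 ≤ n)
    have := mul_le_mul_of_nonneg_right this hσ.le
    linarith
  have h7 : (t:ℝ) * ((k+1) * C1) ≤ γ * n / 2 := by
    have : (t:ℝ) * ((k+1) * C1) ≤ τ * n * ((k+1) * C1) := by gcongr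
    have := mul_le_mul_of_nonneg_right t2 hnr.le
    linarith
  have h8 : (t:ℝ) * ((k+1) * C1) ≤ σ * n / 2 := by
    have : (t:ℝ) * ((k+1) * C1) ≤ τ * n * ((k+1) * C1) := by gcongr
    have := mul_le_mul_of_nonneg_right t3 hnr.le
    linarith
  obtain ⟨Z, W, g1, g2, g3⟩ := AP_det (t := t) (b' := b') hk hs hb0 hsym hBC A'
    (by
      intro j j' p p' hj hj' he
      rw [hA' j hj, hA' j' hj'] at he
      have := hAinj (a₁ := (⟨j, hj⟩, p)) (a₂ := (⟨j', hj'⟩, p')) he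
      simpa using this)
    (by
      intro j hj i f
      rw [hA' j hj]
      obtain ⟨v, hv⟩ := hAv ⟨j, hj⟩
      exact hv.1 i f) Wb hW1 hW2
    (by
      intro j hj p x m he
      rw [hA' j hj] at he
      exact hW3 x m (he ▸ Finset.mem_image.2 ⟨(⟨j, hj⟩, p), mem_univ _, rfl⟩)) z0
    (by
      refine le_trans (le_of_eq ?_) (by linarith : (t:ℝ) * ((k+1) * C1) + C2 ≤ γ * n)
      rw [hC1, hC2]; push_cast; ring)
  refine ⟨Z, W, ?_, g2, fun L hL1 hL2 hL3 => ?_⟩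
  · have g1' : (#Z:ℝ) ≤ ((t*(k+1)*k + (t*(k+1)+1)*ℓ : ℕ):ℝ) := by exact_mod_cast g1
    push_cast at g1'
    have e1 : (0:ℝ) ≤ t * (k+1) * (2*k*b0) := by positivity
    have e2 : (0:ℝ) ≤ k*(2*(b0+b')) + 2*k*b0 := by positivity
    rw [hC1] at h8; rw [hC2] at h6
    linarith
  · obtain ⟨p, hpk⟩ := hL3
    refine g3 L p hL1 (by rw [hpk, Nat.mul_comm]) fun v => ?_
    have h9 : (p:ℝ) ≤ #{j : Fin t | AGood H s z0 0 v (A j)} := by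
      refine le_trans ?_ (hAcnt v)
      refine le_trans ?_ hL2
      rw [hpk]; exact_mod_cast Nat.le_mul_of_pos_left p hk
    have h10 : #{j : Fin t | AGood H s z0 0 v (A j)} = #{j : Fin t | AGood H s z0 0 v (A' j)} := by
      congr 1; ext j; simp only [mem_filter, mem_univ, true_and, hA' j.1 j.2]
    rw [← h10]; exact_mod_cast h9

lemma AP (d r : ℕ) (δ ν ξ : ℝ) (hp : Par d r δ ν) (hξ : 0 < ξ) : ∃ s0 : ℕ, ∀ s ≥ s0, ∀ σ > (0:ℝ), ∃ β > (0:ℝ), ∀ b' : ℕ, ∃ n0 : ℕ, ∀ (V : Type) [Finite V], n0 ≤ Nat.card V →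
    ∀ H : (Fin (d+r) → V) → Prop, Host d r (δ + ξ) H → ∃ (Z : Finset V) (W : Bool → Fin (d+r) → Fin b' → V), (#Z:ℝ) ≤ σ * Nat.card V ∧ AbsOut H s b' Z W ∧
      ∀ L : Finset V, Disjoint L Z → (#L:ℝ) ≤ β * Nat.card V → (d+r) ∣ #L → Absorbs H Z W L := by
  obtain ⟨s1, hs1⟩ := BlockConnect d r δ ν ξ hp hξ
  obtain ⟨s2, hs2⟩ := abs_dens d r δ ν ξ hp hξ (Fin.castAdd r ⟨0, hp.hd⟩) rfl
  refine ⟨s1+s2+1, fun s hs σ hσ => ?_⟩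
  obtain ⟨b0, hb0, ℓ, γ, hγ, n1, hn1⟩ := hs1 s (by omega)
  obtain ⟨c, hc, n2, hn2⟩ := hs2 s (by omega) (2*b0+1) 0
  obtain ⟨β, hβ, h⟩ := AP0 (d+r) s b0 ℓ γ c (by have := hp.hd; omega) (by omega) hb0 hγ hc (Fin.castAdd r ⟨0, hp.hd⟩) σ hσ
  refine ⟨β, hβ, fun b' => ?_⟩
  obtain ⟨n0, hn0⟩ := h b'
  exact ⟨n0+n1+n2, fun V _ hV H hH => hn0 V (by omega) H (fun x σ h => hH.sym x σ h) (hn1 V (by omega) H hH) (hn2 V (by omega) H hH)⟩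
end
end TH

open Finset
set_option linter.all false
namespace TH
open scoped Classical
noncomputable section

lemma tile_rows {U : Type} {k b : ℕ} (Y : Fin k → Fin b → U) (hY : ∀ x x' m m', Y x m = Y x' m' → x = x' ∧ m = m') (D : Finset U) :
    ∃ R : List (Fin k → U), (∀ a ∈ R, ∀ j, ∃ m, a j = Y j m) ∧ (R.flatMap fun a => List.ofFn a).Nodup ∧
      (∀ v ∈ R.flatMap (fun a => List.ofFn a), v ∉ D ∧ ∃ x m, v = Y x m) ∧ (R.flatMap fun a => List.ofFn a).length = R.length * k ∧
      b ≤ R.length + #{v ∈ D | ∃ x m, v = Y x m} := by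
  set u := #{v ∈ D | ∃ x m, v = Y x m} with hu
  have hF : ∀ x, b ≤ #{c : Fin b | Y x c ∉ D} + u := by
    intro x
    have h1 : #{c : Fin b | Y x c ∈ D} ≤ u := by
      refine Finset.card_le_card_of_injOn (Y x) (fun c hc => ?_) (fun c _ c' _ h => (hY _ _ _ _ h).2)
      simp only [coe_filter, Set.mem_setOf_eq, mem_univ, true_and] at hc ⊢
      exact ⟨hc, x, c, rfl⟩
    have h2 := Finset.card_filter_add_card_filter_not (s := (univ : Finset (Fin b))) (fun c => Y x c ∈ D)
    simp only [card_univ, Fintype.card_fin] at h2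
    omega
  have hE : ∀ x, ∃ e : Fin (b-u) → Fin b, Function.Injective e ∧ ∀ i, Y x (e i) ∉ D := by
    intro x
    have : Nonempty (Fin (b-u) ↪ {c : Fin b // Y x c ∉ D}) := by
      apply Function.Embedding.nonempty_of_card_le
      rw [Fintype.card_fin, Fintype.card_subtype]
      have := hF x; omega
    obtain ⟨e⟩ := this
    exact ⟨fun i => (e i).1, fun i j h => e.injective (Subtype.ext h), fun i => (e i).2⟩
  choose e he heD using hE
  refine ⟨List.ofFn fun i : Fin (b-u) => fun x => Y x (e x i), ?_, ?_, ?_, ?_, ?_⟩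
  · intro a ha j
    obtain ⟨i, rfl⟩ := (List.mem_ofFn' _ _).1 ha
    exact ⟨_, rfl⟩
  · refine List.nodup_flatMap.2 ⟨fun a ha => ?_, ?_⟩
    · obtain ⟨i, rfl⟩ := (List.mem_ofFn' _ _).1 ha
      exact List.nodup_ofFn.2 fun x x' h => (hY _ _ _ _ h).1
    · refine List.pairwise_ofFn.2 fun i j hij v hv hv' => ?_
      obtain ⟨x, rfl⟩ := (List.mem_ofFn' _ _).1 hv
      obtain ⟨x', h⟩ := (List.mem_ofFn' _ _).1 hv'
      obtain ⟨rfl, h2⟩ := hY _ _ _ _ h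
      exact hij.ne' (he _ h2)
  · intro v hv
    obtain ⟨a, ha, hv⟩ := List.mem_flatMap.1 hv
    obtain ⟨i, rfl⟩ := (List.mem_ofFn' _ _).1 ha
    obtain ⟨x, rfl⟩ := (List.mem_ofFn' _ _).1 hv
    exact ⟨heD _ _, x, _, rfl⟩
  · generalize (List.ofFn fun i : Fin (b-u) => fun x => Y x (e x i)) = R
    induction R with
    | nil => simp
    | cons a R ih => rw [List.flatMap_cons, List.length_append, ih, List.length_ofFn, List.length_cons]; ring
  · rw [List.length_ofFn]; omega

lemma cyc_det {U : Type} [Finite U] {k : ℕ} (hk : 0 < k) {H Gd : (Fin k → U) → Prop} {b0 ℓ b : ℕ} {γ : ℝ} (hBC : BC H Gd b0 ℓ γ) (hs : Sym H) (hGH : ∀ x, Gd x → H x)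
    (hb : 2*b0+1 ≤ b) (M : ℕ) (Y : ℕ → Fin k → Fin b → U) (wv : Fin k → ℕ → U)
    (hY : ∀ n n' x x' m m', n < M → n' < M → Y n x m = Y n' x' m' → n = n' ∧ x = x' ∧ m = m')
    (hwv : ∀ x x' m m', m < 2*b0 → m' < 2*b0 → wv x m = wv x' m' → x = x' ∧ m = m')
    (hdis : ∀ n x m x' m', n < M → m' < 2*b0 → Y n x m ≠ wv x' m')
    (bY : ∀ n < M, Blk Gd (Y n))
    (bwv : ∀ f : Fin k → ℕ, (∀ x, f x < 2*b0) → Gd fun x => wv x (f x))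
    (hcard : ((M * k + k * (2*b0) : ℕ):ℝ) + (M+1 : ℕ) * (2 * k * b0 + ℓ) ≤ γ * Nat.card U) :
    ∃ l : List U, l.Nodup ∧ TP H l ∧ (∃ (f : Fin k → Fin b0) (m : List U), l = List.ofFn (fun j => wv j (f j)) ++ m) ∧
      (∃ (f : Fin k → Fin b0) (m : List U), l = m ++ List.ofFn (fun j => wv j (b0 + f j))) ∧ l.length % k = Nat.card U % k ∧
      M * k * b ≤ l.length + k * ((M+1) * ℓ) := by
  have hb0 : 0 < b := by omega
  obtain ⟨w, hw, -, hww, hc⟩ := assemble hk hBC hs hGH M 0 (fun i => if i = 0 then Nat.card U % k else 0)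
    (fun i => by split_ifs; exacts [Nat.mod_lt _ hk, hk])
    (fun n x m => Y n x ⟨m % b, Nat.mod_lt _ hb0⟩) wv
    (fun n n' x x' m m' hn hn' hm hm' h => by
      obtain ⟨h1, h2, h3⟩ := hY _ _ _ _ _ _ hn hn' h
      have h3 := congrArg Fin.val h3
      simp only at h3
      rw [Nat.mod_eq_of_lt (by omega), Nat.mod_eq_of_lt (by omega)] at h3
      exact ⟨h1, h2, h3⟩)
    (fun x x' m m' h h' => hwv x x' m m' (by omega) (by omega))
    (fun n x m x' m' hn hm hm' => hdis n x _ x' m' hn (by omega))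
    (fun n hn f hf => bY n hn fun x => ⟨f x % b, Nat.mod_lt _ hb0⟩)
    (fun f hf => bwv f fun x => by have := hf x; omega) (by simpa using hcard)
  set D : Finset U := (range (M+1)).biUnion fun i => (w i).toFinset with hD
  have hDc : #D ≤ (M+1) * ℓ := by
    refine (Finset.card_biUnion_le).trans ?_
    refine (Finset.sum_le_card_nsmul _ _ ℓ fun i hi => ?_).trans (by simp)
    exact (List.toFinset_card_le _).trans (hw i (mem_range.1 hi)).2.1
  have hR : ∀ n, ∃ R : List (Fin k → U), n < M → ((∀ a ∈ R, ∀ j, ∃ m, a j = Y n j m) ∧ (R.flatMap fun a => List.ofFn a).Nodup ∧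
      (∀ v ∈ R.flatMap (fun a => List.ofFn a), v ∉ D ∧ ∃ x m, v = Y n x m) ∧ (R.flatMap fun a => List.ofFn a).length = R.length * k ∧
      b ≤ R.length + #{v ∈ D | ∃ x m, v = Y n x m}) := by
    intro n
    by_cases hn : n < M
    · obtain ⟨R, h⟩ := tile_rows (Y n) (fun x x' m m' h => (hY n n x x' m m' hn hn h).2) D
      exact ⟨R, fun _ => h⟩
    · exact ⟨[], fun h => absurd h hn⟩
  choose R hR using hR
  let c : ℕ → List U := fun n => if n < M then (R n).flatMap (fun a => List.ofFn a) else []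
  have hcn : ∀ n < M, c n = (R n).flatMap (fun a => List.ofFn a) := fun n hn => by simp [c, hn]
  have hcm : ∀ n, ∀ v ∈ c n, n < M ∧ v ∉ D ∧ ∃ x m, v = Y n x m := by
    intro n v hv
    by_cases hn : n < M
    · rw [hcn n hn] at hv; exact ⟨hn, (hR n hn).2.2.1 v hv⟩
    · simp [c, hn] at hv
  obtain ⟨h1, h2, h3, -⟩ := hc c (by
    intro n hn f f' hf hf'
    have := TP_rows hk hs (fun j => {v | ∃ m, v = Y n j m}) (fun x hx => by
      choose m hm using hx
      have := hGH _ (bY n hn m)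
      convert this using 2 with j
      exact hm j) ((fun x => Y n x ⟨f x % b, Nat.mod_lt _ hb0⟩) :: (R n ++ [fun x => Y n x ⟨f' x % b, Nat.mod_lt _ hb0⟩])) (by
      intro a ha j
      simp only [List.mem_cons, List.mem_append, List.not_mem_nil, or_false] at ha
      rcases ha with rfl | ha | rfl
      · exact ⟨_, rfl⟩
      · exact (hR n hn).1 a ha j
      · exact ⟨_, rfl⟩)
    rw [hcn n hn]
    simpa [List.flatMap_append] using this)
  have hpe : pre w c M ++ w M = pre w c (M+1) := by rw [pre_succ]; simp [c]
  have hlen : (pre w c M ++ w M).length = ∑ i ∈ range (M+1), ((w i).length + (c i).length) := by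
    have := congrArg Multiset.card (pre_ms w c (M+1))
    rw [hpe]
    simpa using this
  refine ⟨_, ?_, h1, h2, h3, ?_, ?_⟩
  · rw [hpe]
    refine pre_nodup w c (M+1) (fun i hi => (hw i hi).1) (fun i hi => ?_) (fun i hi j hj v hv hv' => ?_) hww (fun i hi j hj hij v hv hv' => ?_)
    · by_cases hn : i < M
      · rw [hcn i hn]; exact (hR i hn).2.1
      · simp [c, hn]
    · exact (hcm j v hv').2.1 (mem_biUnion.2 ⟨i, mem_range.2 hi, by simpa using hv⟩)
    · obtain ⟨hi', -, x, m, rfl⟩ := hcm i v hv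
      obtain ⟨hj', -, x', m', h⟩ := hcm j _ hv'
      exact hij (hY _ _ _ _ _ _ hi' hj' h).1
  · rw [hlen, Finset.sum_nat_mod]
    have : ∀ i ∈ range (M+1), ((w i).length + (c i).length) % k = if i = 0 then Nat.card U % k else 0 := by
      intro i hi
      have hz : (c i).length % k = 0 := by
        by_cases hn : i < M
        · rw [hcn i hn, (hR i hn).2.2.2.1]; simp
        · simp [c, hn]
      rw [Nat.add_mod, hz, (hw i (mem_range.1 hi)).2.2]
      split_ifs <;> simp
    rw [Finset.sum_congr rfl this, Finset.sum_ite_eq' ]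
    simp
  · have h5 : ∑ i ∈ range M, #{v ∈ D | ∃ x m, v = Y i x m} ≤ #D := by
      rw [← Finset.card_biUnion]
      · exact Finset.card_le_card (Finset.biUnion_subset.2 fun i _ => Finset.filter_subset _ _)
      · intro i hi j hj hij
        refine Finset.disjoint_left.2 fun v hv hv' => ?_
        obtain ⟨-, x, m, h⟩ := mem_filter.1 hv
        obtain ⟨-, x', m', h'⟩ := mem_filter.1 hv'
        exact hij (hY _ _ _ _ _ _ (mem_range.1 hi) (mem_range.1 hj) (h.symm.trans h')).1
    have h6 : ∑ i ∈ range M, k * b ≤ ∑ i ∈ range M, ((c i).length + k * #{v ∈ D | ∃ x m, v = Y i x m}) := by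
      refine Finset.sum_le_sum fun i hi => ?_
      have hi := mem_range.1 hi
      rw [hcn i hi, (hR i hi).2.2.2.1]
      calc k * b ≤ k * _ := Nat.mul_le_mul_left k (hR i hi).2.2.2.2
        _ = _ := by ring
    rw [Finset.sum_add_distrib] at h6
    have h7 : ∑ i ∈ range M, (c i).length ≤ (pre w c M ++ w M).length := by
      rw [hlen]
      calc _ ≤ ∑ i ∈ range (M+1), (c i).length := Finset.sum_le_sum_of_subset (Finset.range_subset_range.2 (by omega))
        _ ≤ _ := Finset.sum_le_sum fun i _ => by omega
    have h8 := Nat.mul_le_mul_left k (h5.trans hDc)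
    simp only [sum_const, card_range, smul_eq_mul] at h6
    rw [mul_assoc]
    exact h6.trans (add_le_add h7 (by rw [← Finset.mul_sum]; exact h8))
end
end TH

open Finset
set_option linter.all false
namespace TH
open scoped Classical
noncomputable section

lemma TP_map {U V : Type} {k : ℕ} {H : (Fin k → V) → Prop} (g : U → V) {l : List U} (h : TP (pull H g) l) : TP H (l.map g) := by
  intro i x hx
  have : ∀ t : Fin k, ∃ u, l[i+t.1]? = some u ∧ g u = x t := by
    intro t
    have := hx t
    rw [List.getElem?_map, Option.map_eq_some_iff] at this
    exact this
  choose u hu hu' using this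
  have := h i u hu
  have e : g ∘ u = x := funext hu'
  rw [← e]; exact this

lemma cyc_core {V : Type} [Finite V] {k : ℕ} (hk : 0 < k) {H : (Fin k → V) → Prop} (hs : Sym H) {b0 ℓ b s m : ℕ} {γ β u : ℝ} (hb0 : 0 < b0)
    {Z : Finset V} {W : Bool → Fin k → Fin b0 → V} (hW : AbsOut H s b0 Z W) {Gd : (Fin k → {v // v ∉ Z}) → Prop}
    (hBC : BC (pull H Subtype.val) Gd b0 ℓ γ) (hGH : ∀ x, Gd x → H (fun j => (x j).1)) (hb : 2*b0+1 ≤ b)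
    (hWG : ∀ (a : Fin k → Bool) (f : Fin k → Fin b0), Gd fun x => ⟨W (a x) x (f x), hW.2.2 _ _ _⟩)
    (Y : Fin m → Fin k → Fin b → {v // v ∉ Z}) (hY : Function.Injective (R3 Y)) (bY : ∀ t, Blk Gd (Y t))
    (hu : (1 - u) * Nat.card {v // v ∉ Z} ≤ m * k * b)
    (hn1 : ((m * k + k * (2*b0) : ℕ):ℝ) + (m+1 : ℕ) * (2 * k * b0 + ℓ) ≤ γ * Nat.card {v // v ∉ Z})
    (hn2 : u * Nat.card {v // v ∉ Z} + (2*(k*b0)) * (k*b) + k * ((m+1) * ℓ) ≤ β * Nat.card V)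
    (hAb : ∀ L : Finset V, Disjoint L Z → (#L:ℝ) ≤ β * Nat.card V → k ∣ #L → Absorbs H Z W L) :
    ∃ (lc : List V) (row : Fin k → V) (m' : List V), lc.Nodup ∧ (∀ v, v ∈ lc) ∧ lc = List.ofFn row ++ m' ∧ TP H (lc ++ List.ofFn row) := by
  have _ := Fintype.ofFinite V
  let w : Bool → Fin k → Fin b0 → {v // v ∉ Z} := fun a x c => ⟨W a x c, hW.2.2 _ _ _⟩
  have winj : ∀ s s' j j' c c', w s j c = w s' j' c' → s = s' ∧ j = j' ∧ c = c' := fun s s' j j' c c' h => hW.1 _ _ _ _ _ _ (congrArg Subtype.val h)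
  let wv : Fin k → ℕ → {v // v ∉ Z} := fun x n => if n < b0 then w true x ⟨n % b0, Nat.mod_lt _ hb0⟩ else w false x ⟨n % b0, Nat.mod_lt _ hb0⟩
  let bad : Finset (Fin m) := {t | ∃ x c a j i, Y t x c = w a j i}
  have hbad : #bad ≤ 2 * (k * b0) := by
    have : ∀ t : Fin m, ∃ p : Bool × Fin k × Fin b0, t ∈ bad → ∃ x c, Y t x c = w p.1 p.2.1 p.2.2 := by
      intro t
      by_cases ht : t ∈ bad
      · obtain ⟨x, c, a, j, i, h⟩ := (mem_filter.1 ht).2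
        exact ⟨(a, j, i), fun _ => ⟨x, c, h⟩⟩
      · exact ⟨(true, ⟨0, hk⟩, ⟨0, hb0⟩), fun h => absurd h ht⟩
    choose p hp using this
    have := Finset.card_le_card_of_injOn (s := bad) (t := univ) p (fun _ _ => mem_coe.2 (mem_univ _)) (fun t ht t' ht' h => by
      obtain ⟨x, c, h1⟩ := hp t ht
      obtain ⟨x', c', h2⟩ := hp t' ht'
      rw [h, ← h2] at h1
      exact congrArg Prod.fst (@hY (t, x, c) (t', x', c') h1))
    simpa using this
  let gd : Finset (Fin m) := {t | ¬ ∃ x c a j i, Y t x c = w a j i}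
  have hgm : #bad + #gd = m := by
    have := Finset.card_filter_add_card_filter_not (s := (univ : Finset (Fin m))) (fun t => ∃ x c a j i, Y t x c = w a j i)
    rw [card_univ, Fintype.card_fin] at this
    exact this
  set M := #gd with hM
  let e := gd.equivFin.symm
  let Y' : ℕ → Fin k → Fin b → {v // v ∉ Z} := fun n x c => if h : n < M then Y (e ⟨n, h⟩).1 x c else wv x 0
  have hY' : ∀ n (h : n < M) x c, Y' n x c = Y (e ⟨n, h⟩).1 x c := fun n h x c => by simp [Y', h]
  have hMm : M ≤ m := by omega
  have hMr : (M:ℝ) ≤ m := by exact_mod_cast hMm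
  obtain ⟨l, l1, l2, ⟨f, m1, l3⟩, ⟨f', m2, l4⟩, l5, l6⟩ := cyc_det hk hBC (fun x σ h => hs _ σ h) (fun x h => hGH x h) hb M Y' wv
    (by
      intro n n' x x' c c' hn hn' h
      rw [hY' n hn, hY' n' hn'] at h
      have := @hY (_, x, c) (_, x', c') h
      simp only [Prod.mk.injEq] at this
      have h1 := e.injective (Subtype.ext this.1)
      exact ⟨congrArg Fin.val h1, this.2.1, this.2.2⟩)
    (by
      intro x x' n n' hn hn' h
      have hm1 : ∀ n, n < 2*b0 → n % b0 = if n < b0 then n else n - b0 := by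
        intro n hn
        split_ifs with h
        · exact Nat.mod_eq_of_lt h
        · rw [Nat.mod_eq_sub_mod (by omega)]; exact Nat.mod_eq_of_lt (by omega)
      have q1 := hm1 n hn
      have q2 := hm1 n' hn'
      by_cases a1 : n < b0 <;> by_cases a2 : n' < b0 <;> simp only [wv, a1, a2, if_true, if_false] at h q1 q2 <;> have := winj _ _ _ _ _ _ h <;>
        simp only [Fin.mk.injEq, reduceCtorEq, false_and, true_and] at this <;> exact ⟨this.1, by omega⟩)
    (by
      intro n x c x' c' hn hc' h
      rw [hY' n hn] at h
      have := (mem_filter.1 (e ⟨n, hn⟩).2).2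
      apply this
      simp only [wv] at h
      split_ifs at h
      · exact ⟨_, _, _, _, _, h⟩
      · exact ⟨_, _, _, _, _, h⟩)
    (by
      intro n hn g
      have := bY (e ⟨n, hn⟩).1 g
      simp only [hY' n hn]; exact this)
    (by
      intro g hg
      have := hWG (fun x => decide (g x < b0)) (fun x => ⟨g x % b0, Nat.mod_lt _ hb0⟩)
      convert this using 2 with x
      by_cases h : g x < b0 <;> simp [wv, w, h])
    (by
      refine le_trans ?_ hn1
      push_cast
      gcongr)
  let Lu : Finset {v // v ∉ Z} := {v | v ∉ l}
  have hLu : #Lu + l.length = Nat.card {v // v ∉ Z} := by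
    have h1 := Finset.card_filter_add_card_filter_not (s := (univ : Finset {v // v ∉ Z})) (fun v => v ∈ l)
    have h2 : (univ.filter fun v => v ∈ l) = l.toFinset := by ext; simp
    rw [h2, List.toFinset_card_of_nodup l1, card_univ, ← Nat.card_eq_fintype_card] at h1
    rw [add_comm]
    convert h1
  let L : Finset V := Lu.map (Function.Embedding.subtype _)
  have hLc : #L = #Lu := card_map _
  have hmemL : ∀ v, v ∈ L ↔ ∃ h : v ∉ Z, (⟨v, h⟩ : {v // v ∉ Z}) ∉ l := by
    intro v; simp [L, Lu]
  obtain ⟨core, c1, c2, c3⟩ := hAb L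
    (Finset.disjoint_left.2 fun v hv hv' => by obtain ⟨h, -⟩ := (hmemL v).1 hv; exact h hv')
    (by
      refine le_trans ?_ hn2
      rw [hLc]
      have e1 : (#Lu:ℝ) + l.length = Nat.card {v // v ∉ Z} := by exact_mod_cast hLu
      have e2 : (M:ℝ) * k * b ≤ l.length + k * ((M+1) * ℓ) := by exact_mod_cast l6
      have e3 : (k:ℝ) * ((M+1) * ℓ) ≤ k * ((m+1)*ℓ) := by gcongr
      have e4 : (m:ℝ) ≤ 2*(k*b0) + M := by exact_mod_cast (by omega : m ≤ 2*(k*b0) + M)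
      have e5 : (m:ℝ) * (k*b) ≤ (2*(k*b0) + M) * (k*b) := by gcongr
      linarith)
    (by
      rw [hLc]
      have h1 : (#Lu + l.length) % k = (0 + l.length) % k := by rw [hLu, zero_add, l5]
      have h2 : #Lu ≡ 0 [MOD k] := Nat.ModEq.add_right_cancel' _ h1
      exact (Nat.modEq_zero_iff_dvd).1 h2)
  have r1 : ∀ j, (wv j (f j)).1 = W true j (f j) := by
    intro j
    have := (f j).2
    simp [wv, w, Nat.mod_eq_of_lt this]
  have r2 : ∀ j, (wv j (b0 + f' j)).1 = W false j (f' j) := by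
    intro j
    have := (f' j).2
    simp [wv, w, Nat.mod_eq_of_lt this]
  have m3 : l.map Subtype.val = List.ofFn (fun j => W true j (f j)) ++ m1.map Subtype.val := by
    rw [l3, List.map_append, List.map_ofFn]; congr 2; funext j; exact r1 j
  have m4 : l.map Subtype.val = m2.map Subtype.val ++ List.ofFn (fun j => W false j (f' j)) := by
    rw [l4, List.map_append, List.map_ofFn]; congr 2; funext j; exact r2 j
  refine ⟨l.map Subtype.val ++ core, fun j => W true j (f j), m1.map Subtype.val ++ core, ?_, ?_, ?_, ?_⟩
  · refine List.nodup_append'.2 ⟨l1.map Subtype.val_injective, c1, fun v hv hv' => ?_⟩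
    obtain ⟨v, hv2, rfl⟩ := List.mem_map.1 hv
    have := List.mem_toFinset.2 hv'
    rw [c2, mem_union] at this
    rcases this with h | h
    · exact v.2 h
    · obtain ⟨_, h'⟩ := (hmemL _).1 h
      exact h' hv2
  · intro v
    by_cases hv : v ∈ core
    · simp [hv]
    · have : v ∉ Z ∪ L := by rw [← c2]; simpa using hv
      rw [mem_union, not_or, hmemL, not_exists] at this
      have h2 := not_not.1 (this.2 this.1)
      exact List.mem_append_left _ (List.mem_map.2 ⟨_, h2, rfl⟩)
  · rw [m3, List.append_assoc]
  · have t1 := TP_map Subtype.val l2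
    rw [m4] at t1 ⊢
    have := TP_glue (b := core ++ List.ofFn fun j => W true j (f j)) (by simp) t1 (by rw [← List.append_assoc]; exact c3 f' f)
    simpa [List.append_assoc] using this
end
end TH

open Finset
set_option linter.all false
namespace TH
open scoped Classical
noncomputable section

lemma nums (k b0 ℓ : ℕ) (hk : 0 < k) (γ β : ℝ) (hγ : 0 < γ) (hβ : 0 < β) : ∃ b, 2*b0+1 ≤ b ∧ ∃ n0 : ℕ, ∀ (m N n : ℕ) (u : ℝ), m * k * b ≤ N → N ≤ n → n0 ≤ N → u ≤ β/4 →
    (((m * k + k * (2*b0) : ℕ):ℝ) + (m+1 : ℕ) * (2 * k * b0 + ℓ) ≤ γ * N) ∧ (u * N + (2*(k*b0)) * (k*b) + k * ((m+1) * ℓ) ≤ β * n) := by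
  obtain ⟨b1, hb1⟩ := exists_nat_gt (2 * (k + 2*k*b0+ℓ) / γ)
  obtain ⟨b2, hb2⟩ := exists_nat_gt (4 * ℓ / β)
  refine ⟨2*b0+1+b1+b2, by omega, ?_⟩
  set b := 2*b0+1+b1+b2 with hb
  obtain ⟨n1, hn1⟩ := exists_nat_gt (2 * (k*(2*b0) + (2*k*b0+ℓ)) / γ)
  obtain ⟨n2, hn2⟩ := exists_nat_gt (4 * (2*(k*b0) * (k*b)) / β)
  obtain ⟨n3, hn3⟩ := exists_nat_gt (4 * (k*ℓ) / β)
  refine ⟨n1+n2+n3, fun m N n u hm hNn hN hu => ?_⟩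
  rw [div_lt_iff₀ hγ] at hb1 hn1
  rw [div_lt_iff₀ hβ] at hb2 hn2 hn3
  have hkr : (1:ℝ) ≤ k := by exact_mod_cast hk
  have c1 : (b1:ℝ) ≤ b := by exact_mod_cast (by omega : b1 ≤ b)
  have c2 : (b2:ℝ) ≤ b := by exact_mod_cast (by omega : b2 ≤ b)
  have c3 : (n1:ℝ) ≤ N := by exact_mod_cast (by omega : n1 ≤ N)
  have c4 : (n2:ℝ) ≤ N := by exact_mod_cast (by omega : n2 ≤ N)
  have c5 : (n3:ℝ) ≤ N := by exact_mod_cast (by omega : n3 ≤ N)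
  have c6 : (N:ℝ) ≤ n := by exact_mod_cast hNn
  have hmr : (m:ℝ) * (k * b) ≤ N := by rw [← mul_assoc]; exact_mod_cast hm
  have hmb : (m:ℝ) * b ≤ N := by
    refine le_trans ?_ hmr
    have : (0:ℝ) ≤ b := Nat.cast_nonneg _
    gcongr
    exact le_mul_of_one_le_left this hkr
  have e1 : 2 * (k + 2*k*b0+ℓ) ≤ (b:ℝ) * γ := hb1.le.trans (by gcongr)
  have e2 : 4 * ℓ ≤ (b:ℝ) * β := hb2.le.trans (by gcongr)
  have e3 : (m:ℝ) * (2 * (k + 2*k*b0+ℓ)) ≤ m * (b * γ) := by gcongr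
  have e4 : (m:ℝ) * b * γ ≤ N * γ := by gcongr
  have e5 : (n1:ℝ) * γ ≤ N * γ := by gcongr
  have e6 : (n2:ℝ) * β ≤ n * β := mul_le_mul_of_nonneg_right (c4.trans c6) hβ.le
  have e7 : (n3:ℝ) * β ≤ n * β := mul_le_mul_of_nonneg_right (c5.trans c6) hβ.le
  have e8 : (m:ℝ) * k * (4 * ℓ) ≤ m * k * (b * β) := by gcongr
  have e9 : (m:ℝ) * (k * b) * β ≤ n * β := by gcongr; exact hmr.trans c6
  have e10 : u * N ≤ β/4 * n := by
    calc u * N ≤ β/4 * N := by gcongr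
      _ ≤ _ := by gcongr
  constructor
  · push_cast
    linarith
  · linarith

lemma cycle (d r : ℕ) (δ ν ξ : ℝ) (hp : Par d r δ ν) (hξ : 0 < ξ) : ∃ n0 : ℕ, ∀ (V : Type) [Finite V], n0 ≤ Nat.card V →
    ∀ H : (Fin (d+r) → V) → Prop, Host d r (δ + ξ) H →
    ∃ (lc : List V) (row : Fin (d+r) → V) (m' : List V), lc.Nodup ∧ (∀ v, v ∈ lc) ∧ lc = List.ofFn row ++ m' ∧ TP H (lc ++ List.ofFn row) := by
  have hξ2 : 0 < ξ/2 := by positivity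
  have hk : 0 < d + r := by have := hp.hd; omega
  have hr : (0:ℝ) < r := by exact_mod_cast hp.hr
  obtain ⟨s1, hs1⟩ := AP d r δ ν ξ hp hξ
  obtain ⟨s2, hs2⟩ := G_mono d r δ ν (ξ/2) hp hξ2
  obtain ⟨s, hs⟩ : ∃ s, s = s1+s2+1 := ⟨_, rfl⟩
  have hspos : (0:ℝ) < s := by exact_mod_cast (by omega : 0 < s)
  let σ : ℝ := min (1/2) (min (ξ/(2*r)) (1 / (2 * (s:ℝ)^(d+r+1)) / s))
  have hσ : 0 < σ := by simp only [σ, lt_min_iff]; exact ⟨by norm_num, by positivity, by positivity⟩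
  have σ1 : σ ≤ 1/2 := min_le_left _ _
  have σ2 : σ ≤ ξ/(2*r) := (min_le_right _ _).trans (min_le_left _ _)
  have σ3 : σ ≤ 1 / (2 * (s:ℝ)^(d+r+1)) / s := (min_le_right _ _).trans (min_le_right _ _)
  obtain ⟨β, hβ, hAP⟩ := hs1 s (by omega) σ hσ
  let ε : ℝ := min (1/80) (β/164)
  have hε : 0 < ε := by simp only [ε, lt_min_iff]; exact ⟨by norm_num, by positivity⟩
  have ε1 : ε ≤ 1/80 := min_le_left _ _
  have ε2 : 41 * ε ≤ β/4 := by have : ε ≤ β/164 := min_le_right _ _; linarith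
  obtain ⟨s3, hs3⟩ := BlockConnect d r δ ν (ξ/2) hp hξ2
  obtain ⟨s4, hs4⟩ := FracG d r δ ν (ξ/2) hp hξ2 ε hε
  obtain ⟨s5, hs5⟩ := Sz_ev d r hp.hν
  obtain ⟨s', hs'⟩ : ∃ s', s' = 4*s+s3+s4+s5+1 := ⟨_, rfl⟩
  obtain ⟨b0, hb0, ℓ, γ, hγ, n1, hn1⟩ := hs3 s' (by omega)
  obtain ⟨n2, hn2⟩ := hs4 s' (by omega)
  obtain ⟨n3, hn3⟩ := hs2 s (by omega) s' (by omega)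
  obtain ⟨b, hb, n4, hn4⟩ := nums (d+r) b0 ℓ hk γ β hγ hβ
  obtain ⟨n5, hn5⟩ := cover (d+r) (d+r+s') (by omega) hε ε1 b (by omega)
  obtain ⟨n6, hn6⟩ := hAP b0
  refine ⟨n6 + 2*(n1+n2+n3+n4+n5)+1, fun V _ hV H hH => ?_⟩
  have _ := Fintype.ofFinite V
  have hne : Nonempty V := (Nat.card_pos_iff.1 (by omega : 0 < Nat.card V)).1
  obtain ⟨Z, W, hZ, hW, hAb⟩ := hn6 V (by omega) H hH
  have hnr : (0:ℝ) < Nat.card V := by exact_mod_cast (by omega : 0 < Nat.card V)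
  have hcU : (Nat.card {v // v ∉ Z} : ℝ) = Nat.card V - #Z := by
    rw [Nat.card_eq_fintype_card, Fintype.card_subtype_compl, Nat.card_eq_fintype_card, Fintype.card_coe, Nat.cast_sub (Finset.card_le_univ Z)]
  have hcUV : Nat.card {v // v ∉ Z} ≤ Nat.card V := Nat.card_le_card_of_injective _ Subtype.val_injective
  have hq : ((Nat.card V:ℝ) - Nat.card {v // v ∉ Z}) / Nat.card V ≤ σ := by
    rw [div_le_iff₀ hnr, hcU]; linarith
  have hN : n1+n2+n3+n4+n5 ≤ Nat.card {v // v ∉ Z} := by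
    have h1 : ((2*(n1+n2+n3+n4+n5):ℕ):ℝ) ≤ Nat.card V := by exact_mod_cast (by omega)
    have h2 : σ * Nat.card V ≤ 1/2 * Nat.card V := by gcongr
    have : ((n1+n2+n3+n4+n5:ℕ):ℝ) ≤ Nat.card {v // v ∉ Z} := by
      rw [hcU]; push_cast at h1 ⊢; linarith
    exact_mod_cast this
  have hH' : Host d r (δ + ξ/2) (pull H (Subtype.val : {v // v ∉ Z} → V)) := by
    have := Host_restrict hH (Subtype.val : {v // v ∉ Z} → V) Subtype.val_injective (η := ξ/2) (by
      calc (r:ℝ) * _ ≤ r * (ξ/(2*r)) := mul_le_mul_of_nonneg_left (hq.trans σ2) hr.le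
        _ = ξ/2 := by field_simp)
    convert this using 1; ring
  have hs'pos : 0 < s' := by omega
  obtain ⟨m, Y, y1, y2, y3⟩ := hn5 {v // v ∉ Z} (by omega) (G (pull H Subtype.val) s') (fun x hx => hH'.inj _ (G.H hs'pos hx))
    (le_trans (pr_mono fun R hR => fun hh => hR (FracG_pfm hp (hs5 s' (by omega)) hH'.inj hh.1 hh.2)) (hn2 {v // v ∉ Z} (by omega) _ hH'))
  have hmN : m * (d+r) * b ≤ Nat.card {v // v ∉ Z} := by
    have := Nat.card_le_card_of_injective _ y1
    simpa [mul_assoc] using this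
  obtain ⟨q1, q2⟩ := hn4 m _ _ (41*ε) hmN hcUV (by omega) ε2
  refine cyc_core hk hH.sym hb0 hW (hn1 _ (by omega) _ hH') (Gd := G (pull H Subtype.val) s') (fun x hx => (G.H hs'pos hx : pull H Subtype.val x)) hb (fun a f => ?_) Y y1 y2 (by exact_mod_cast y3) (by exact_mod_cast q1) (by exact_mod_cast q2) hAb
  refine hn3 _ (by omega) _ hH' _ (G_restrict Subtype.val Subtype.val_injective ?_ (hW.2.1 a f))
  calc (s:ℝ) * _ ≤ s * (1 / (2 * (s:ℝ)^(d+r+1)) / s) := mul_le_mul_of_nonneg_left (hq.trans σ3) hspos.le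
    _ = 1 / (2 * (s:ℝ)^(d+r+1)) := by field_simp
end
end TH

open Finset
set_option linter.all false
namespace TH
open scoped Classical
noncomputable section

lemma par_ex (d r : ℕ) (hd : 0 < d) (hr : 0 < r) (μ : ℝ) (hμ : 0 < μ) :
    ∃ ν, Par d r ((2:ℝ)^(-(1:ℝ)/(r:ℝ)) + μ/4) ν := by
  set c : ℝ := (2:ℝ)^(-(1:ℝ)/(r:ℝ)) with hc
  have hrr : (0:ℝ) < r := by exact_mod_cast hr
  have hr1 : (1:ℝ) ≤ r := by exact_mod_cast hr
  have hc0 : 0 < c := by positivity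
  have hcr : c^r = 1/2 := by
    rw [hc, ← Real.rpow_natCast, ← Real.rpow_mul (by norm_num), div_mul_cancel₀ _ hrr.ne', Real.rpow_neg_one]; norm_num
  have hc1 : 1/2 ≤ c := by
    have : (2:ℝ)^(-1:ℝ) ≤ c := by
      refine Real.rpow_le_rpow_of_exponent_le (by norm_num) ?_
      rw [le_div_iff₀ hrr]; linarith
    rw [Real.rpow_neg_one] at this; linarith
  have hc2 : (r:ℝ) ≤ c * (r+1) := by
    by_contra h
    push Not at h
    have h1 : (c * (r+1))^r < (r:ℝ)^r := pow_lt_pow_left₀ h (by positivity) (by omega)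
    have h2 : 2 * (r:ℝ)^r ≤ (r+1)^r := by
      have := one_add_mul_le_pow (a := (1:ℝ)/r) (by have : (0:ℝ) ≤ 1/r := by positivity
                                                    linarith) r
      rw [mul_one_div_cancel hrr.ne'] at this
      calc 2 * (r:ℝ)^r ≤ (1+1/r)^r * r^r := by gcongr; linarith
        _ = _ := by rw [← mul_pow]; congr 1; field_simp
    rw [mul_pow, hcr] at h1
    linarith
  have hpos : 1/2 < (c+μ/4)^r := by
    rw [← hcr]; exact pow_lt_pow_left₀ (by linarith) hc0.le (by omega)
  refine ⟨min ((c+μ/4)^r - 1/2) (μ/4), hr, hd, by positivity, ?_, ?_, ?_, ?_⟩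
  · rw [lt_min_iff]; exact ⟨by linarith, by positivity⟩
  · have := min_le_left ((c+μ/4)^r - 1/2) (μ/4); linarith
  · have := min_le_right ((c+μ/4)^r - 1/2) (μ/4); linarith
  · have hd1 : (1:ℝ) ≤ d := by exact_mod_cast hd
    have h1 : c * (r+1) ≤ c * (d+r) := by apply mul_le_mul_of_nonneg_left _ hc0.le; linarith
    have h2 : c * (d+r) ≤ (c+μ/4) * (d+r) := by apply mul_le_mul_of_nonneg_right _ (by positivity); linarith
    linarith

def HE {B : Type} (V : Finset B) (E : Finset (Finset B)) (k : ℕ) (x : Fin k → {v // v ∈ V}) : Prop :=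
  Function.Injective x ∧ ∃ e ∈ E, ∀ b, b ∈ e ↔ ∃ j, (x j).1 = b

lemma host_ex (d r : ℕ) (hr : 0 < r) (c μ : ℝ) (hc : 0 < c) (hμ : 0 < μ) : ∃ n0 : ℕ, ∀ (B : Type) [DecidableEq B] (V : Finset B) (E : Finset (Finset B)),
    n0 ≤ V.card → (∀ e ∈ E, e ⊆ V ∧ e.card = d + r) →
    (∀ S ⊆ V, S.card = d → (c+μ) * (((V.card - d).choose r : ℕ):ℝ) ≤ ((E.filter fun e => S ⊆ e).card : ℝ)) →
    Host d r (c + μ/2) (HE V E (d+r)) := by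
  obtain ⟨n1, hn1⟩ := exists_nat_gt ((c+μ) * (r * (d+r)) * 2 / μ)
  refine ⟨n1 + d + r + 1, fun B _ V E hn hE hdeg => ⟨?_, fun x h => h.1, fun S hS => ?_⟩⟩
  · rintro x σ ⟨h1, e, he, h2⟩
    refine ⟨h1.comp σ.injective, e, he, fun b => (h2 b).trans ?_⟩
    constructor
    · rintro ⟨j, h⟩; exact ⟨σ.symm j, by simpa using h⟩
    · rintro ⟨j, h⟩; exact ⟨σ j, h⟩
  set Ss : Finset B := univ.image fun j => (S j).1 with hSs
  have hSV : Ss ⊆ V := by intro b hb; obtain ⟨j, -, rfl⟩ := mem_image.1 hb; exact (S j).2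
  have hSc : Ss.card = d := by
    rw [hSs, card_image_of_injective _ (fun i j h => hS (Subtype.ext h))]; simp
  have h0 := hdeg Ss hSV hSc
  -- enumerations
  have hen : ∀ e : {e // e ∈ E.filter fun e => Ss ⊆ e}, ∃ b : Fin r → {v // v ∈ V}, Function.Injective b ∧ ∀ v, v ∈ e.1 \ Ss ↔ ∃ j, (b j).1 = v := by
    rintro ⟨e, he⟩
    obtain ⟨heE, hSe⟩ := mem_filter.1 he
    have hcard : (e \ Ss).card = r := by rw [card_sdiff_of_subset hSe, hSc, (hE e heE).2]; omega
    let q := (e \ Ss).equivFinOfCardEq hcard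
    refine ⟨fun j => ⟨(q.symm j).1, (hE e heE).1 (mem_sdiff.1 (q.symm j).2).1⟩, fun i j h => ?_, fun v => ⟨fun hv => ⟨q ⟨v, hv⟩, by simp⟩, ?_⟩⟩
    · have := congrArg Subtype.val h
      exact q.symm.injective (Subtype.ext this)
    · rintro ⟨j, rfl⟩; exact (q.symm j).2
  choose en en1 en2 using hen
  have hcount : (E.filter fun e => Ss ⊆ e).card * r.factorial ≤ #{b : Fin r → {v // v ∈ V} | HE V E (d+r) (Fin.append S b)} := by
    have h1 : Fintype.card ({e // e ∈ E.filter fun e => Ss ⊆ e} × Equiv.Perm (Fin r)) = (E.filter fun e => Ss ⊆ e).card * r.factorial := by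
      rw [Fintype.card_prod, Fintype.card_coe, Fintype.card_perm, Fintype.card_fin]
    rw [← h1, ← card_univ]
    refine Finset.card_le_card_of_injOn (fun p => en p.1 ∘ p.2) (fun p _ => ?_) ?_
    · simp only [coe_filter, mem_univ, true_and, Set.mem_setOf_eq]
      obtain ⟨heE, hSe⟩ := mem_filter.1 p.1.2
      constructor
      · rw [Fin.append_injective_iff]
        refine ⟨hS, (en1 p.1).comp p.2.injective, fun i j h => ?_⟩
        have := (en2 p.1 _).2 ⟨p.2 j, rfl⟩
        refine (mem_sdiff.1 this).2 ?_
        exact mem_image.2 ⟨i, mem_univ _, congrArg Subtype.val h⟩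
      · refine ⟨p.1.1, heE, fun v => ⟨fun hv => ?_, ?_⟩⟩
        · by_cases hvS : v ∈ Ss
          · obtain ⟨j, -, rfl⟩ := mem_image.1 hvS
            exact ⟨Fin.castAdd r j, by rw [Fin.append_left]⟩
          · obtain ⟨j, rfl⟩ := (en2 p.1 v).1 (mem_sdiff.2 ⟨hv, hvS⟩)
            exact ⟨Fin.natAdd d (p.2.symm j), by rw [Fin.append_right]; simp⟩
        · rintro ⟨j, rfl⟩
          refine Fin.addCases (fun i => ?_) (fun i => ?_) j
          · rw [Fin.append_left]; exact hSe (mem_image.2 ⟨i, mem_univ _, rfl⟩)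
          · rw [Fin.append_right]; exact (mem_sdiff.1 ((en2 p.1 _).2 ⟨p.2 i, rfl⟩)).1
    · rintro ⟨e, σ⟩ - ⟨e', σ'⟩ - h
      have h : en e ∘ σ = en e' ∘ σ' := h
      have hee : e = e' := by
        have hsd : e.1 \ Ss = e'.1 \ Ss := by
          ext v
          rw [en2, en2]
          constructor
          · rintro ⟨j, rfl⟩
            refine ⟨σ' (σ.symm j), ?_⟩
            have := congrFun h (σ.symm j); simp at this; rw [this]
          · rintro ⟨j, rfl⟩
            refine ⟨σ (σ'.symm j), ?_⟩
            have := congrFun h (σ'.symm j); simp at this; rw [this]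
        apply Subtype.ext
        rw [← sdiff_union_of_subset (mem_filter.1 e.2).2, hsd, sdiff_union_of_subset (mem_filter.1 e'.2).2]
      subst hee
      congr 1
      ext j
      exact congrArg Fin.val (en1 e (congrFun h j))
  set n := V.card with hnV
  have hnpos : (0:ℝ) < n := by exact_mod_cast (by omega : 0 < n)
  have hcd : Fintype.card {v // v ∈ V} = n := by rw [Fintype.card_coe]
  have hpr : pr (fun b : Fin r → {v // v ∈ V} => HE V E (d+r) (Fin.append S b)) = (#{b : Fin r → {v // v ∈ V} | HE V E (d+r) (Fin.append S b)} : ℝ) / (n:ℝ)^r := by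
    rw [pr_card]
    simp [hcd]
  rw [hpr, le_div_iff₀ (by positivity)]
  have h3 : ((n - d - r : ℕ):ℝ)^r ≤ (r.factorial : ℝ) * ((n-d).choose r : ℕ) := by
    have h4 : (n - d - r)^r ≤ r.factorial * (n-d).choose r := by
      rw [← Nat.descFactorial_eq_factorial_mul_choose]
      exact (Nat.pow_le_pow_left (by omega) r).trans (Nat.pow_sub_le_descFactorial (n-d) r)
    exact_mod_cast h4
  have h5 : (((E.filter fun e => Ss ⊆ e).card : ℕ):ℝ) * r.factorial ≤ (#{b : Fin r → {v // v ∈ V} | HE V E (d+r) (Fin.append S b)} : ℝ) := by exact_mod_cast hcount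
  have h6 : (c+μ) * ((n - d - r : ℕ):ℝ)^r ≤ (((E.filter fun e => Ss ⊆ e).card : ℕ):ℝ) * r.factorial := by
    calc (c+μ) * ((n - d - r : ℕ):ℝ)^r ≤ (c+μ) * ((r.factorial : ℝ) * ((n-d).choose r : ℕ)) := mul_le_mul_of_nonneg_left h3 (by positivity)
      _ = (c+μ) * ((n-d).choose r : ℕ) * r.factorial := by ring
      _ ≤ _ := mul_le_mul_of_nonneg_right h0 (by positivity)
  refine le_trans ?_ (h6.trans h5)
  have h7 : ((n - d - r : ℕ):ℝ) = n * (1 + -((d+r)/n)) := by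
    rw [Nat.cast_sub (by omega), Nat.cast_sub (by omega)]; field_simp; ring
  have h8 : 1 + (r:ℝ) * (-((d+r)/n)) ≤ (1 + -((d+r)/n))^r := by
    apply one_add_mul_le_pow
    have : ((d:ℝ)+r)/n ≤ 1 := by rw [div_le_one hnpos]; exact_mod_cast (by omega : d + r ≤ n)
    linarith
  rw [h7, mul_pow]
  have h9 : c + μ/2 ≤ (c+μ) * (1 + (r:ℝ) * (-((d+r)/n))) := by
    have : (c+μ) * (r * ((d+r)/n)) ≤ μ/2 := by
      rw [div_lt_iff₀ hμ] at hn1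
      have hnn : (n1:ℝ) * μ ≤ n * μ := by
        apply mul_le_mul_of_nonneg_right _ hμ.le; exact_mod_cast (by omega : n1 ≤ n)
      have : (c+μ) * (r * ((d+r)/n)) = (c+μ) * (r * (d+r)) / n := by ring
      rw [this, div_le_iff₀ hnpos]
      linarith
    linarith
  calc (c+μ/2) * (n:ℝ)^r ≤ ((c+μ) * (1 + (r:ℝ) * (-((d+r)/n)))) * (n:ℝ)^r := mul_le_mul_of_nonneg_right h9 (by positivity)
    _ ≤ ((c+μ) * ((1 + -((d+r)/n))^r)) * (n:ℝ)^r := by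
      apply mul_le_mul_of_nonneg_right _ (by positivity)
      exact mul_le_mul_of_nonneg_left h8 (by positivity)
    _ = _ := by ring

lemma window {U : Type} {k : ℕ} {H : (Fin k → U) → Prop} {lc m' : List U} {row : Fin k → U} (hl : lc = List.ofFn row ++ m') (ht : TP H (lc ++ List.ofFn row))
    (i : ℕ) (hi : i < lc.length) : ∃ x : Fin k → U, H x ∧ (lc.rotate i).take k = List.ofFn x := by
  have hkl : k ≤ lc.length := by rw [hl]; simp
  have hpos : 0 < lc.length := by omega
  refine ⟨fun t => lc[(t.1+i) % lc.length]'(Nat.mod_lt _ hpos), ?_, ?_⟩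
  · refine ht i _ fun t => ?_
    have htk := t.2
    by_cases h : i + t.1 < lc.length
    · rw [List.getElem?_append_left h, ← List.getElem?_eq_getElem]
      congr 1
      rw [Nat.mod_eq_of_lt (by omega)]; omega
    · rw [List.getElem?_append_right (by omega), ← List.getElem?_eq_getElem]
      have h2 : (t.1 + i) % lc.length = i + t.1 - lc.length := by
        rw [Nat.mod_eq_sub_mod (by omega), Nat.mod_eq_of_lt (by omega)]; omega
      rw [h2]
      have h3 : ∀ q < k, (List.ofFn row)[q]? = lc[q]? := by
        intro q hq
        conv_rhs => rw [hl]
        rw [List.getElem?_append_left (by rw [List.length_ofFn]; exact hq)]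
      exact h3 _ (by omega)
  · apply List.ext_getElem
    · simp [hkl]
    · intro j h1 h2
      simp [List.getElem_rotate]

lemma bridge (d r : ℕ) (hd : 0 < d) (hr : 0 < r) (μ : ℝ) (hμ : 0 < μ) : ∃ n0 : ℕ, ∀ (B : Type) [DecidableEq B] (V : Finset B) (E : Finset (Finset B)),
    n0 ≤ V.card → (∀ e ∈ E, e ⊆ V ∧ e.card = d + r) →
    (∀ S ⊆ V, S.card = d → ((2:ℝ)^(-(1:ℝ)/(r:ℝ))+μ) * (((V.card - d).choose r : ℕ):ℝ) ≤ ((E.filter fun e => S ⊆ e).card : ℝ)) →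
    ∃ w : List B, w.Nodup ∧ w.toFinset = V ∧ d + r ≤ w.length ∧ ∀ i < w.length, ((w.rotate i).take (d+r)).toFinset ∈ E := by
  obtain ⟨ν, hp⟩ := par_ex d r hd hr μ hμ
  obtain ⟨n1, hn1⟩ := host_ex d r hr ((2:ℝ)^(-(1:ℝ)/(r:ℝ))) μ (by positivity) hμ
  obtain ⟨n2, hn2⟩ := cycle d r _ ν (μ/4) hp (by positivity)
  refine ⟨n1+n2, fun B _ V E hn hE hdeg => ?_⟩
  have hH := hn1 B V E (by omega) hE hdeg
  obtain ⟨lc, row, m', h1, h2, h3, h4⟩ := hn2 {v // v ∈ V} (by rw [Nat.card_eq_fintype_card, Fintype.card_coe]; omega) _ (by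
    convert hH using 1; ring)
  refine ⟨lc.map Subtype.val, h1.map Subtype.val_injective, ?_, ?_, ?_⟩
  · ext v
    simp [h2]
  · rw [List.length_map, h3]; simp
  · intro i hi
    rw [List.length_map] at hi
    obtain ⟨x, ⟨-, e, he, hx⟩, hw⟩ := window h3 h4 i hi
    rw [← List.map_rotate, ← List.map_take, hw]
    convert he
    ext b
    rw [hx b]
    simp
end
end TH


/-- `hc_d(k) ≤ 2^(-1/(k-d))`. -/
theorem tight_hamilton_threshold_general (k d : ℕ) (hk : 2 ≤ k) (hd : 1 ≤ d) (hdk : d ≤ k - 1)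
    (μ : ℝ) (hμ : 0 < μ) :
    ∃ n₀ : ℕ, ∀ (B : Type) [DecidableEq B], ∀ (V : Finset B) (E : Finset (Finset B)),
      n₀ ≤ V.card → (∀ e ∈ E, e ⊆ V ∧ e.card = k) →
      (∀ S ⊆ V, S.card = d →
        ((2 : ℝ) ^ (-(1 : ℝ) / ((k : ℝ) - (d : ℝ))) + μ)
            * (((V.card - d).choose (k - d) : ℕ) : ℝ)
          ≤ ((E.filter fun e => S ⊆ e).card : ℝ)) →
      HasTightHamCycle k V E := by
  obtain ⟨r, rfl⟩ : ∃ r, k = d + r := ⟨k - d, by omega⟩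
  obtain ⟨n0, h⟩ := TH.bridge d r (by omega) (by omega) μ hμ
  refine ⟨n0, fun B _ V E hn hE hdeg => ?_⟩
  have e1 : d + r - d = r := by omega
  have e2 : ((d + r : ℕ):ℝ) - (d:ℝ) = r := by push_cast; ring
  rw [e1, e2] at hdeg
  obtain ⟨w, h1, h2, h3, h4⟩ := h B V E hn hE hdeg
  exact ⟨w, h1, h2, h3, h4⟩
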